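/- arXiv:2308.10853 — 2 statements merged into one kernel-verified Lean document; each statement's English description precedes it below -/
import Mathlib

section
/- Let q be an odd prime power, d ≥ 2, and let Q be a non-degenerate quadratic form on F_q^d. Let n, t be positive integers and let A ⊆ F_q^d satisfy |A| ≥ 12 n² q^{(d-1)/2 + t} (as real numbers, with real exponent). Then for every distance graph G on n vertices with maximum vertex degree t, there exists an injective map ι from the vertex set of G into A such that Q(ι(v) − ι(w)) = λ_e whenever e is an edge of G joining v and w. -/
namespace DG
open Polynomial


/-- Independence lemma: the heart of the Stepanov argument. -/
theorem indep_core {E : Type*} [Field E] {p m : ℕ} [Fact p.Prime] [CharP E p]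
    (h : E[X]) (h0 : h.coeff 0 ≠ 0)
    (hns : ∀ (c : E) (A B : E[X]), c ≠ 0 → A ^ 2 = C c * h * B ^ 2 → B = 0)
    (hodd : Odd (p ^ m)) (L : ℕ) (hL : 2 * L + h.natDegree < p ^ m)
    (A B : E[X]) (hA : A.natDegree ≤ L) (hB : B.natDegree ≤ L)
    (hdvd : (X : E[X]) ^ (p ^ m) ∣ A + B * h ^ ((p ^ m + 1) / 2)) : A = 0 ∧ B = 0 := by
  set r := p ^ m with hr
  have hH : (h ^ ((r + 1) / 2)) ^ 2 = h * h ^ r := by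
    rw [← pow_mul, ← pow_succ']
    congr 1
    obtain ⟨k, hk⟩ := hodd
    omega
  set c := (h.coeff 0) ^ r with hc
  have hc0 : c ≠ 0 := pow_ne_zero _ h0
  have h1 : (X : E[X]) ^ r ∣ h ^ r - C c := by
    have : h ^ r - C c = (h - C (h.coeff 0)) ^ r := by
      rw [hr, sub_pow_char_pow, hc, C_pow]
    rw [this]
    apply pow_dvd_pow_of_dvd
    rw [X_dvd_iff]; simp
  have h2 : (X : E[X]) ^ r ∣ A ^ 2 - C c * h * B ^ 2 := by
    have e : A ^ 2 - C c * h * B ^ 2 = (A + B * h ^ ((r + 1) / 2)) * (A - B * h ^ ((r + 1) / 2))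
        + (h ^ r - C c) * (h * B ^ 2) := by
      have : (A + B * h ^ ((r + 1) / 2)) * (A - B * h ^ ((r + 1) / 2)) =
        A ^ 2 - B ^ 2 * (h ^ ((r + 1) / 2)) ^ 2 := by ring
      rw [this, hH]; ring
    rw [e]
    exact dvd_add (hdvd.mul_right _) (h1.mul_right _)
  have h3 : A ^ 2 - C c * h * B ^ 2 = 0 := by
    apply Polynomial.eq_zero_of_dvd_of_natDegree_lt h2
    rw [natDegree_X_pow]
    refine lt_of_le_of_lt (natDegree_sub_le _ _) ?_
    have a1 : (A ^ 2).natDegree ≤ 2 * L := (natDegree_pow_le).trans (by gcongr)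
    have a2 : (C c * h * B ^ 2).natDegree ≤ h.natDegree + 2 * L := by
      refine natDegree_mul_le.trans ?_
      exact add_le_add (natDegree_C_mul_le _ _) ((natDegree_pow_le).trans (by gcongr))
    have := max_le (a1.trans (Nat.le_add_left _ h.natDegree)) a2
    omega
  have hB0 : B = 0 := hns c A B hc0 (sub_eq_zero.1 h3)
  refine ⟨?_, hB0⟩
  rw [hB0] at h3
  simpa using h3

theorem indep_sum {E : Type*} [Field E] {p m : ℕ} [Fact p.Prime] [CharP E p]
    (h : E[X]) (h0 : h.coeff 0 ≠ 0)
    (hns : ∀ (c : E) (A B : E[X]), c ≠ 0 → A ^ 2 = C c * h * B ^ 2 → B = 0)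
    (hodd : Odd (p ^ m)) (L : ℕ) (hL : 2 * L + h.natDegree < p ^ m) (M : ℕ)
    (A B : ℕ → E[X]) (hA : ∀ j, (A j).natDegree ≤ L) (hB : ∀ j, (B j).natDegree ≤ L)
    (hsum : ∑ j ∈ Finset.range M, X ^ (j * p ^ m) * (A j + B j * h ^ ((p ^ m + 1) / 2)) = 0) :
    ∀ j < M, A j = 0 ∧ B j = 0 := by
  induction M generalizing A B with
  | zero => intro j hj; omega
  | succ M ih =>
    rw [Finset.sum_range_succ'] at hsum
    have e : ∑ k ∈ Finset.range M, X ^ ((k + 1) * p ^ m) * (A (k + 1) + B (k + 1) * h ^ ((p ^ m + 1) / 2))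
        = X ^ (p ^ m) * ∑ k ∈ Finset.range M, X ^ (k * p ^ m) * (A (k + 1) + B (k + 1) * h ^ ((p ^ m + 1) / 2)) := by
      rw [Finset.mul_sum]
      refine Finset.sum_congr rfl fun k _ => ?_
      ring
    rw [e] at hsum
    have hd : (X : E[X]) ^ (p ^ m) ∣ A 0 + B 0 * h ^ ((p ^ m + 1) / 2) := by
      have : A 0 + B 0 * h ^ ((p ^ m + 1) / 2) = X ^ (p ^ m) * -(∑ k ∈ Finset.range M, X ^ (k * p ^ m) * (A (k + 1) + B (k + 1) * h ^ ((p ^ m + 1) / 2))) := by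
        rw [mul_neg, eq_neg_iff_add_eq_zero, ← hsum]; simp; ring
      rw [this]; exact dvd_mul_right _ _
    have h00 := indep_core h h0 hns hodd L hL (A 0) (B 0) (hA 0) (hB 0) hd
    rw [h00.1, h00.2] at hsum
    simp only [zero_mul, add_zero, mul_zero] at hsum
    have hs := (mul_eq_zero.1 hsum).resolve_left (pow_ne_zero _ X_ne_zero)
    have := ih (fun k => A (k + 1)) (fun k => B (k + 1)) (fun _ => hA _) (fun _ => hB _) hs
    intro j hj
    cases j with
    | zero => exact h00
    | succ j => exact this j (by omega)


theorem stepanov {E : Type*} [Field E] [Fintype E] {p m : ℕ} [Fact p.Prime] [CharP E p]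
    (h : E[X]) (h0 : h.coeff 0 ≠ 0)
    (hns : ∀ (c : E) (A B : E[X]), c ≠ 0 → A ^ 2 = C c * h * B ^ 2 → B = 0)
    (hodd : Odd (p ^ m)) (hcard : Fintype.card E = (p ^ m) ^ 2)
    (hbig : 2 * h.natDegree + 2 ≤ p ^ m) (S : Finset E)
    (hS : ∀ y ∈ S, (h.eval y) ^ (p ^ m * ((p ^ m + 1) / 2)) = (h.eval y) ^ ((p ^ m + 1) / 2)) :
    2 * S.card ≤ (p ^ m) ^ 2 + (4 * h.natDegree + 4) * p ^ m := by
  classical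
  set r := p ^ m with hr
  set δ := h.natDegree with hδ
  set s := (r + 1) / 2 with hs
  set K := r / 4 with hK
  set M := s + δ + 1 with hM
  have hs2 : 2 * s = r + 1 := by obtain ⟨k, hk⟩ := hodd; omega
  have hKr : 4 * K ≤ r := by omega
  have hKr' : r + 1 ≤ 4 * (K + 1) := by omega
  set D := K * r + M + δ * s with hD
  have hDlt : D < 2 * (M * (K + 1)) := by
    have e1 : 2 * (M * (K + 1)) = K * r + r + (2 * δ + 3) * (K + 1) := by
      have : 2 * M = r + 1 + 2 * δ + 2 := by omega
      calc 2 * (M * (K + 1)) = (2 * M) * (K + 1) := by ring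
        _ = _ := by rw [this]; ring
    have e2 : (2 * δ + 3) * (r + 1) ≤ (2 * δ + 3) * (4 * (K + 1)) := Nat.mul_le_mul_left _ hKr'
    have e3 : 2 * (δ * s) = δ * (r + 1) := by rw [← hs2]; ring
    rw [e1, hD]
    nlinarith
  -- the linear map
  let Tj : (Fin M × Fin (K + 1) → E) × (Fin M × Fin (K + 1) → E) → E[X] := fun φ =>
    ∑ j : Fin M, X ^ (j : ℕ) * (∑ k : Fin (K + 1), C (φ.1 (j, k)) * X ^ ((k : ℕ) * r) +
      (∑ k : Fin (K + 1), C (φ.2 (j, k)) * X ^ ((k : ℕ) * r)) * h ^ s)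
  have hTdeg : ∀ φ, (Tj φ).degree < D := by
    intro φ
    have hin : ∀ (f : Fin M × Fin (K + 1) → E) (j : Fin M),
        (∑ k : Fin (K + 1), C (f (j, k)) * X ^ ((k : ℕ) * r)).natDegree ≤ K * r := by
      intro f j
      refine natDegree_sum_le_of_forall_le _ _ fun k _ => ?_
      refine (natDegree_C_mul_X_pow_le _ _).trans ?_
      exact Nat.mul_le_mul_right _ (by have := k.2; omega)
    refine (Polynomial.degree_sum_le _ _).trans_lt ?_
    rw [Finset.sup_lt_iff (WithBot.bot_lt_coe _)]
    intro j _
    refine lt_of_le_of_lt Polynomial.degree_le_natDegree ?_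
    rw [Nat.cast_lt]
    refine lt_of_le_of_lt natDegree_mul_le ?_
    rw [natDegree_X_pow]
    have b1 : (∑ k : Fin (K + 1), C (φ.1 (j, k)) * X ^ ((k : ℕ) * r) +
      (∑ k : Fin (K + 1), C (φ.2 (j, k)) * X ^ ((k : ℕ) * r)) * h ^ s).natDegree ≤ K * r + δ * s := by
      refine (natDegree_add_le _ _).trans (max_le ((hin _ _).trans (Nat.le_add_right _ _)) ?_)
      refine natDegree_mul_le.trans (add_le_add (hin _ _) ?_)
      rw [mul_comm δ s]
      exact natDegree_pow_le
    have := j.2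
    omega
  let T : ((Fin M × Fin (K + 1) → E) × (Fin M × Fin (K + 1) → E)) →ₗ[E] (Fin D → E) :=
    { toFun := fun φ i => (Tj φ).coeff i
      map_add' := by
        intro φ φ'
        ext i
        simp only [Tj, Pi.add_apply, Prod.fst_add, Prod.snd_add, C_add, add_mul, mul_add,
          Finset.sum_add_distrib, coeff_add]
        ring
      map_smul' := by
        intro c φ
        ext i
        have : Tj (c • φ) = C c * Tj φ := by
          simp only [Tj, Prod.smul_fst, Prod.smul_snd, Pi.smul_apply, smul_eq_mul, C_mul,
            Finset.mul_sum, mul_add, Finset.sum_mul]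
          refine Finset.sum_congr rfl fun j _ => ?_
          congr 1 <;> refine Finset.sum_congr rfl fun k _ => ?_ <;> ring
        simp only [this, coeff_C_mul, RingHom.id_apply, Pi.smul_apply, smul_eq_mul] }
  have hker : LinearMap.ker T ≠ ⊥ := by
    apply LinearMap.ker_ne_bot_of_finrank_lt
    simp only [Module.finrank_prod, Module.finrank_fintype_fun_eq_card, Fintype.card_fin,
      Fintype.card_prod]
    omega
  obtain ⟨φ, hφT, hφ0⟩ := (Submodule.ne_bot_iff _).1 hker
  have hT0 : Tj φ = 0 := by
    ext i
    by_cases hi : i < D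
    · have := congrFun (LinearMap.mem_ker.1 hφT) ⟨i, hi⟩
      simpa [T] using this
    · exact coeff_eq_zero_of_degree_lt ((hTdeg φ).trans_le (by exact_mod_cast not_lt.1 hi))
  have hfrob : ∀ x : E, (x ^ r) ^ r = x := by
    intro x
    rw [← pow_mul, ← sq, ← hcard]; exact FiniteField.pow_card x
  let mk : (Fin M × Fin (K + 1) → E) → ℕ → E[X] := fun f j =>
    if hj : j < M then ∑ k : Fin (K + 1), C (f (⟨j, hj⟩, k) ^ r) * X ^ (k : ℕ) else 0
  have hmkdeg : ∀ f j, (mk f j).natDegree ≤ K := by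
    intro f j
    simp only [mk]
    split_ifs
    · refine natDegree_sum_le_of_forall_le _ _ fun k _ => ?_
      refine (natDegree_C_mul_X_pow_le _ _).trans ?_
      have := k.2; omega
    · simp
  have hmkpow : ∀ f (j : Fin M), (mk f j) ^ r = ∑ k : Fin (K + 1), C (f (j, k)) * X ^ ((k : ℕ) * r) := by
    intro f j
    simp only [mk, j.2, dif_pos]
    rw [hr, sum_pow_char_pow, ← hr]
    refine Finset.sum_congr rfl fun k _ => ?_
    rw [mul_pow, ← C_pow, hfrob, ← pow_mul]
  set P : E[X] := ∑ j ∈ Finset.range M, X ^ (j * r) * (mk φ.1 j + mk φ.2 j * h ^ s) with hP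
  have hP0 : P ≠ 0 := by
    intro h00
    have hall := indep_sum (p := p) (m := m) h h0 hns hodd K (by omega) M (mk φ.1) (mk φ.2)
      (hmkdeg _) (hmkdeg _) h00
    apply hφ0
    have hz : ∀ f : Fin M × Fin (K + 1) → E, (∀ j < M, mk f j = 0) → f = 0 := by
      intro f hf
      ext ⟨j, k⟩
      have h1 := hf j j.2
      have h2 := hmkpow f j
      have h3 : (mk f j).coeff k = f (j, k) ^ r := by
        simp only [mk, j.2, dif_pos, finsetSum_coeff, coeff_C_mul_X_pow]
        rw [Finset.sum_eq_single k]
        · simp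
        · intro b _ hb
          rw [if_neg]
          intro h; exact hb (Fin.ext h.symm)
        · simp
      rw [h1, coeff_zero] at h3
      have := hfrob (f (j, k))
      rw [← h3, zero_pow (by omega)] at this
      simpa using this.symm
    exact Prod.ext (hz _ fun j hj => (hall j hj).1) (hz _ fun j hj => (hall j hj).2)
  have hroot : ∀ y ∈ S, P.eval y = 0 := by
    intro y hy
    have h1 : (P.eval y) ^ r = (Tj φ).eval y := by
      simp only [hP, Tj, eval_finsetSum, eval_mul, eval_add, eval_pow, eval_X]
      rw [hr, sum_pow_char_pow, ← hr, ← Fin.sum_univ_eq_sum_range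
        (fun j => (y ^ (j * r) * (eval y (mk φ.1 j) + eval y (mk φ.2 j) * eval y h ^ s)) ^ r) M]
      refine Finset.sum_congr rfl fun j _ => ?_
      rw [mul_pow, mul_comm (j : ℕ) r, pow_mul, pow_right_comm, hfrob, hr, add_pow_char_pow, ← hr,
        mul_pow, ← eval_pow, ← eval_pow, hmkpow, hmkpow, ← pow_mul, mul_comm s r, hS y hy]
      simp only [eval_finsetSum, eval_mul, eval_pow, eval_X, eval_C]
    rw [hT0, eval_zero] at h1
    exact pow_eq_zero_iff (by omega) |>.1 h1
  have hcardS : S.card ≤ P.natDegree := by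
    have hsub : S ⊆ P.roots.toFinset := by
      intro y hy
      rw [Multiset.mem_toFinset, mem_roots hP0]
      exact hroot y hy
    exact (Finset.card_le_card hsub).trans ((Multiset.toFinset_card_le _).trans (card_roots' _))
  have hPdeg : P.natDegree ≤ M * r + (K + δ * s) := by
    refine natDegree_sum_le_of_forall_le _ _ fun j hj => ?_
    refine natDegree_mul_le.trans ?_
    rw [natDegree_X_pow]
    refine add_le_add (Nat.mul_le_mul_right _ (Finset.mem_range.1 hj).le) ?_
    refine (natDegree_add_le _ _).trans (max_le ((hmkdeg _ _).trans (Nat.le_add_right _ _)) ?_)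
    refine natDegree_mul_le.trans (add_le_add (hmkdeg _ _) ?_)
    rw [mul_comm δ s]
    exact natDegree_pow_le
  have e3 : 2 * (δ * s) = δ * (r + 1) := by rw [← hs2]; ring
  have e4 : 2 * (M * r) = (r + 1 + 2 * δ + 2) * r := by
    have : 2 * M = r + 1 + 2 * δ + 2 := by omega
    rw [← this]; ring
  have : S.card ≤ M * r + (K + δ * s) := hcardS.trans hPdeg
  nlinarith

end DG

namespace DG
open Polynomial
theorem hpoly_props {E : Type*} [Field E] {p : ℕ} [hp : Fact p.Prime] [CharP E p] (hp2 : p ≠ 2)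
    (ε u D : E) (hε : ε ≠ 0) (hD : D ≠ 0) :
    (C ε * ((X ^ p - X + C u) ^ 2 - C D) : E[X]).natDegree = 2 * p ∧
    ∀ (c : E) (A B : E[X]), c ≠ 0 →
      A ^ 2 = C c * (C ε * ((X ^ p - X + C u) ^ 2 - C D)) * B ^ 2 → B = 0 := by
  set U : E[X] := X ^ p - X + C u with hU
  have hUdeg : U.natDegree = p := by
    have h1 : 1 < p := hp.out.one_lt
    have : U = X ^ p + (-X + C u) := by rw [hU]; ring
    rw [this, natDegree_add_eq_left_of_natDegree_lt, natDegree_X_pow]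
    rw [natDegree_X_pow]
    refine lt_of_le_of_lt (natDegree_add_le _ _) ?_
    simp [h1, hp.out.pos]
  have hdeg : (C ε * (U ^ 2 - C D) : E[X]).natDegree = 2 * p := by
    rw [natDegree_C_mul hε, natDegree_sub_C, natDegree_pow, hUdeg]
  refine ⟨hdeg, ?_⟩
  have hU' : derivative U = -1 := by simp [hU, derivative_X_pow, CharP.cast_eq_zero]
  have h2 : (2 : E) ≠ 0 := by
    have : ringChar E ≠ 2 := by rw [ringChar.eq E p]; exact hp2
    exact Ring.two_ne_zero this
  have hsep : (C ε * (U ^ 2 - C D) : E[X]).Separable := by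
    refine ⟨C (-1 / (ε * D)), C (-1 / (2 * ε * D)) * U, ?_⟩
    simp only [derivative_mul, derivative_C, derivative_sub, derivative_pow, hU', zero_mul, zero_add,
      sub_zero]
    have e1 : C (-1 / (ε * D)) * (C ε * (U ^ 2 - C D)) +
        C (-1 / (2 * ε * D)) * U * (C ε * (C ((2 : ℕ) : E) * U ^ (2 - 1) * -1)) =
        (C (-1 / (ε * D) * ε) - C (-1 / (2 * ε * D) * ε * 2)) * U ^ 2 - C (-1 / (ε * D) * ε * D) := by
      simp only [C_mul]; push_cast; simp only [Nat.add_one_sub_one, pow_one]; ring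
    rw [e1]
    have a1 : -1 / (2 * ε * D) * ε * 2 = -1 / (ε * D) * ε := by field_simp
    have a2 : -1 / (ε * D) * ε * D = -1 := by field_simp
    rw [a1, a2]; simp
  intro c A B hc hAB
  by_contra hB
  have hdvd : B ∣ A := by
    rw [← UniqueFactorizationMonoid.pow_dvd_pow_iff_dvd (n := 2) two_ne_zero, hAB]; exact dvd_mul_left _ _
  obtain ⟨k, rfl⟩ := hdvd
  have hk : k ^ 2 = C c * (C ε * (U ^ 2 - C D)) := by
    have hB2 : B ^ 2 ≠ 0 := pow_ne_zero _ hB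
    apply mul_right_cancel₀ hB2
    rw [← hAB]; ring
  have hku : IsUnit k := by
    apply hsep.squarefree
    refine ⟨C c⁻¹, ?_⟩
    rw [← sq, hk]
    have : (C c * C c⁻¹ : E[X]) = 1 := by rw [← C_mul, mul_inv_cancel₀ hc, C_1]
    linear_combination (-(C ε * (U ^ 2 - C D))) * this
  have hd : (k ^ 2).natDegree = 2 * p := by rw [hk, natDegree_C_mul hc, hdeg]
  rw [natDegree_pow, natDegree_eq_zero_of_isUnit hku] at hd
  have := hp.out.pos
  omega

theorem pow_of_char {E : Type*} [Field E] [Fintype E] [DecidableEq E] {r : ℕ}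
    (hE : ringChar E ≠ 2) (hodd : Odd r)
    (hcard : Fintype.card E = r ^ 2) (g : E) (hg : quadraticChar E g ≠ -1) :
    g ^ (r * ((r + 1) / 2)) = g ^ ((r + 1) / 2) := by
  by_cases h0 : g = 0
  · subst h0
    have : 0 < r := hodd.pos
    rw [zero_pow, zero_pow]
    · omega
    · have : 0 < (r + 1) / 2 := by omega
      positivity
  have h1 : quadraticChar E g = 1 := (quadraticChar_dichotomy h0).resolve_right hg
  have h2 := quadraticChar_eq_pow_of_char_ne_two' hE g
  rw [h1, hcard] at h2
  have e : r * ((r + 1) / 2) = r ^ 2 / 2 + (r + 1) / 2 := by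
    obtain ⟨k, rfl⟩ := hodd
    have a : (2 * k + 1 + 1) / 2 = k + 1 := by omega
    have b : (2 * k + 1) ^ 2 / 2 = 2 * k * k + 2 * k := by
      have : (2 * k + 1) ^ 2 = 2 * (2 * k * k + 2 * k) + 1 := by ring
      omega
    rw [a, b]; ring
  rw [e, pow_add, ← h2]; simp

theorem char_sum_bound {E : Type*} [Field E] [Fintype E] [DecidableEq E] {p m : ℕ}
    [hp : Fact p.Prime] [CharP E p] (hp2 : p ≠ 2)
    (hcard : Fintype.card E = (p ^ m) ^ 2) (hbig : 4 * p + 2 ≤ p ^ m)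
    (u D : E) (hD : D ≠ 0) (hu : u ^ 2 ≠ D) :
    |∑ y : E, quadraticChar E ((y ^ p - y + u) ^ 2 - D)| ≤ (8 * p + 4) * (p : ℤ) ^ m := by
  have hE : ringChar E ≠ 2 := by rw [ringChar.eq E p]; exact hp2
  have hodd : Odd (p ^ m) := (hp.out.odd_of_ne_two hp2).pow
  set f : E → E := fun y => (y ^ p - y + u) ^ 2 - D with hf
  have key : ∀ ε : E, ε ≠ 0 → ∀ S : Finset E, (∀ y ∈ S, quadraticChar E (ε * f y) ≠ -1) →
      2 * S.card ≤ (p ^ m) ^ 2 + (8 * p + 4) * p ^ m := by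
    intro ε hε S hS
    obtain ⟨hdeg, hns⟩ := hpoly_props (p := p) hp2 ε u D hε hD
    have := stepanov (p := p) (m := m) (C ε * ((X ^ p - X + C u) ^ 2 - C D) : E[X]) ?_ hns hodd hcard
      (by rw [hdeg]; omega) S ?_
    · rw [hdeg] at this
      convert this using 2
      ring
    · rw [coeff_zero_eq_eval_zero]
      simp [hε, hp.out.ne_zero, sub_eq_zero, hu]
    · intro y hy
      have e : (C ε * ((X ^ p - X + C u) ^ 2 - C D) : E[X]).eval y = ε * f y := by simp [hf]
      rw [e]
      exact pow_of_char hE hodd hcard _ (hS y hy)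
  obtain ⟨η, hη⟩ := quadraticChar_exists_neg_one hE
  have hη0 : η ≠ 0 := by rintro rfl; simp at hη
  have k1 := key 1 one_ne_zero (Finset.univ.filter fun y => quadraticChar E (f y) ≠ -1) (by simp)
  have k2 := key η hη0 (Finset.univ.filter fun y => quadraticChar E (f y) ≠ 1) (by
    intro y hy
    simp only [Finset.mem_filter, Finset.mem_univ, true_and] at hy
    rw [map_mul, hη]
    intro h; apply hy; linarith)
  -- express the sum
  have hval : ∀ g : E, quadraticChar E g =
      (if quadraticChar E g ≠ -1 then 1 else 0) - (if quadraticChar E g ≠ 1 then 1 else 0) := by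
    intro g
    rcases quadraticChar_isQuadratic E g with h | h | h <;> rw [h] <;> simp
  have hsum : ∑ y : E, quadraticChar E (f y) =
      ((Finset.univ.filter fun y => quadraticChar E (f y) ≠ -1).card : ℤ) -
      ((Finset.univ.filter fun y => quadraticChar E (f y) ≠ 1).card : ℤ) := by
    rw [Finset.card_filter, Finset.card_filter]
    push_cast
    rw [← Finset.sum_sub_distrib]
    exact Finset.sum_congr rfl fun y _ => hval _
  have hge : (p ^ m) ^ 2 ≤ (Finset.univ.filter fun y => quadraticChar E (f y) ≠ -1).card +
      (Finset.univ.filter fun y => quadraticChar E (f y) ≠ 1).card := by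
    rw [← hcard, ← Finset.card_univ]
    refine le_trans (Finset.card_le_card ?_) (Finset.card_union_le _ _)
    intro y _
    simp only [Finset.mem_union, Finset.mem_filter, Finset.mem_univ, true_and]
    by_cases h : quadraticChar E (f y) = 1
    · left; rw [h]; decide
    · right; exact h
  show |∑ y : E, quadraticChar E (f y)| ≤ _
  rw [hsum, abs_le]
  have k1' : (2 : ℤ) * ((Finset.univ.filter fun y => quadraticChar E (f y) ≠ -1).card : ℤ) ≤
    ((p : ℤ) ^ m) ^ 2 + (8 * p + 4) * p ^ m := by exact_mod_cast k1
  have k2' : (2 : ℤ) * ((Finset.univ.filter fun y => quadraticChar E (f y) ≠ 1).card : ℤ) ≤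
    ((p : ℤ) ^ m) ^ 2 + (8 * p + 4) * p ^ m := by exact_mod_cast k2
  have hge' : ((p : ℤ) ^ m) ^ 2 ≤ ((Finset.univ.filter fun y => quadraticChar E (f y) ≠ -1).card : ℤ) +
      ((Finset.univ.filter fun y => quadraticChar E (f y) ≠ 1).card : ℤ) := by exact_mod_cast hge
  constructor <;> linarith

end DG

namespace DG
open Polynomial

theorem norm_addChar {F : Type*} [Field F] [Fintype F] (ψ : AddChar F ℂ) (x : F) : ‖ψ x‖ = 1 :=
  AddChar.norm_apply ψ x

theorem sum_sq_eq {F : Type*} [Field F] [Fintype F] [DecidableEq F] (hF : ringChar F ≠ 2)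
    (g : F → ℂ) : ∑ v : F, g (v ^ 2) = ∑ z : F, ((quadraticChar F z : ℂ) + 1) * g z := by
  rw [← Finset.sum_fiberwise Finset.univ (fun v : F => v ^ 2)]
  refine Finset.sum_congr rfl fun z _ => ?_
  rw [Finset.sum_congr rfl (g := fun _ => g z)]
  · rw [Finset.sum_const, nsmul_eq_mul]
    congr 1
    have := quadraticChar_card_sqrts hF z
    rw [Set.toFinset_ofPred] at this
    exact_mod_cast this
  · intro v hv
    simp only [Finset.mem_filter, Finset.mem_univ, true_and] at hv
    rw [hv]

/-- Kloosterman sum. -/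
noncomputable def kl {F : Type*} [Field F] [Fintype F] [DecidableEq F] (ψ : AddChar F ℂ) (a b : F) : ℂ :=
  ∑ s : F, if s ≠ 0 then ψ (a * s + b * s⁻¹) else 0

theorem kl_eq {F : Type*} [Field F] [Fintype F] [DecidableEq F] (hF : ringChar F ≠ 2)
    (ψ : AddChar F ℂ) (hψ : ψ ≠ 1) (a b : F) (ha : a ≠ 0) (hb : b ≠ 0) :
    kl ψ a b = ∑ u : F, (quadraticChar F (u ^ 2 - 4 * a * b) : ℂ) * ψ u := by
  have h2 : (2 : F) ≠ 0 := Ring.two_ne_zero hF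
  have h0 : ∑ u : F, ψ u = 0 := AddChar.sum_eq_zero_of_ne_one hψ
  have h1 : ∑ u : F, (quadraticChar F (u ^ 2 - 4 * a * b) : ℂ) * ψ u =
      ∑ u : F, ((quadraticChar F (u ^ 2 - 4 * a * b) : ℂ) + 1) * ψ u := by
    simp only [add_mul, one_mul, Finset.sum_add_distrib, h0, add_zero]
  rw [h1]
  have h3 : ∀ u : F, ((quadraticChar F (u ^ 2 - 4 * a * b) : ℂ) + 1) * ψ u =
      ∑ w : F, if w ^ 2 = u ^ 2 - 4 * a * b then ψ u else 0 := by
    intro u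
    rw [sum_sq_eq hF (fun z => if z = u ^ 2 - 4 * a * b then ψ u else 0)]
    simp
  simp_rw [h3]
  rw [← Finset.sum_product', ← Finset.sum_filter, kl]
  rw [← Finset.sum_filter]
  refine Finset.sum_bij' (fun s _ => (a * s + b * s⁻¹, a * s - b * s⁻¹))
    (fun x _ => (x.1 + x.2) / (2 * a)) ?_ ?_ ?_ ?_ ?_
  · intro s hs
    simp only [Finset.mem_filter, Finset.mem_univ, true_and] at hs
    simp only [Finset.mem_filter, Finset.mem_product, Finset.mem_univ, true_and]
    field_simp; ring
  · rintro ⟨u, w⟩ hx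
    simp only [Finset.mem_filter, Finset.mem_product, Finset.mem_univ, true_and] at hx ⊢
    intro h
    have : u + w = 0 := by
      rcases div_eq_zero_iff.1 h with h | h
      · exact h
      · exact absurd h (mul_ne_zero h2 ha)
    have hw : w = -u := by linear_combination this
    rw [hw] at hx
    have : (2 : F) * 2 * a * b = 0 := by linear_combination hx
    simp [h2, ha, hb] at this
  · intro s hs
    simp only [Finset.mem_filter, Finset.mem_univ, true_and] at hs
    field_simp; ring
  · rintro ⟨u, w⟩ hx
    simp only [Finset.mem_filter, Finset.mem_product, Finset.mem_univ, true_and] at hx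
    have hs : u + w ≠ 0 := by
      intro this
      have hw : w = -u := by linear_combination this
      rw [hw] at hx
      have : (2 : F) * 2 * a * b = 0 := by linear_combination hx
      simp [h2, ha, hb] at this
    ext
    · simp only; field_simp; linear_combination hx
    · simp only; field_simp; linear_combination -hx
  · intro s hs; rfl

theorem char_sum_norm_le {F : Type*} [Field F] [DecidableEq F] [Fintype F] (g : F) :
    ‖((quadraticChar F g : ℤ) : ℂ)‖ ≤ 1 := by
  rcases quadraticChar_isQuadratic F g with h | h | h <;> rw [h] <;> simp

theorem twisted_bound {E : Type*} [Field E] [Fintype E] [DecidableEq E] {p m : ℕ}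
    [hp : Fact p.Prime] [CharP E p] (hp2 : p ≠ 2)
    (hcard : Fintype.card E = (p ^ m) ^ 2) (hbig : 4 * p + 2 ≤ p ^ m)
    (ψ : AddChar E ℂ) (hfr : ∀ y, ψ (y ^ p) = ψ y) (D : E) (hD : D ≠ 0) :
    ‖∑ u : E, (quadraticChar E (u ^ 2 - D) : ℂ) * ψ u‖ ≤ (8 * p + 4) * (p : ℝ) ^ m + 2 := by
  have hE : ringChar E ≠ 2 := by rw [ringChar.eq E p]; exact hp2
  have hinv : ∀ u y : E, ψ (y ^ p - y + u) = ψ u := by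
    intro u y
    rw [AddChar.map_add_eq_mul, AddChar.map_sub_eq_div, hfr, div_self, one_mul]
    rw [← norm_pos_iff, AddChar.norm_apply]; norm_num
  set Qc : ℝ := (Fintype.card E : ℝ) with hQc
  have hQpos : 0 < Qc := by rw [hQc]; exact_mod_cast Fintype.card_pos
  set S0 := ∑ u : E, (quadraticChar E (u ^ 2 - D) : ℂ) * ψ u with hS0
  have h1 : (Fintype.card E : ℂ) * S0 =
      ∑ u : E, (∑ y : E, (quadraticChar E ((y ^ p - y + u) ^ 2 - D) : ℂ)) * ψ u := by
    simp_rw [Finset.sum_mul]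
    rw [Finset.sum_comm]
    have : ∀ y : E, ∑ u : E, (quadraticChar E ((y ^ p - y + u) ^ 2 - D) : ℂ) * ψ u = S0 := by
      intro y
      rw [hS0, ← Equiv.sum_comp (Equiv.addLeft (y ^ p - y))
        (fun u => (quadraticChar E (u ^ 2 - D) : ℂ) * ψ u)]
      refine Finset.sum_congr rfl fun u _ => ?_
      simp only [Equiv.coe_addLeft, hinv]
    rw [Finset.sum_congr rfl (fun y _ => this y)]
    simp
  set Cst : ℝ := (8 * p + 4) * (p : ℝ) ^ m with hC
  have hCpos : 0 ≤ Cst := by positivity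
  have h2 : ∀ u : E, ‖(∑ y : E, (quadraticChar E ((y ^ p - y + u) ^ 2 - D) : ℂ)) * ψ u‖ ≤
      Cst + if u ^ 2 = D then Qc else 0 := by
    intro u
    rw [norm_mul, AddChar.norm_apply, mul_one]
    split_ifs with hu
    · have : ‖∑ y : E, (quadraticChar E ((y ^ p - y + u) ^ 2 - D) : ℂ)‖ ≤ ∑ y : E, (1 : ℝ) :=
        norm_sum_le_of_le _ fun y _ => char_sum_norm_le _
      simp only [Finset.sum_const, Finset.card_univ, nsmul_eq_mul, mul_one] at this
      linarith
    · have hb := char_sum_bound (p := p) (m := m) hp2 hcard hbig u D hD hu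
      rw [add_zero, ← Int.cast_sum, Complex.norm_intCast, hC]
      exact_mod_cast hb
  have h3 : (∑ u : E, if u ^ 2 = D then Qc else 0) ≤ 2 * Qc := by
    rw [← Finset.sum_filter, Finset.sum_const, nsmul_eq_mul]
    have := quadraticChar_card_sqrts hE D
    rw [Set.toFinset_ofPred] at this
    have h4 : quadraticChar E D ≤ 1 := by
      rcases quadraticChar_isQuadratic E D with h | h | h <;> rw [h] <;> norm_num
    have h5 : (((Finset.univ.filter fun u : E => u ^ 2 = D).card : ℤ)) ≤ 2 := by
      rw [this]; linarith
    have h6 : (((Finset.univ.filter fun u : E => u ^ 2 = D).card : ℝ)) ≤ 2 := by exact_mod_cast h5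
    exact mul_le_mul_of_nonneg_right h6 hQpos.le
  have h7 : Qc * ‖S0‖ ≤ Qc * (Cst + 2) := by
    have : Qc * ‖S0‖ = ‖(Fintype.card E : ℂ) * S0‖ := by rw [norm_mul, Complex.norm_natCast]
    rw [this, h1]
    refine (norm_sum_le_of_le _ fun u _ => h2 u).trans ?_
    rw [Finset.sum_add_distrib, Finset.sum_const, nsmul_eq_mul, Finset.card_univ]
    nlinarith
  exact le_of_mul_le_mul_left h7 hQpos

end DG

namespace DG
open Polynomial

/-- Auxiliary sum. -/
noncomputable def auxh {F : Type*} [Field F] [Fintype F] [DecidableEq F] (ψ : AddChar F ℂ) (a b c : F) : ℂ :=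
  ∑ u : F, if u ^ 2 - c ≠ 0 then ψ (2 * u * (a + b * (u ^ 2 - c)⁻¹)) else 0

theorem sum_char_mul {F : Type*} [Field F] [Fintype F] [DecidableEq F] (ψ : AddChar F ℂ) (hψ : ψ ≠ 1)
    (c : F) : ∑ u : F, ψ (u * c) = if c = 0 then (Fintype.card F : ℂ) else 0 := by
  have hp : ψ.IsPrimitive := AddChar.IsPrimitive.of_ne_one hψ
  rw [AddChar.sum_mulShift c hp]; split_ifs <;> simp

theorem auxh_total {F : Type*} [Field F] [Fintype F] [DecidableEq F] (hF : ringChar F ≠ 2)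
    (ψ : AddChar F ℂ) (hψ : ψ ≠ 1) (a b : F) (ha : a ≠ 0) (hb : b ≠ 0) :
    ∑ z : F, auxh ψ a b z = Fintype.card F := by
  have h2 : (2 : F) ≠ 0 := Ring.two_ne_zero hF
  unfold auxh
  rw [Finset.sum_comm]
  have h1 : ∀ u : F, (∑ z : F, if u ^ 2 - z ≠ 0 then ψ (2 * u * (a + b * (u ^ 2 - z)⁻¹)) else 0) =
      ∑ n : F, if n ≠ 0 then ψ (2 * u * (a + b * n⁻¹)) else 0 := by
    intro u
    exact Equiv.sum_comp (Equiv.subLeft (u ^ 2))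
      (fun n => if n ≠ 0 then ψ (2 * u * (a + b * n⁻¹)) else 0)
  simp_rw [h1]
  rw [Finset.sum_comm]
  have h3 : ∀ n : F, (∑ u : F, if n ≠ 0 then ψ (2 * u * (a + b * n⁻¹)) else 0) =
      if n = - b / a then (Fintype.card F : ℂ) else 0 := by
    intro n
    by_cases hn : n = 0
    · subst hn
      rw [if_neg (by rw [eq_comm, div_eq_zero_iff]; simp [ha, hb])]
      simp
    · have : ∀ u : F, (if n ≠ 0 then ψ (2 * u * (a + b * n⁻¹)) else 0) = ψ (u * (2 * (a + b * n⁻¹))) := by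
        intro u; rw [if_pos hn]; congr 1; ring
      simp_rw [this]
      rw [sum_char_mul ψ hψ]
      have : (2 * (a + b * n⁻¹) = 0) ↔ (n = - b / a) := by
        rw [mul_eq_zero, or_iff_right h2, eq_div_iff ha]
        constructor
        · intro h
          field_simp at h
          linear_combination h
        · intro h
          field_simp
          linear_combination h
      simp [this]
  simp_rw [h3]
  simp

theorem kl_sq {F : Type*} [Field F] [Fintype F] [DecidableEq F] (hF : ringChar F ≠ 2)
    (ψ : AddChar F ℂ) (a b : F) :
    kl ψ a b ^ 2 = ∑ v : F, auxh ψ a b (v ^ 2) := by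
  have h2 : (2 : F) ≠ 0 := Ring.two_ne_zero hF
  unfold kl auxh
  rw [sq, Finset.sum_mul_sum, ← Finset.sum_product', ← Finset.sum_product']
  refine Finset.sum_nbij' (fun x => ((x.1 - x.2) / 2, (x.1 + x.2) / 2))
    (fun x => (x.1 + x.2, x.2 - x.1)) ?_ ?_ ?_ ?_ ?_
  · intros; simp
  · intros; simp
  · rintro ⟨s, t⟩ _
    ext <;> simp only <;> field_simp <;> ring
  · rintro ⟨s, t⟩ _
    ext <;> simp only <;> field_simp <;> ring
  · rintro ⟨s, t⟩ _
    simp only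
    have : ((s + t) / 2) ^ 2 - ((s - t) / 2) ^ 2 = s * t := by field_simp; ring
    rw [this]
    by_cases hs : s = 0
    · simp [hs]
    by_cases ht : t = 0
    · simp [ht]
    rw [if_pos hs, if_pos ht, if_pos (mul_ne_zero hs ht), ← AddChar.map_add_eq_mul]
    congr 1
    field_simp
    ring

theorem step {F : Type} [Field F] [Fintype F] [DecidableEq F] {p : ℕ} [hp : Fact p.Prime] [CharP F p]
    (hp2 : p ≠ 2) (ψ : AddChar F ℂ) (hψ : ψ ≠ 1) (hfr : ∀ y, ψ (y ^ p) = ψ y)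
    (a b : F) (ha : a ≠ 0) (hb : b ≠ 0) :
    ∃ (E : Type) (_ : Field E) (_ : Fintype E) (_ : DecidableEq E) (_ : CharP E p) (ψ' : AddChar E ℂ)
      (a' b' : E), ψ' ≠ 1 ∧ (∀ y, ψ' (y ^ p) = ψ' y) ∧ a' ≠ 0 ∧ b' ≠ 0 ∧
      Fintype.card E = Fintype.card F ^ 2 ∧
      kl ψ' a' b' = 2 * (Fintype.card F : ℂ) - kl ψ a b ^ 2 := by
  classical
  have hF : ringChar F ≠ 2 := by rw [ringChar.eq F p]; exact hp2
  have h2 : (2 : F) ≠ 0 := Ring.two_ne_zero hF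
  obtain ⟨δ, hδ⟩ := FiniteField.exists_nonsquare hF
  have hδ0 : δ ≠ 0 := by rintro rfl; exact hδ ⟨0, by simp⟩
  have fact : Fact (∀ r : F, r ^ 2 ≠ δ + 0 * r) := ⟨fun r hr => hδ ⟨r, by rw [← sq, hr]; ring⟩⟩
  let _ : Fintype (QuadraticAlgebra F δ 0) := Fintype.ofEquiv (F × F) (QuadraticAlgebra.equivProd δ 0).symm
  have _ : CharP (QuadraticAlgebra F δ 0) p := charP_of_injective_algebraMap (algebraMap F (QuadraticAlgebra F δ 0)).injective p
  let ψ' : AddChar (QuadraticAlgebra F δ 0) ℂ := 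
    { toFun := fun z => ψ (2 * z.re)
      map_zero_eq_one' := by simp
      map_add_eq_mul' := fun x y => by
        rw [QuadraticAlgebra.re_add, mul_add, AddChar.map_add_eq_mul] }
  have hψ'def : ∀ z : (QuadraticAlgebra F δ 0), ψ' z = ψ (2 * z.re) := fun z => rfl
  refine ⟨(QuadraticAlgebra F δ 0), inferInstance, inferInstance, inferInstance, inferInstance, ψ', algebraMap F (QuadraticAlgebra F δ 0) a,
    algebraMap F (QuadraticAlgebra F δ 0) b, ?_, ?_, ?_, ?_, ?_, ?_⟩
  · intro h
    apply hψ
    ext x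
    have := DFunLike.congr_fun h (algebraMap F (QuadraticAlgebra F δ 0) (x / 2))
    rw [hψ'def, QuadraticAlgebra.algebraMap_re, mul_div_cancel₀ _ h2] at this
    simpa using this
  · intro z
    have hre : (z ^ p).re = z.re ^ p := by
      obtain ⟨k, hk⟩ := hp.out.odd_of_ne_two hp2
      have hz : z = algebraMap F (QuadraticAlgebra F δ 0) z.re + algebraMap F (QuadraticAlgebra F δ 0) z.im * QuadraticAlgebra.omega := by
        ext <;> simp
      have hom : (QuadraticAlgebra.omega : (QuadraticAlgebra F δ 0)) * QuadraticAlgebra.omega = algebraMap F (QuadraticAlgebra F δ 0) δ := by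
        ext <;> simp
      have hop : (QuadraticAlgebra.omega : (QuadraticAlgebra F δ 0)) ^ p = algebraMap F (QuadraticAlgebra F δ 0) (δ ^ k) * QuadraticAlgebra.omega := by
        rw [hk, pow_succ, pow_mul, sq, hom, map_pow]
      conv_lhs => rw [hz]
      rw [add_pow_char, mul_pow, hop, ← map_pow, ← map_pow]
      simp [-map_pow]
    rw [hψ'def, hψ'def, hre, two_mul, two_mul, AddChar.map_add_eq_mul, AddChar.map_add_eq_mul, hfr]
  · simpa using ha
  · simpa using hb
  · rw [Fintype.card_congr (QuadraticAlgebra.equivProd δ 0), Fintype.card_prod, sq]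
  · rw [kl_sq hF]
    have hE : kl ψ' (algebraMap F (QuadraticAlgebra F δ 0) a) (algebraMap F (QuadraticAlgebra F δ 0) b) = ∑ v : F, auxh ψ a b (δ * v ^ 2) := by
      unfold kl auxh
      rw [← Equiv.sum_comp (QuadraticAlgebra.equivProd δ 0).symm, ← Finset.univ_product_univ,
        Finset.sum_product_right]
      refine Finset.sum_congr rfl fun v _ => Finset.sum_congr rfl fun u _ => ?_
      set z : (QuadraticAlgebra F δ 0) := (QuadraticAlgebra.equivProd δ 0).symm (u, v) with hz
      have hzr : z.re = u := rfl
      have hzi : z.im = v := rfl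
      have hn : z.norm = u ^ 2 - δ * v ^ 2 := by
        rw [QuadraticAlgebra.norm_def, hzr, hzi]; ring
      have hz0 : z = 0 ↔ u ^ 2 - δ * v ^ 2 = 0 := by
        rw [← hn, QuadraticAlgebra.norm_eq_zero_iff_eq_zero]
      by_cases h0 : u ^ 2 - δ * v ^ 2 = 0
      · rw [if_neg (by simpa using hz0.2 h0), if_neg (by simpa using h0)]
      · rw [if_pos (by simpa [hz0] using h0), if_pos h0, hψ'def]
        congr 1
        have : (z⁻¹).re = (u ^ 2 - δ * v ^ 2)⁻¹ * u := by
          rw [QuadraticAlgebra.re_inv, hn, hzr]; simp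
        simp [this, hzr, hzi]
        ring
    rw [hE, sum_sq_eq hF, sum_sq_eq hF (fun z => auxh ψ a b (δ * z))]
    have : ∑ z : F, ((quadraticChar F z : ℂ) + 1) * auxh ψ a b (δ * z) =
        ∑ z : F, (-(quadraticChar F z : ℂ) + 1) * auxh ψ a b z := by
      rw [← Equiv.sum_comp (Equiv.mulLeft₀ δ hδ0) (fun z => (-(quadraticChar F z : ℂ) + 1) * auxh ψ a b z)]
      refine Finset.sum_congr rfl fun z _ => ?_
      have hm : quadraticChar F δ = -1 := quadraticChar_neg_one_iff_not_isSquare.2 hδ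
      simp only [Equiv.mulLeft₀_apply, map_mul, hm]
      push_cast
      ring
    rw [this, ← auxh_total hF ψ hψ a b ha hb, Finset.mul_sum, ← Finset.sum_sub_distrib]
    refine Finset.sum_congr rfl fun z _ => ?_
    ring

theorem iter (k : ℕ) {p : ℕ} [hp : Fact p.Prime] (hp2 : p ≠ 2) :
    ∀ {F : Type} [Field F] [Fintype F] [DecidableEq F] [CharP F p]
    (ψ : AddChar F ℂ) (_ : ψ ≠ 1) (_ : ∀ y, ψ (y ^ p) = ψ y)
    (a b : F) (_ : a ≠ 0) (_ : b ≠ 0) (r ε : ℝ) (_ : 0 < r) (_ : 0 < ε)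
    (_ : (Fintype.card F : ℝ) = r ^ 2) (_ : (2 + ε) * r ≤ ‖kl ψ a b‖),
    ∃ (E : Type) (_ : Field E) (_ : Fintype E) (_ : DecidableEq E) (_ : CharP E p) (ψ' : AddChar E ℂ)
      (a' b' : E), ψ' ≠ 1 ∧ (∀ y, ψ' (y ^ p) = ψ' y) ∧ a' ≠ 0 ∧ b' ≠ 0 ∧
      Fintype.card E = Fintype.card F ^ (2 ^ k) ∧
      (2 + 4 ^ k * ε) * r ^ (2 ^ k) ≤ ‖kl ψ' a' b'‖ := by
  induction k with
  | zero =>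
    intro F i1 i2 i3 i4 ψ h1 h2 a b h3 h4 r ε h5 h6 h7 h8
    exact ⟨F, i1, i2, i3, i4, ψ, a, b, h1, h2, h3, h4, by simp, by simpa using h8⟩
  | succ k ih =>
    intro F i1 i2 i3 i4 ψ h1 h2 a b h3 h4 r ε h5 h6 h7 h8
    obtain ⟨E, j1, j2, j3, j4, ψ', a', b', g1, g2, g3, g4, g5, g6⟩ := step hp2 ψ h1 h2 a b h3 h4
    have key : (2 + 4 * ε) * r ^ 2 ≤ ‖kl ψ' a' b'‖ := by
      rw [g6]
      have t1 : ‖kl ψ a b ^ 2‖ - ‖2 * (Fintype.card F : ℂ)‖ ≤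
          ‖2 * (Fintype.card F : ℂ) - kl ψ a b ^ 2‖ := by
        rw [norm_sub_rev]; exact norm_sub_norm_le _ _
      rw [norm_pow, norm_mul, Complex.norm_natCast, h7, Complex.norm_two] at t1
      have t2 : ((2 + ε) * r) ^ 2 ≤ ‖kl ψ a b‖ ^ 2 := by
        gcongr
      have t3 : 0 ≤ ε ^ 2 * r ^ 2 := by positivity
      nlinarith
    obtain ⟨E', l1, l2, l3, l4, ψ'', a'', b'', f1, f2, f3, f4, f5, f6⟩ :=
      ih ψ' g1 g2 a' b' g3 g4 (r ^ 2) (4 * ε) (by positivity) (by positivity)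
        (by rw [g5]; push_cast; rw [h7]) key
    refine ⟨E', l1, l2, l3, l4, ψ'', a'', b'', f1, f2, f3, f4, ?_, ?_⟩
    · rw [f5, g5, ← pow_mul, pow_succ, mul_comm]
    · rw [← pow_mul] at f6
      rw [pow_succ, pow_succ, mul_assoc, mul_comm (2 ^ k) 2]
      exact f6

theorem kl_bound {F : Type} [Field F] [Fintype F] [DecidableEq F] {p : ℕ} [hp : Fact p.Prime] [CharP F p]
    (hp2 : p ≠ 2) (ψ : AddChar F ℂ) (hψ : ψ ≠ 1) (hfr : ∀ y, ψ (y ^ p) = ψ y)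
    (a b : F) (ha : a ≠ 0) (hb : b ≠ 0) :
    ‖kl ψ a b‖ ≤ 2 * Real.sqrt (Fintype.card F) := by
  by_contra hcon
  push Not at hcon
  obtain ⟨n, hpr, hn⟩ := FiniteField.card F p
  set r := Real.sqrt (Fintype.card F) with hr
  have hcpos : (0 : ℝ) < Fintype.card F := by exact_mod_cast Fintype.card_pos
  have hrpos : 0 < r := Real.sqrt_pos.2 hcpos
  have hr2 : (Fintype.card F : ℝ) = r ^ 2 := (Real.sq_sqrt hcpos.le).symm
  set ε := ‖kl ψ a b‖ / r - 2 with hε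
  have hεpos : 0 < ε := by
    rw [hε, sub_pos, lt_div_iff₀ hrpos]; exact hcon
  obtain ⟨j0, hj0⟩ := pow_unbounded_of_one_lt ((8 * p + 4) / ε) (by norm_num : (1 : ℝ) < 4)
  set j := max j0 (4 * p + 2) with hj
  obtain ⟨E, i1, i2, i3, i4, ψ', a', b', h1, h2, h3, h4, h5, h6⟩ :=
    iter (j + 1) hp2 ψ hψ hfr a b ha hb r ε hrpos hεpos hr2 (by
      rw [hε]; field_simp; linarith)
  have hm : Fintype.card E = (p ^ ((n : ℕ) * 2 ^ j)) ^ 2 := by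
    rw [h5, hn, ← pow_mul, ← pow_mul, pow_succ, mul_assoc]
  have hE : ringChar E ≠ 2 := by rw [ringChar.eq E p]; exact hp2
  have h20 : (2 : E) ≠ 0 := Ring.two_ne_zero hE
  have hp1 : 1 < p := hp.out.one_lt
  have hbig : 4 * p + 2 ≤ p ^ ((n : ℕ) * 2 ^ j) := by
    calc 4 * p + 2 ≤ j := le_max_right _ _
      _ ≤ 2 ^ j := (Nat.lt_two_pow_self).le
      _ ≤ (n : ℕ) * 2 ^ j := Nat.le_mul_of_pos_left _ n.pos
      _ ≤ p ^ ((n : ℕ) * 2 ^ j) := (Nat.lt_pow_self hp1).le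
  have hb := twisted_bound hp2 hm hbig ψ' h2 (4 * a' * b') (by
    have : (4 : E) = 2 * 2 := by norm_num
    rw [this]
    exact mul_ne_zero (mul_ne_zero (mul_ne_zero h20 h20) h3) h4)
  rw [← kl_eq hE ψ' h1 a' b' h3 h4] at hb
  have hR : r ^ (2 ^ (j + 1)) = (p : ℝ) ^ ((n : ℕ) * 2 ^ j) := by
    rw [pow_succ 2 j, mul_comm (2 ^ j) 2, pow_mul, ← hr2, hn]
    push_cast
    rw [← pow_mul]
  rw [hR] at h6
  set R := (p : ℝ) ^ ((n : ℕ) * 2 ^ j) with hRdef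
  have hR1 : 1 ≤ R := one_le_pow₀ (by exact_mod_cast hp1.le)
  have h4j : (8 * p + 4 : ℝ) < 4 ^ (j + 1) * ε := by
    rw [div_lt_iff₀ hεpos] at hj0
    refine hj0.trans_le ?_
    gcongr
    · norm_num
    · exact (le_max_left _ _).trans (Nat.le_succ _)
  nlinarith

end DG

namespace DG
open Polynomial

theorem exists_char (F : Type) [Field F] [Fintype F] (p : ℕ) [hp : Fact p.Prime] [CharP F p] :
    ∃ ψ : AddChar F ℂ, ψ ≠ 1 ∧ ∀ y, ψ (y ^ p) = ψ y := by
  let _ : Algebra (ZMod p) F := ZMod.algebra F p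
  let ψ : AddChar F ℂ := 
    (ZMod.stdAddChar (N := p)).compAddMonoidHom (Algebra.trace (ZMod p) F).toAddMonoidHom
  have hdef : ∀ y, ψ y = ZMod.stdAddChar (Algebra.trace (ZMod p) F y) := fun y => rfl
  refine ⟨ψ, ?_, ?_⟩
  · intro h
    obtain ⟨y, hy⟩ := Algebra.trace_surjective (ZMod p) F 1
    have h1 := DFunLike.congr_fun h y
    rw [hdef, hy, AddChar.one_apply] at h1
    have h2 : ZMod.stdAddChar (1 : ZMod p) = ZMod.stdAddChar (0 : ZMod p) := by
      rw [h1, AddChar.map_zero_eq_one]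
    exact one_ne_zero (ZMod.injective_stdAddChar h2)
  · intro y
    rw [hdef, hdef]
    congr 1
    have := Algebra.trace_eq_of_algEquiv (FiniteField.frobeniusAlgEquiv (ZMod p) F p) y
    rw [← this]
    congr 1
    simp [FiniteField.frobeniusAlgEquiv]

section
variable {F : Type} [Field F] [Fintype F] [DecidableEq F]

/-- complex-valued quadratic character -/
noncomputable def qc (z : F) : ℂ := ((quadraticChar F z : ℤ) : ℂ)

theorem qc_mul (x y : F) : qc (x * y) = qc x * qc y := by simp [qc, -quadraticChar_apply]

theorem qc_zero : qc (0 : F) = 0 := by simp [qc]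

theorem qc_sq {x : F} (hx : x ≠ 0) : qc x * qc x = 1 := by
  unfold qc
  rw [← sq]
  exact_mod_cast quadraticChar_sq_one hx

theorem qc_inv {x : F} : qc x⁻¹ = qc x := by
  by_cases hx : x = 0
  · simp [hx]
  have h1 : qc x⁻¹ * qc x = 1 := by
    rw [← qc_mul, inv_mul_cancel₀ hx]; simp [qc]
  calc qc x⁻¹ = qc x⁻¹ * (qc x * qc x) := by rw [qc_sq hx, mul_one]
    _ = qc x := by rw [← mul_assoc, h1, one_mul]

theorem qc_norm {x : F} (hx : x ≠ 0) : ‖qc x‖ = 1 := by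
  have := qc_sq hx
  have h : ‖qc x‖ * ‖qc x‖ = 1 := by rw [← norm_mul, this, norm_one]
  nlinarith [norm_nonneg (qc x)]

/-- Gauss sum -/
noncomputable def gs (ψ : AddChar F ℂ) : ℂ := ∑ z : F, qc z * ψ z

theorem gs_norm (hF : ringChar F ≠ 2) (ψ : AddChar F ℂ) (hψ : ψ ≠ 1) :
    ‖gs ψ‖ = Real.sqrt (Fintype.card F) := by
  have hp : ψ.IsPrimitive := AddChar.IsPrimitive.of_ne_one hψ
  have h1 : gs ψ = gaussSum ((quadraticChar F).ringHomComp (Int.castRingHom ℂ)) ψ := rfl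
  have h2 : gs ψ ^ 2 = qc (-1 : F) * Fintype.card F := by
    rw [h1, gaussSum_sq _ _ hp]
    · rfl
    · rw [MulChar.ringHomComp_ne_one_iff Int.cast_injective]
      exact quadraticChar_ne_one hF
    · exact (quadraticChar_isQuadratic F).comp _
  have h3 : ‖gs ψ‖ ^ 2 = Fintype.card F := by
    rw [← norm_pow, h2, norm_mul, qc_norm (by simp), one_mul, Complex.norm_natCast]
  rw [← h3, Real.sqrt_sq (norm_nonneg _)]

theorem gs_mul (ψ : AddChar F ℂ) {t : F} (ht : t ≠ 0) : ∑ z : F, qc z * ψ (t * z) = qc t * gs ψ := by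
  unfold gs
  rw [← Equiv.sum_comp (Equiv.mulLeft₀ t ht) (fun z => qc z * ψ z), Finset.mul_sum]
  refine Finset.sum_congr rfl fun z _ => ?_
  simp only [Equiv.mulLeft₀_apply, qc_mul]
  rw [← mul_assoc, ← mul_assoc, qc_sq ht, one_mul]

theorem sum_quad0 (hF : ringChar F ≠ 2) (ψ : AddChar F ℂ) (hψ : ψ ≠ 1) {t : F} (ht : t ≠ 0) :
    ∑ x : F, ψ (t * x ^ 2) = qc t * gs ψ := by
  rw [sum_sq_eq hF (fun z => ψ (t * z)), ← gs_mul ψ ht]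
  simp only [add_mul, one_mul, Finset.sum_add_distrib]
  have : ∑ z : F, ψ (t * z) = 0 := by
    simp_rw [mul_comm t]
    rw [sum_char_mul ψ hψ, if_neg ht]
  rw [this, add_zero]; rfl

theorem sum_quad (hF : ringChar F ≠ 2) (ψ : AddChar F ℂ) (hψ : ψ ≠ 1) {t : F} (ht : t ≠ 0) (b : F) :
    ∑ x : F, ψ (t * x ^ 2 + b * x) = qc t * gs ψ * ψ (-(b ^ 2 / (4 * t))) := by
  have h2 : (2 : F) ≠ 0 := Ring.two_ne_zero hF
  have h4 : (4 : F) = 2 * 2 := by norm_num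
  rw [← sum_quad0 hF ψ hψ ht, ← Equiv.sum_comp (Equiv.addRight (b / (2 * t))) (fun x => ψ (t * x ^ 2)),
    Finset.sum_mul]
  refine Finset.sum_congr rfl fun x _ => ?_
  rw [← AddChar.map_add_eq_mul]
  congr 1
  simp only [Equiv.coe_addRight, h4]
  field_simp
  ring

theorem salie_bound (hF : ringChar F ≠ 2) (ψ : AddChar F ℂ) (hψ : ψ ≠ 1) {a : F} (ha : a ≠ 0) (b : F) :
    ‖∑ s : F, qc s * ψ (a * s + b * s⁻¹)‖ ≤ 2 * Real.sqrt (Fintype.card F) := by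
  have h2 : (2 : F) ≠ 0 := Ring.two_ne_zero hF
  have hcpos : (0 : ℝ) < Fintype.card F := by exact_mod_cast Fintype.card_pos
  have hrpos : 0 < Real.sqrt (Fintype.card F) := Real.sqrt_pos.2 hcpos
  by_cases hb : b = 0
  · subst hb
    simp only [zero_mul, add_zero]
    rw [gs_mul ψ ha, norm_mul, qc_norm ha, gs_norm hF ψ hψ]
    linarith
  set T := ∑ s : F, qc s * ψ (a * s + b * s⁻¹) with hT
  have hinv : T = qc (a * b) * T := by
    conv_lhs => rw [hT]
    rw [hT, Finset.mul_sum]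
    let e : F ≃ F := (inv_involutive.toPerm (Inv.inv : F → F)).trans (Equiv.mulLeft₀ (b / a) (div_ne_zero hb ha))
    rw [← Equiv.sum_comp e]
    refine Finset.sum_congr rfl fun s _ => ?_
    have he : e s = b / a * s⁻¹ := rfl
    have hq : qc (b / a * s⁻¹) = qc (a * b) * qc s := by
      rw [qc_mul, qc_inv, div_eq_mul_inv, qc_mul, qc_inv, qc_mul, mul_comm (qc a)]
    have harg : a * (b / a * s⁻¹) + b * (b / a * s⁻¹)⁻¹ = a * s + b * s⁻¹ := by
      by_cases hs : s = 0
      · simp [hs]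
      field_simp
      ring
    rw [he, hq, harg, mul_assoc]
  by_cases hsq : IsSquare (a * b)
  · obtain ⟨e, he⟩ := hsq
    have hbc : b = a * (e / a) ^ 2 := by
      field_simp; rw [sq, ← he, mul_comm]
    set c := e / a with hc
    have hG : gs ψ * T = qc (-a) * ((Fintype.card F : ℂ) * (ψ (2 * a * c) + ψ (2 * a * (-c)))) := by
      have h1 : ∀ s : F, gs ψ * (qc s * ψ (a * s + b * s⁻¹)) =
          qc (-a) * ∑ y : F, if s ≠ 0 then ψ (2 * a * c * y) * ψ (s * (a * (1 - y ^ 2))) else 0 := by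
        intro s
        by_cases hs : s = 0
        · simp [hs, qc_zero]
        · have hq := sum_quad hF ψ hψ (t := -a * s) (mul_ne_zero (neg_ne_zero.2 ha) hs) (2 * a * c)
          have : ∀ y : F, (if s ≠ 0 then ψ (2 * a * c * y) * ψ (s * (a * (1 - y ^ 2))) else 0) =
            ψ (a * s) * ψ (-a * s * y ^ 2 + 2 * a * c * y) := by
            intro y
            rw [if_pos hs, ← AddChar.map_add_eq_mul, ← AddChar.map_add_eq_mul]
            congr 1; ring
          simp_rw [this]
          rw [← Finset.mul_sum, hq, qc_mul, AddChar.map_add_eq_mul]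
          have h3 : -((2 * a * c) ^ 2 / (4 * (-a * s))) = b * s⁻¹ := by
            have h4 : (4 : F) = 2 * 2 := by norm_num
            rw [hbc, h4]; field_simp
          rw [h3]
          have := qc_sq (neg_ne_zero.2 ha)
          linear_combination (-1 : ℂ) * (gs ψ * qc s * ψ (a * s) * ψ (b * s⁻¹)) * this
      rw [hT, Finset.mul_sum, Finset.sum_congr rfl (fun s _ => h1 s), ← Finset.mul_sum, Finset.sum_comm]
      congr 1
      have h5 : ∀ y : F, (∑ s : F, if s ≠ 0 then ψ (2 * a * c * y) * ψ (s * (a * (1 - y ^ 2))) else 0) =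
          (if y ^ 2 = 1 then (Fintype.card F : ℂ) * ψ (2 * a * c * y) else 0) - ψ (2 * a * c * y) := by
        intro y
        have h6 : ∀ s : F, (if s ≠ 0 then ψ (2 * a * c * y) * ψ (s * (a * (1 - y ^ 2))) else 0) =
            ψ (2 * a * c * y) * ψ (s * (a * (1 - y ^ 2))) - if s = 0 then ψ (2 * a * c * y) else 0 := by
          intro s
          by_cases hs : s = 0 <;> simp [hs]
        simp_rw [h6]
        rw [Finset.sum_sub_distrib, ← Finset.mul_sum, sum_char_mul ψ hψ]
        have : (a * (1 - y ^ 2) = 0) ↔ y ^ 2 = 1 := by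
          rw [mul_eq_zero, or_iff_right ha, sub_eq_zero, eq_comm]
        simp [this, mul_comm]
      simp_rw [h5]
      rw [Finset.sum_sub_distrib]
      have h7 : ∑ y : F, ψ (2 * a * c * y) = 0 := by
        simp_rw [mul_comm (2 * a * c)]
        rw [sum_char_mul ψ hψ, if_neg]
        refine mul_ne_zero (mul_ne_zero h2 ha) ?_
        rintro h0
        rw [h0] at hbc
        simp at hbc
        exact hb hbc
      rw [h7, sub_zero, ← Finset.sum_filter]
      have h8 : (Finset.univ.filter fun y : F => y ^ 2 = 1) = {1, -1} := by
        ext y; simp only [Finset.mem_filter, Finset.mem_univ, true_and, sq_eq_one_iff, Finset.mem_insert, Finset.mem_singleton]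
      rw [h8, Finset.sum_pair]
      · rw [mul_one, mul_add]; congr 3; ring
      · intro h
        apply h2
        linear_combination h
    have h9 : Real.sqrt (Fintype.card F) * ‖T‖ ≤ Real.sqrt (Fintype.card F) * (2 * Real.sqrt (Fintype.card F)) := by
      have : Real.sqrt (Fintype.card F) * ‖T‖ = ‖gs ψ * T‖ := by rw [norm_mul, gs_norm hF ψ hψ]
      rw [this, hG, norm_mul, norm_mul, qc_norm (neg_ne_zero.2 ha), Complex.norm_natCast]
      have h10 : ‖ψ (2 * a * c) + ψ (2 * a * (-c))‖ ≤ 2 := by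
        refine (norm_add_le _ _).trans ?_
        rw [AddChar.norm_apply, AddChar.norm_apply]; norm_num
      have h11 := Real.mul_self_sqrt hcpos.le
      nlinarith
    exact le_of_mul_le_mul_left h9 hrpos
  · have hm : qc (a * b) = -1 := by
      unfold qc
      rw [quadraticChar_neg_one_iff_not_isSquare.2 hsq]; simp
    rw [hm] at hinv
    have : T = 0 := by linear_combination hinv / 2
    rw [this, norm_zero]
    positivity

theorem inner_bound {p : ℕ} [hp : Fact p.Prime] [CharP F p]
    (hp2 : p ≠ 2) (ψ : AddChar F ℂ) (hψ : ψ ≠ 1) (hfr : ∀ y, ψ (y ^ p) = ψ y)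
    (d : ℕ) {a : F} (ha : a ≠ 0) (b : F) :
    ‖∑ s : F, if s ≠ 0 then qc s ^ d * ψ (a * s + b * s⁻¹) else 0‖ ≤ 2 * Real.sqrt (Fintype.card F) := by
  have hF : ringChar F ≠ 2 := by rw [ringChar.eq F p]; exact hp2
  rcases Nat.even_or_odd' d with ⟨k, hk | hk⟩
  · have h1 : (∑ s : F, if s ≠ 0 then qc s ^ d * ψ (a * s + b * s⁻¹) else 0) = kl ψ a b := by
      unfold kl
      refine Finset.sum_congr rfl fun s _ => ?_
      split_ifs with hs
      · rw [hk, pow_mul, sq, qc_sq hs, one_pow, one_mul]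
      · rfl
    rw [h1]
    by_cases hb : b = 0
    · subst hb
      have h2 : kl ψ a 0 = -1 := by
        unfold kl
        have : ∀ s : F, (if s ≠ 0 then ψ (a * s + 0 * s⁻¹) else 0) = ψ (s * a) - if s = 0 then 1 else 0 := by
          intro s
          by_cases hs : s = 0 <;> simp [hs, mul_comm]
        simp_rw [this]
        rw [Finset.sum_sub_distrib, sum_char_mul ψ hψ, if_neg ha]
        simp
      rw [h2, norm_neg, norm_one]
      have : (1 : ℝ) ≤ Real.sqrt (Fintype.card F) := by
        rw [Real.one_le_sqrt]
        exact_mod_cast Fintype.card_pos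
      linarith
    · exact kl_bound hp2 ψ hψ hfr a b ha hb
  · have h1 : (∑ s : F, if s ≠ 0 then qc s ^ d * ψ (a * s + b * s⁻¹) else 0) =
        ∑ s : F, qc s * ψ (a * s + b * s⁻¹) := by
      refine Finset.sum_congr rfl fun s _ => ?_
      split_ifs with hs
      · rw [hk, pow_succ, pow_mul, sq, qc_sq hs, one_pow, one_mul]
      · simp only [ne_eq, not_not] at hs
        simp [hs, qc_zero]
    rw [h1]
    exact salie_bound hF ψ hψ ha b
end

end DG

namespace DG
open Polynomial

section
variable {F : Type} [Field F] [Fintype F] [DecidableEq F] {ι : Type} [Fintype ι] [DecidableEq ι]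

theorem map_sum_prod (ψ : AddChar F ℂ) (f : ι → F) : ψ (∑ i, f i) = ∏ i, ψ (f i) := by
  exact map_prod ψ.toMonoidHom (fun i => Multiplicative.ofAdd (f i)) Finset.univ

theorem sum_pi_prod (f : ι → F → ℂ) : ∑ ξ : ι → F, ∏ i, f i (ξ i) = ∏ i, ∑ x : F, f i x := by
  rw [Finset.prod_univ_sum, Fintype.piFinset_univ]

theorem orth (ψ : AddChar F ℂ) (hψ : ψ ≠ 1) (z : ι → F) :
    ∑ ξ : ι → F, ψ (∑ i, ξ i * z i) = if z = 0 then (Fintype.card F : ℂ) ^ (Fintype.card ι) else 0 := by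
  simp_rw [map_sum_prod]
  rw [sum_pi_prod (fun i x => ψ (x * z i))]
  simp_rw [sum_char_mul ψ hψ]
  split_ifs with h
  · subst h; simp
  · obtain ⟨i, hi⟩ := Function.ne_iff.1 h
    exact Finset.prod_eq_zero (Finset.mem_univ i) (if_neg hi)

theorem parseval (ψ : AddChar F ℂ) (hψ : ψ ≠ 1) (B : Finset (ι → F)) :
    ∑ ξ : ι → F, ‖∑ x ∈ B, ψ (∑ i, ξ i * x i)‖ ^ 2 = (Fintype.card F : ℝ) ^ (Fintype.card ι) * B.card := by
  have h : ∑ ξ : ι → F, ((‖∑ x ∈ B, ψ (∑ i, ξ i * x i)‖ ^ 2 : ℝ) : ℂ) =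
      (Fintype.card F : ℂ) ^ (Fintype.card ι) * B.card := by
    have h1 : ∀ ξ : ι → F, ((‖∑ x ∈ B, ψ (∑ i, ξ i * x i)‖ ^ 2 : ℝ) : ℂ) =
        ∑ x ∈ B, ∑ y ∈ B, ψ (∑ i, ξ i * (x - y) i) := by
      intro ξ
      push_cast
      rw [← Complex.mul_conj', map_sum, Finset.sum_mul_sum]
      refine Finset.sum_congr rfl fun x _ => Finset.sum_congr rfl fun y _ => ?_
      rw [← AddChar.map_neg_eq_conj, ← AddChar.map_add_eq_mul]
      congr 1
      rw [← Finset.sum_neg_distrib, ← Finset.sum_add_distrib]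
      refine Finset.sum_congr rfl fun i _ => ?_
      simp; ring
    simp_rw [h1]
    rw [Finset.sum_comm]
    simp_rw [Finset.sum_comm (s := Finset.univ) (t := B), orth ψ hψ, sub_eq_zero]
    simp [mul_comm]
  exact_mod_cast h

theorem dual_id (hF : ringChar F ≠ 2) (ψ : AddChar F ℂ) (hψ : ψ ≠ 1) (w : ι → F) (hw : ∀ i, w i ≠ 0)
    (s : F) (hs : s ≠ 0) (x : ι → F) :
    (∏ i, (qc (-w i) * gs ψ)) * ψ (s * ∑ i, w i * x i ^ 2) =
      qc s ^ (Fintype.card ι) * ∑ ξ : ι → F, ψ ((-∑ i, ξ i ^ 2 / (4 * w i)) * s⁻¹ + ∑ i, ξ i * x i) := by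
  have h2 : (2 : F) ≠ 0 := Ring.two_ne_zero hF
  have h4 : (4 : F) = 2 * 2 := by norm_num
  have h40 : (4 : F) ≠ 0 := by rw [h4]; exact mul_ne_zero h2 h2
  have h1 : ∀ ξ : ι → F, ψ ((-∑ i, ξ i ^ 2 / (4 * w i)) * s⁻¹ + ∑ i, ξ i * x i) =
      ∏ i, ψ (-(4 * s * w i)⁻¹ * ξ i ^ 2 + x i * ξ i) := by
    intro ξ
    rw [← map_sum_prod]
    congr 1
    rw [neg_mul, Finset.sum_mul, ← Finset.sum_neg_distrib, ← Finset.sum_add_distrib]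
    refine Finset.sum_congr rfl fun i _ => ?_
    have := hw i
    field_simp
  simp_rw [h1]
  rw [sum_pi_prod (fun i y => ψ (-(4 * s * w i)⁻¹ * y ^ 2 + x i * y))]
  have h3 : ∀ i, ∑ y : F, ψ (-(4 * s * w i)⁻¹ * y ^ 2 + x i * y) =
      qc s * ((qc (-w i) * gs ψ) * ψ (s * (w i * x i ^ 2))) := by
    intro i
    have hwi := hw i
    have hne : -(4 * s * w i)⁻¹ ≠ 0 := by
      rw [neg_ne_zero]
      exact inv_ne_zero (mul_ne_zero (mul_ne_zero h40 hs) hwi)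
    rw [sum_quad hF ψ hψ hne]
    have e1 : qc (-(4 * s * w i)⁻¹) = qc s * qc (-w i) := by
      have : -(4 * s * w i)⁻¹ = ((2 * 2) * (s * (-w i)))⁻¹ := by
        rw [h4]; field_simp
      rw [this, qc_inv, qc_mul, qc_mul, qc_mul, qc_sq h2, one_mul]
    have e2 : -(x i ^ 2 / (4 * -(4 * s * w i)⁻¹)) = s * (w i * x i ^ 2) := by
      field_simp
    rw [e1, e2]; ring
  simp_rw [h3]
  have h5 : ∏ i, qc s * ((qc (-w i) * gs ψ) * ψ (s * (w i * x i ^ 2))) =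
      qc s ^ Fintype.card ι * ((∏ i, (qc (-w i) * gs ψ)) * ψ (s * ∑ i, w i * x i ^ 2)) := by
    rw [Finset.mul_sum, map_sum_prod, ← Finset.prod_mul_distrib, ← Finset.card_univ, ← Finset.prod_const,
      ← Finset.prod_mul_distrib]
  rw [h5, ← mul_assoc (qc s ^ _), ← mul_pow, qc_sq hs, one_pow, one_mul]

theorem mixing_w {p : ℕ} [hp : Fact p.Prime] [CharP F p]
    (hp2 : p ≠ 2) (w : ι → F) (hw : ∀ i, w i ≠ 0) (l : F) (hl : l ≠ 0) (B C : Finset (ι → F)) :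
    |(((B ×ˢ C).filter fun z => ∑ i, w i * (z.1 i - z.2 i) ^ 2 = l).card : ℝ) -
      (B.card : ℝ) * C.card / Fintype.card F| ≤
      2 * Real.sqrt (Fintype.card F) ^ (Fintype.card ι + 1) / Fintype.card F *
        Real.sqrt (B.card * C.card) := by
  have hF : ringChar F ≠ 2 := by rw [ringChar.eq F p]; exact hp2
  obtain ⟨ψ, hψ, hfr⟩ := exists_char F p
  set N := ((B ×ˢ C).filter fun z => ∑ i, w i * (z.1 i - z.2 i) ^ 2 = l).card with hN
  set q : ℝ := (Fintype.card F : ℝ) with hq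
  have hqpos : 0 < q := by rw [hq]; exact_mod_cast Fintype.card_pos
  set d := Fintype.card ι with hd
  set κ : ℂ := ∏ i, (qc (-w i) * gs ψ) with hκ
  have hκn : ‖κ‖ = Real.sqrt q ^ d := by
    rw [hκ, norm_prod]
    simp_rw [norm_mul, gs_norm hF ψ hψ]
    rw [Finset.prod_congr rfl (g := fun _ => Real.sqrt q)]
    · simp [hd]
    · intro i _
      rw [qc_norm (neg_ne_zero.2 (hw i)), one_mul]
  let K : (ι → F) → ℂ := fun ξ =>
    ∑ s : F, if s ≠ 0 then qc s ^ d * ψ ((-l) * s + (-∑ i, ξ i ^ 2 / (4 * w i)) * s⁻¹) else 0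
  have hK : ∀ ξ, ‖K ξ‖ ≤ 2 * Real.sqrt q := fun ξ =>
    inner_bound hp2 ψ hψ hfr d (neg_ne_zero.2 hl) _
  have hpt : ∀ z : (ι → F) × (ι → F),
      κ * ((Fintype.card F : ℂ) * (if ∑ i, w i * (z.1 i - z.2 i) ^ 2 = l then 1 else 0) - 1) =
      ∑ ξ : ι → F, K ξ * (ψ (∑ i, ξ i * z.1 i) * ψ (∑ i, ξ i * (-z.2) i)) := by
    intro z
    set Qz := ∑ i, w i * (z.1 i - z.2 i) ^ 2 with hQz
    have e1 : (Fintype.card F : ℂ) * (if Qz = l then 1 else 0) - 1 =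
        ∑ s : F, if s ≠ 0 then ψ (-l * s) * ψ (s * Qz) else 0 := by
      have : ∀ s : F, (if s ≠ 0 then ψ (-l * s) * ψ (s * Qz) else 0) =
          ψ (s * (Qz - l)) - if s = 0 then 1 else 0 := by
        intro s
        by_cases hs : s = 0
        · simp [hs]
        · rw [if_pos hs, if_neg hs, ← AddChar.map_add_eq_mul, sub_zero]
          congr 1; ring
      simp_rw [this]
      rw [Finset.sum_sub_distrib, sum_char_mul ψ hψ]
      simp [sub_eq_zero]
    rw [e1, Finset.mul_sum]
    simp only [K]
    simp_rw [Finset.sum_mul]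
    rw [Finset.sum_comm]
    refine Finset.sum_congr rfl fun s _ => ?_
    by_cases hs : s = 0
    · simp [hs]
    · simp only [ne_eq, hs, not_false_eq_true, if_true]
      have := dual_id hF ψ hψ w hw s hs (z.1 - z.2)
      rw [mul_left_comm, hQz]
      simp only [Pi.sub_apply] at this
      rw [hκ, this, Finset.mul_sum, Finset.mul_sum]
      refine Finset.sum_congr rfl fun ξ _ => ?_
      rw [AddChar.map_add_eq_mul, AddChar.map_add_eq_mul]
      have : ψ (∑ i, ξ i * (z.1 i - z.2 i)) = ψ (∑ i, ξ i * z.1 i) * ψ (∑ i, ξ i * (-z.2) i) := by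
        rw [← AddChar.map_add_eq_mul, ← Finset.sum_add_distrib]
        congr 1
        refine Finset.sum_congr rfl fun i _ => ?_
        simp; ring
      rw [this]; ring
  clear_value K
  have htot : κ * ((Fintype.card F : ℂ) * N - B.card * C.card) =
      ∑ ξ : ι → F, K ξ * ((∑ x ∈ B, ψ (∑ i, ξ i * x i)) * (∑ y ∈ C, ψ (∑ i, ξ i * (-y) i))) := by
    have h1 : (Fintype.card F : ℂ) * N - B.card * C.card = ∑ z ∈ B ×ˢ C,
      ((Fintype.card F : ℂ) * (if ∑ i, w i * (z.1 i - z.2 i) ^ 2 = l then 1 else 0) - 1) := by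
      rw [Finset.sum_sub_distrib, ← Finset.mul_sum, hN, Finset.card_filter]
      push_cast
      simp [Finset.card_product]
    rw [h1, Finset.mul_sum, Finset.sum_congr rfl (fun z _ => hpt z), Finset.sum_comm]
    refine Finset.sum_congr rfl fun ξ _ => ?_
    rw [← Finset.mul_sum, Finset.sum_mul_sum, Finset.sum_product]
  have hC : ∑ ξ : ι → F, ‖∑ y ∈ C, ψ (∑ i, ξ i * (-y) i)‖ ^ 2 = q ^ d * C.card := by
    rw [← parseval ψ hψ C, ← Equiv.sum_comp (Equiv.neg (ι → F))]
    refine Finset.sum_congr rfl fun ξ _ => ?_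
    simp
  have hB := parseval ψ hψ B
  have hbound : Real.sqrt q ^ d * |q * N - B.card * C.card| ≤
      2 * Real.sqrt q * (q ^ d * Real.sqrt (B.card * C.card)) := by
    have e : Real.sqrt q ^ d * |q * N - B.card * C.card| = ‖κ * ((Fintype.card F : ℂ) * N - B.card * C.card)‖ := by
      rw [norm_mul, hκn, ← Real.norm_eq_abs, ← Complex.norm_real]
      push_cast
      rfl
    rw [e, htot]
    refine (norm_sum_le _ _).trans ?_
    calc ∑ ξ : ι → F, ‖K ξ * ((∑ x ∈ B, ψ (∑ i, ξ i * x i)) * (∑ y ∈ C, ψ (∑ i, ξ i * (-y) i)))‖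
        ≤ ∑ ξ : ι → F, 2 * Real.sqrt q * (‖∑ x ∈ B, ψ (∑ i, ξ i * x i)‖ * ‖∑ y ∈ C, ψ (∑ i, ξ i * (-y) i)‖) := by
          refine Finset.sum_le_sum fun ξ _ => ?_
          rw [norm_mul, norm_mul]
          exact mul_le_mul_of_nonneg_right (hK ξ) (by positivity)
      _ = 2 * Real.sqrt q * ∑ ξ : ι → F, (‖∑ x ∈ B, ψ (∑ i, ξ i * x i)‖ * ‖∑ y ∈ C, ψ (∑ i, ξ i * (-y) i)‖) := by
          rw [Finset.mul_sum]
      _ ≤ 2 * Real.sqrt q * (q ^ d * Real.sqrt (B.card * C.card)) := by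
          refine mul_le_mul_of_nonneg_left ?_ (by positivity)
          refine (Real.sum_mul_le_sqrt_mul_sqrt _ _ _).trans ?_
          rw [hB, hC, ← Real.sqrt_mul (by positivity)]
          rw [show q ^ d * (B.card : ℝ) * (q ^ d * C.card) = (q ^ d) ^ 2 * (B.card * C.card) by ring,
            Real.sqrt_mul (by positivity), Real.sqrt_sq (by positivity)]
  have hs : 0 < Real.sqrt q := Real.sqrt_pos.2 hqpos
  have hqd : q ^ d = Real.sqrt q ^ d * Real.sqrt q ^ d := by
    rw [← mul_pow, Real.mul_self_sqrt hqpos.le]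
  have h5 : |q * N - B.card * C.card| ≤ 2 * Real.sqrt q ^ (d + 1) * Real.sqrt (B.card * C.card) := by
    refine le_of_mul_le_mul_left ?_ (pow_pos hs d)
    refine hbound.trans (le_of_eq ?_)
    rw [hqd]; ring
  have h6 : (N : ℝ) - B.card * C.card / q = (q * N - B.card * C.card) / q := by field_simp
  rw [h6, abs_div, abs_of_pos hqpos, div_mul_eq_mul_div]
  gcongr

end

end DG

namespace DG
open Polynomial

theorem mixing_Q {F : Type} [Field F] [Fintype F] [DecidableEq F] {d : ℕ}
    {p : ℕ} [hp : Fact p.Prime] [CharP F p] (hp2 : p ≠ 2) (Q : QuadraticForm F (Fin d → F))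
    (hQ : ∀ x, (∀ y, QuadraticMap.polar (⇑Q) x y = 0) → x = 0) (l : F) (hl : l ≠ 0)
    (B C : Finset (Fin d → F)) :
    |(((B ×ˢ C).filter fun z => Q (z.1 - z.2) = l).card : ℝ) -
      (B.card : ℝ) * C.card / Fintype.card F| ≤
      2 * Real.sqrt (Fintype.card F) ^ (d + 1) / Fintype.card F *
        Real.sqrt (B.card * C.card) := by
  have hF : ringChar F ≠ 2 := by rw [ringChar.eq F p]; exact hp2
  have h2 : (2 : F) ≠ 0 := Ring.two_ne_zero hF
  let _ : Invertible (2 : F) := invertibleOfNonzero h2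
  have hsep : (QuadraticMap.associated (R := F) Q).SeparatingLeft := by
    intro x hx
    apply hQ
    intro y
    have := QuadraticMap.two_nsmul_associated F Q
    have h3 := LinearMap.congr_fun (LinearMap.congr_fun this x) y
    have h4 := hx y
    rw [LinearMap.smul_apply, LinearMap.smul_apply, h4, smul_zero] at h3
    exact h3.symm
  obtain ⟨w, ⟨e⟩⟩ := QuadraticForm.equivalent_weightedSumSquares_units_of_nondegenerate' Q hsep
  have hQe : ∀ x, Q x = ∑ i, (w i : F) * (e x i) ^ 2 := by
    intro x
    rw [← e.map_app x, QuadraticMap.weightedSumSquares_apply]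
    refine Finset.sum_congr rfl fun i _ => ?_
    rw [Units.smul_def, smul_eq_mul, sq]
  have hm := mixing_w hp2 (fun i => (w i : F)) (fun i => (w i).ne_zero) l hl
    (B.map e.toLinearEquiv.toEquiv.toEmbedding) (C.map e.toLinearEquiv.toEquiv.toEmbedding)
  rw [Finset.card_map, Finset.card_map, Fintype.card_fin] at hm
  have hcount : ((B ×ˢ C).filter fun z => Q (z.1 - z.2) = l).card =
    (((B.map e.toLinearEquiv.toEquiv.toEmbedding) ×ˢ (C.map e.toLinearEquiv.toEquiv.toEmbedding)).filter
      fun z => ∑ i, (w i : F) * (z.1 i - z.2 i) ^ 2 = l).card := by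
    have hpt : ∀ z : (Fin d → F) × (Fin d → F),
        Q (z.1 - z.2) = ∑ i, (w i : F) * (e z.1 i - e z.2 i) ^ 2 := by
      intro z
      rw [hQe]
      have : ∀ i, e (z.1 - z.2) i = e z.1 i - e z.2 i := by
        intro i
        have : e (z.1 - z.2) = e z.1 - e z.2 := map_sub e.toLinearEquiv z.1 z.2
        rw [this]; rfl
      simp_rw [this]
    rw [← Finset.prodMap_map_product, Finset.filter_map, Finset.card_map]
    congr 1
    refine Finset.filter_congr fun z _ => ?_
    rw [hpt z]
    rfl
  rw [← hcount, Module.finrank_fin_fun] at hm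
  exact hm

end DG

namespace DG

section
variable {V α : Type} [Fintype V] [LinearOrder V] [Fintype α] [DecidableEq α]

theorem averaging (f : (V → α) → ℝ) (u : V) :
    ∑ i0 : V → α, ∑ x : α, f (Function.update i0 u x) = (Fintype.card α : ℝ) * ∑ i : V → α, f i := by
  have h1 : (Fintype.card α : ℝ) * ∑ i : V → α, f i = ∑ i : V → α, ∑ _x : α, f i := by
    simp [Finset.mul_sum]
  rw [h1, ← Finset.sum_product', ← Finset.sum_product']
  refine Finset.sum_nbij' (fun z => (Function.update z.1 u z.2, z.1 u))
    (fun z => (Function.update z.1 u z.2, z.1 u)) ?_ ?_ ?_ ?_ ?_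
  · intros; simp
  · intros; simp
  · rintro ⟨i, x⟩ _; simp
  · rintro ⟨i, x⟩ _; simp
  · rintro ⟨i, x⟩ _; rfl

/-- `i` satisfies all constraints in `S`. -/
def sat (R : V × V → α → α → Prop) (S : Finset (V × V)) (i : V → α) : Prop :=
  ∀ e ∈ S, R e (i e.1) (i e.2)

open Classical in
/-- indicator of `sat`. -/
noncomputable def ind (R : V × V → α → α → Prop) (S : Finset (V × V)) (i : V → α) : ℝ :=
  if sat R S i then 1 else 0

/-- number of satisfying maps -/
noncomputable def cnt (R : V × V → α → α → Prop) (S : Finset (V × V)) : ℝ :=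
  ∑ i : V → α, ind R S i

/-- edges not touching `u` -/
def off (S : Finset (V × V)) (u : V) : Finset (V × V) := S.filter fun e => e.1 ≠ u ∧ e.2 ≠ u

theorem sat_congr (R : V × V → α → α → Prop) (S : Finset (V × V)) (i j : V → α)
    (h : ∀ e ∈ S, i e.1 = j e.1 ∧ i e.2 = j e.2) : sat R S i ↔ sat R S j := by
  unfold sat
  refine forall₂_congr fun e he => ?_
  rw [(h e he).1, (h e he).2]

theorem ind_nonneg (R : V × V → α → α → Prop) (S : Finset (V × V)) (i : V → α) : 0 ≤ ind R S i := by
  unfold ind; split_ifs <;> norm_num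

theorem cnt_nonneg (R : V × V → α → α → Prop) (S : Finset (V × V)) : 0 ≤ cnt R S :=
  Finset.sum_nonneg fun i _ => ind_nonneg R S i

open Classical in
theorem edge_ineq (R : V × V → α → α → Prop) (q Λ : ℝ) (hΛ : 0 ≤ Λ) (hM : 0 < Fintype.card α)
    (S : Finset (V × V)) (hS : ∀ e ∈ S, e.1 < e.2) (u v : V) (he : (u, v) ∈ S)
    (hmix : ∀ B C : Finset α, |(((B ×ˢ C).filter fun z => R (u, v) z.1 z.2).card : ℝ) -
      (B.card : ℝ) * C.card / q| ≤ Λ * Real.sqrt (B.card * C.card)) :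
    |cnt R S - cnt R (S.erase (u, v)) / q| ≤
      Λ / Fintype.card α * Real.sqrt (cnt R (off S v) * cnt R (off S u)) := by
  have huv : u < v := hS _ he
  have hne : u ≠ v := huv.ne
  set M : ℝ := (Fintype.card α : ℝ) with hMdef
  have hMpos : 0 < M := by rw [hMdef]; exact_mod_cast hM
  set S' := S.erase (u, v) with hS'
  let S0 := S'.filter fun e => (e.1 ≠ u ∧ e.2 ≠ u) ∧ (e.1 ≠ v ∧ e.2 ≠ v)
  let Su := S'.filter fun e => e.1 = u ∨ e.2 = u
  let Sv := S'.filter fun e => e.1 = v ∨ e.2 = v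
  let B : (V → α) → Finset α := fun i => Finset.univ.filter fun x => sat R Su (Function.update i u x)
  let C : (V → α) → Finset α := fun i => Finset.univ.filter fun y => sat R Sv (Function.update i v y)
  have hboth : ∀ e ∈ S', ¬ ((e.1 = u ∨ e.2 = u) ∧ (e.1 = v ∨ e.2 = v)) := by
    rintro ⟨a, b⟩ he' h
    rw [hS', Finset.mem_erase] at he'
    have h3 := hS _ he'.2
    simp only at h h3
    rcases h with ⟨rfl | rfl, rfl | rfl⟩
    · exact hne rfl
    · exact he'.1 rfl
    · exact absurd h3 (not_lt.2 huv.le)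
    · exact hne rfl
  have hoffv : ∀ e, e ∈ off S v ↔ e ∈ S' ∧ e.1 ≠ v ∧ e.2 ≠ v := by
    intro e
    simp only [off, Finset.mem_filter, hS', Finset.mem_erase]
    constructor
    · rintro ⟨h1, h2⟩
      exact ⟨⟨fun h => h2.2 (by rw [h]), h1⟩, h2⟩
    · rintro ⟨h1, h2⟩
      exact ⟨h1.2, h2⟩
  have hoffu : ∀ e, e ∈ off S u ↔ e ∈ S' ∧ e.1 ≠ u ∧ e.2 ≠ u := by
    intro e
    simp only [off, Finset.mem_filter, hS', Finset.mem_erase]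
    constructor
    · rintro ⟨h1, h2⟩
      exact ⟨⟨fun h => h2.1 (by rw [h]), h1⟩, h2⟩
    · rintro ⟨h1, h2⟩
      exact ⟨h1.2, h2⟩
  have hsu : ∀ i x, sat R (off S v) (Function.update i u x) ↔ sat R S0 i ∧ x ∈ B i := by
    intro i x
    simp only [B, Finset.mem_filter, Finset.mem_univ, true_and]
    rw [← sat_congr R S0 (Function.update i u x) i (by
      intro e he
      simp only [S0, Finset.mem_filter] at he
      rw [Function.update_of_ne he.2.1.1, Function.update_of_ne he.2.1.2]; exact ⟨rfl, rfl⟩)]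
    constructor
    · intro h
      refine ⟨fun e he => h e ?_, fun e he => h e ?_⟩
      · simp only [S0, Finset.mem_filter] at he
        exact (hoffv e).2 ⟨he.1, he.2.2⟩
      · simp only [Su, Finset.mem_filter] at he
        refine (hoffv e).2 ⟨he.1, ?_⟩
        have := hboth e he.1
        tauto
    · rintro ⟨h1, h2⟩ e he
      rw [hoffv] at he
      by_cases hu : e.1 = u ∨ e.2 = u
      · exact h2 e (by simp only [Su, Finset.mem_filter]; exact ⟨he.1, hu⟩)
      · exact h1 e (by simp only [S0, Finset.mem_filter]; push Not at hu; exact ⟨he.1, hu, he.2⟩)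
  have hsv : ∀ i x, sat R (off S u) (Function.update i v x) ↔ sat R S0 i ∧ x ∈ C i := by
    intro i x
    simp only [C, Finset.mem_filter, Finset.mem_univ, true_and]
    rw [← sat_congr R S0 (Function.update i v x) i (by
      intro e he
      simp only [S0, Finset.mem_filter] at he
      rw [Function.update_of_ne he.2.2.1, Function.update_of_ne he.2.2.2]; exact ⟨rfl, rfl⟩)]
    constructor
    · intro h
      refine ⟨fun e he => h e ?_, fun e he => h e ?_⟩
      · simp only [S0, Finset.mem_filter] at he
        exact (hoffu e).2 ⟨he.1, he.2.1⟩
      · simp only [Sv, Finset.mem_filter] at he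
        refine (hoffu e).2 ⟨he.1, ?_⟩
        have := hboth e he.1
        tauto
    · rintro ⟨h1, h2⟩ e he
      rw [hoffu] at he
      by_cases hu : e.1 = v ∨ e.2 = v
      · exact h2 e (by simp only [Sv, Finset.mem_filter]; exact ⟨he.1, hu⟩)
      · exact h1 e (by simp only [S0, Finset.mem_filter]; push Not at hu; exact ⟨he.1, he.2, hu⟩)
  have hs' : ∀ i x y, sat R S' (Function.update (Function.update i u x) v y) ↔
      sat R S0 i ∧ x ∈ B i ∧ y ∈ C i := by
    intro i x y
    have e1 : sat R (off S v) (Function.update (Function.update i u x) v y) ↔ sat R S0 i ∧ x ∈ B i := by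
      rw [← hsu]
      apply sat_congr
      intro e he
      rw [hoffv] at he
      rw [Function.update_of_ne he.2.1, Function.update_of_ne he.2.2]; exact ⟨rfl, rfl⟩
    have e2 : sat R (off S u) (Function.update (Function.update i u x) v y) ↔ sat R S0 i ∧ y ∈ C i := by
      rw [← hsv, Function.update_comm hne]
      apply sat_congr
      intro e he
      rw [hoffu] at he
      rw [Function.update_of_ne he.2.1, Function.update_of_ne he.2.2]; exact ⟨rfl, rfl⟩
    have e3 : ∀ j, sat R S' j ↔ sat R (off S v) j ∧ sat R (off S u) j := by
      intro j
      constructor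
      · intro h
        exact ⟨fun e he => h e ((hoffv e).1 he).1, fun e he => h e ((hoffu e).1 he).1⟩
      · rintro ⟨h1, h2⟩ e he
        by_cases hv : e.1 = v ∨ e.2 = v
        · refine h2 e ((hoffu e).2 ⟨he, ?_⟩)
          have := hboth e he
          tauto
        · push Not at hv
          exact h1 e ((hoffv e).2 ⟨he, hv⟩)
    rw [e3, e1, e2]
    tauto
  have hs : ∀ i x y, sat R S (Function.update (Function.update i u x) v y) ↔
      (sat R S0 i ∧ x ∈ B i ∧ y ∈ C i) ∧ R (u, v) x y := by
    intro i x y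
    rw [← hs']
    have e1 : ∀ j, sat R S j ↔ sat R S' j ∧ R (u, v) (j u) (j v) := by
      intro j
      constructor
      · intro h
        exact ⟨fun e he => h e (Finset.mem_of_mem_erase he), h _ he⟩
      · rintro ⟨h1, h2⟩ e he'
        by_cases h : e = (u, v)
        · rw [h]; exact h2
        · exact h1 e (Finset.mem_erase.2 ⟨h, he'⟩)
    rw [e1, Function.update_self, Function.update_of_ne hne, Function.update_self]
  -- double averages
  have hd : ∀ f : (V → α) → ℝ, ∑ i, ∑ x, ∑ y, f (Function.update (Function.update i u x) v y) =
      M * (M * ∑ i, f i) := by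
    intro f
    rw [averaging (fun j => ∑ y, f (Function.update j v y)) u, averaging]
  have hB : ∑ i, ind R S0 i * (B i).card = M * cnt R (off S v) := by
    unfold cnt
    rw [← averaging _ u]
    refine Finset.sum_congr rfl fun i _ => ?_
    simp only [ind, hsu]
    by_cases h0 : sat R S0 i <;> simp [h0]
  have hC : ∑ i, ind R S0 i * (C i).card = M * cnt R (off S u) := by
    unfold cnt
    rw [← averaging _ v]
    refine Finset.sum_congr rfl fun i _ => ?_
    simp only [ind, hsv]
    by_cases h0 : sat R S0 i <;> simp [h0]
  have hN : ∑ i, ind R S0 i * (((B i ×ˢ C i).filter fun z => R (u, v) z.1 z.2).card : ℝ) =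
      M * (M * cnt R S) := by
    unfold cnt
    rw [← hd]
    refine Finset.sum_congr rfl fun i _ => ?_
    simp only [ind, hs]
    by_cases h0 : sat R S0 i
    · rw [if_pos h0, one_mul, Finset.card_filter, Finset.sum_product]
      push_cast
      rw [← Finset.sum_filter_add_sum_filter_not Finset.univ (fun x => x ∈ B i)]
      rw [Finset.filter_mem_eq_inter, Finset.univ_inter]
      rw [Finset.sum_eq_zero (s := Finset.univ.filter fun x => x ∉ B i), add_zero]
      · refine Finset.sum_congr rfl fun x hx => ?_
        rw [← Finset.sum_filter_add_sum_filter_not Finset.univ (fun y => y ∈ C i)]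
        rw [Finset.filter_mem_eq_inter, Finset.univ_inter]
        rw [Finset.sum_eq_zero (s := Finset.univ.filter fun x => x ∉ C i), add_zero]
        · refine Finset.sum_congr rfl fun y hy => ?_
          simp [h0, hx, hy]
        · intro y hy
          simp only [Finset.mem_filter, Finset.mem_univ, true_and] at hy
          simp [hy]
      · intro x hx
        simp only [Finset.mem_filter, Finset.mem_univ, true_and] at hx
        simp [hx]
    · simp [h0]
  have hN' : ∑ i, ind R S0 i * ((B i).card * (C i).card : ℝ) = M * (M * cnt R S') := by
    unfold cnt
    rw [← hd]
    refine Finset.sum_congr rfl fun i _ => ?_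
    simp only [ind, hs']
    by_cases h0 : sat R S0 i
    · simp only [h0, if_true, true_and, one_mul, ite_and]
      simp
    · simp [h0]
  have hmain : M * (M * |cnt R S - cnt R S' / q|) ≤ Λ * (M * Real.sqrt (cnt R (off S v) * cnt R (off S u))) := by
    have e1 : M * (M * |cnt R S - cnt R S' / q|) = |∑ i, ind R S0 i *
        ((((B i ×ˢ C i).filter fun z => R (u, v) z.1 z.2).card : ℝ) - ((B i).card : ℝ) * (C i).card / q)| := by
      have : ∑ i, ind R S0 i *
        ((((B i ×ˢ C i).filter fun z => R (u, v) z.1 z.2).card : ℝ) - ((B i).card : ℝ) * (C i).card / q) =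
          M * (M * (cnt R S - cnt R S' / q)) := by
        simp_rw [mul_sub]
        rw [Finset.sum_sub_distrib, hN]
        simp_rw [← mul_div_assoc]
        rw [← Finset.sum_div, hN']
      rw [this, abs_mul, abs_mul, abs_of_pos hMpos]
    rw [e1]
    refine (Finset.abs_sum_le_sum_abs _ _).trans ?_
    calc _ ≤ ∑ i, Λ * (Real.sqrt (ind R S0 i * (B i).card) * Real.sqrt (ind R S0 i * (C i).card)) := by
          refine Finset.sum_le_sum fun i _ => ?_
          by_cases h0 : sat R S0 i
          · simp only [ind, h0, if_true, one_mul]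
            rw [← Real.sqrt_mul (by positivity)]
            exact hmix _ _
          · simp [ind, h0]
      _ = Λ * ∑ i, (Real.sqrt (ind R S0 i * (B i).card) * Real.sqrt (ind R S0 i * (C i).card)) := by
          rw [Finset.mul_sum]
      _ ≤ Λ * (Real.sqrt (M * cnt R (off S v)) * Real.sqrt (M * cnt R (off S u))) := by
          refine mul_le_mul_of_nonneg_left ?_ hΛ
          rw [← hB, ← hC]
          exact Real.sum_sqrt_mul_sqrt_le _ (fun i => mul_nonneg (ind_nonneg R S0 i) (Nat.cast_nonneg _))
            (fun i => mul_nonneg (ind_nonneg R S0 i) (Nat.cast_nonneg _))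
      _ = _ := by
          rw [← Real.sqrt_mul (mul_nonneg hMpos.le (cnt_nonneg _ _)),
            show M * cnt R (off S v) * (M * cnt R (off S u)) = M ^ 2 * (cnt R (off S v) * cnt R (off S u)) by ring,
            Real.sqrt_mul (by positivity), Real.sqrt_sq hMpos.le]
  have h9 : M * |cnt R S - cnt R S' / q| ≤ Λ * Real.sqrt (cnt R (off S v) * cnt R (off S u)) := by
    refine le_of_mul_le_mul_left ?_ hMpos
    linarith
  rw [div_mul_eq_mul_div, le_div_iff₀ hMpos, mul_comm]
  exact h9

end

end DG

namespace DG

section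
variable {V α : Type} [Fintype V] [LinearOrder V] [Fintype α] [DecidableEq α]

open Classical in
theorem cnt_est (R : V × V → α → α → Prop) (q Λ : ℝ) (hq : 1 ≤ q) (hΛ : 0 ≤ Λ) (hM : 0 < Fintype.card α)
    (t : ℕ) (E0 : Finset (V × V)) (hE : ∀ e ∈ E0, e.1 < e.2)
    (hdeg : ∀ v, (E0.filter fun e => e.1 = v ∨ e.2 = v).card ≤ t)
    (hmix : ∀ e ∈ E0, ∀ B C : Finset α, |(((B ×ˢ C).filter fun z => R e z.1 z.2).card : ℝ) -
      (B.card : ℝ) * C.card / q| ≤ Λ * Real.sqrt (B.card * C.card))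
    (hsmall : 2 * (Λ * q ^ t / Fintype.card α) * E0.card ≤ 1 / 3) (k : ℕ) :
    ∀ S ⊆ E0, S.card = k → 
      |cnt R S * q ^ S.card / Fintype.card (V → α) - 1| ≤ 2 * (Λ * q ^ t / Fintype.card α) * S.card := by
  set M : ℝ := (Fintype.card α : ℝ) with hMdef
  have hMpos : 0 < M := by rw [hMdef]; exact_mod_cast hM
  have hqpos : 0 < q := by linarith
  haveI : Nonempty α := Fintype.card_pos_iff.1 hM
  set T : ℝ := (Fintype.card (V → α) : ℝ) with hT
  have hTpos : 0 < T := by rw [hT]; exact_mod_cast Fintype.card_pos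
  set ε := Λ * q ^ t / M with hε
  have hε0 : 0 ≤ ε := by positivity
  induction k using Nat.strong_induction_on with
  | _ k ih =>
  intro S hSE hk
  rcases S.eq_empty_or_nonempty with rfl | ⟨⟨u, v⟩, he⟩
  · have : cnt R ∅ = T := by
      unfold cnt ind sat
      simp [hT]
    rw [this]
    simp [hTpos.ne']
  have hcard : S.card = (S.erase (u, v)).card + 1 := (Finset.card_erase_add_one he).symm
  have hS : ∀ e ∈ S, e.1 < e.2 := fun e h => hE e (hSE h)
  have hedge := edge_ineq R q Λ hΛ hM S hS u v he (hmix _ (hSE he))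
  have ih' := ih (S.erase (u, v)).card (by omega) (S.erase (u, v))
    ((Finset.erase_subset _ _).trans hSE) rfl
  -- off bounds
  have hoff : ∀ w, (w = u ∨ w = v) → cnt R (off S w) * q ^ S.card ≤ 4 / 3 * T * q ^ t := by
    intro w hw
    have hsub : off S w ⊆ S := Finset.filter_subset _ _
    have hlt : (off S w).card < S.card := by
      apply Finset.card_lt_card
      refine ⟨hsub, fun h => ?_⟩
      have := h he
      simp only [off, Finset.mem_filter] at this
      rcases hw with rfl | rfl
      · exact this.2.1 rfl
      · exact this.2.2 rfl
    have hle : S.card ≤ (off S w).card + t := by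
      have h1 := Finset.card_filter_add_card_filter_not (s := S) (fun e => e.1 ≠ w ∧ e.2 ≠ w)
      have h2 : (S.filter fun e => ¬ (e.1 ≠ w ∧ e.2 ≠ w)).card ≤ t := by
        refine (Finset.card_le_card ?_).trans (hdeg w)
        intro e he
        simp only [Finset.mem_filter] at he ⊢
        exact ⟨hSE he.1, by tauto⟩
      unfold off
      omega
    have h3 := ih (off S w).card (by omega) (off S w) (hsub.trans hSE) rfl
    have h4 : 2 * ε * (off S w).card ≤ 1 / 3 := by
      refine le_trans ?_ hsmall
      refine mul_le_mul_of_nonneg_left ?_ (by positivity)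
      exact_mod_cast Finset.card_le_card (hsub.trans hSE)
    have h5 : cnt R (off S w) * q ^ (off S w).card / T ≤ 4 / 3 := by
      have := (abs_le.1 h3).2
      linarith
    rw [div_le_iff₀ hTpos] at h5
    calc cnt R (off S w) * q ^ S.card ≤ cnt R (off S w) * q ^ ((off S w).card + t) := by
          refine mul_le_mul_of_nonneg_left (pow_le_pow_right₀ hq hle) (cnt_nonneg _ _)
      _ = (cnt R (off S w) * q ^ (off S w).card) * q ^ t := by rw [pow_add]; ring
      _ ≤ 4 / 3 * T * q ^ t := by gcongr
  have hsq : Real.sqrt (cnt R (off S v) * cnt R (off S u)) * q ^ S.card ≤ 4 / 3 * T * q ^ t := by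
    have : Real.sqrt (cnt R (off S v) * cnt R (off S u)) * q ^ S.card =
        Real.sqrt ((cnt R (off S v) * q ^ S.card) * (cnt R (off S u) * q ^ S.card)) := by
      rw [show (cnt R (off S v) * q ^ S.card) * (cnt R (off S u) * q ^ S.card) =
        (cnt R (off S v) * cnt R (off S u)) * (q ^ S.card) ^ 2 by ring,
        Real.sqrt_mul (mul_nonneg (cnt_nonneg _ _) (cnt_nonneg _ _)), Real.sqrt_sq (by positivity)]
    rw [this]
    refine Real.sqrt_le_iff.2 ⟨by positivity, ?_⟩
    rw [sq]
    exact mul_le_mul (hoff v (Or.inr rfl)) (hoff u (Or.inl rfl))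
      (mul_nonneg (cnt_nonneg _ _) (by positivity)) (by positivity)
  have hdiff : |cnt R S * q ^ S.card / T - cnt R (S.erase (u, v)) * q ^ (S.erase (u, v)).card / T| ≤ 2 * ε := by
    have e1 : cnt R S * q ^ S.card / T - cnt R (S.erase (u, v)) * q ^ (S.erase (u, v)).card / T =
        (cnt R S - cnt R (S.erase (u, v)) / q) * (q ^ S.card / T) := by
      rw [hcard, pow_succ]; field_simp
    rw [e1, abs_mul, abs_of_pos (show 0 < q ^ S.card / T by positivity)]
    calc _ ≤ (Λ / M * Real.sqrt (cnt R (off S v) * cnt R (off S u))) * (q ^ S.card / T) :=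
          mul_le_mul_of_nonneg_right hedge (by positivity)
      _ = Λ / M / T * (Real.sqrt (cnt R (off S v) * cnt R (off S u)) * q ^ S.card) := by ring
      _ ≤ Λ / M / T * (4 / 3 * T * q ^ t) := mul_le_mul_of_nonneg_left hsq (by positivity)
      _ = 4 / 3 * ε := by rw [hε]; field_simp
      _ ≤ 2 * ε := by linarith
  have e2 : 2 * ε * (S.card : ℝ) = 2 * ε * ((S.erase (u, v)).card : ℝ) + 2 * ε := by
    rw [hcard]; push_cast; ring
  rw [e2]
  rw [abs_le] at *
  constructor <;> linarith [hdiff.1, hdiff.2, ih'.1, ih'.2]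

open Classical in
theorem exists_inj (R : V × V → α → α → Prop) (q Λ : ℝ) (hq : 1 ≤ q) (hΛ : 0 ≤ Λ) (hM : 0 < Fintype.card α)
    (t : ℕ) (E0 : Finset (V × V)) (hE : ∀ e ∈ E0, e.1 < e.2)
    (hdeg : ∀ v, (E0.filter fun e => e.1 = v ∨ e.2 = v).card ≤ t)
    (hmix : ∀ e ∈ E0, ∀ B C : Finset α, |(((B ×ˢ C).filter fun z => R e z.1 z.2).card : ℝ) -
      (B.card : ℝ) * C.card / q| ≤ Λ * Real.sqrt (B.card * C.card))
    (hsmall : 2 * (Λ * q ^ t / Fintype.card α) * E0.card ≤ 1 / 3)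
    (hsmall2 : 4 * ((Fintype.card V : ℝ) ^ 2 * q ^ t) ≤ Fintype.card α) :
    ∃ i : V → α, Function.Injective i ∧ sat R E0 i := by
  by_contra hcon
  push Not at hcon
  set M : ℝ := (Fintype.card α : ℝ) with hMdef
  have hMpos : 0 < M := by rw [hMdef]; exact_mod_cast hM
  have hqpos : 0 < q := by linarith
  haveI : Nonempty α := Fintype.card_pos_iff.1 hM
  set T : ℝ := (Fintype.card (V → α) : ℝ) with hT
  have hTpos : 0 < T := by rw [hT]; exact_mod_cast Fintype.card_pos
  have hest := fun S hS => cnt_est R q Λ hq hΛ hM t E0 hE hdeg hmix hsmall S.card S hS rfl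
  have hlow : 2 / 3 * T ≤ cnt R E0 * q ^ E0.card := by
    have h1 := (abs_le.1 (hest E0 subset_rfl)).1
    have : 2 / 3 ≤ cnt R E0 * q ^ E0.card / T := by linarith
    rwa [le_div_iff₀ hTpos] at this
  have hoff : ∀ w, cnt R (off E0 w) * q ^ E0.card ≤ 4 / 3 * T * q ^ t := by
    intro w
    have hsub : off E0 w ⊆ E0 := Finset.filter_subset _ _
    have hle : E0.card ≤ (off E0 w).card + t := by
      have h1 := Finset.card_filter_add_card_filter_not (s := E0) (fun e => e.1 ≠ w ∧ e.2 ≠ w)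
      have h2 : (E0.filter fun e => ¬ (e.1 ≠ w ∧ e.2 ≠ w)).card ≤ t := by
        refine (Finset.card_le_card ?_).trans (hdeg w)
        intro e he
        simp only [Finset.mem_filter] at he ⊢
        exact ⟨he.1, by tauto⟩
      unfold off
      omega
    have h3 := hest (off E0 w) hsub
    have h4 : 2 * (Λ * q ^ t / M) * (off E0 w).card ≤ 1 / 3 := by
      refine le_trans ?_ hsmall
      refine mul_le_mul_of_nonneg_left ?_ (by positivity)
      exact_mod_cast Finset.card_le_card hsub
    have h5 : cnt R (off E0 w) * q ^ (off E0 w).card / T ≤ 4 / 3 := by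
      have := (abs_le.1 h3).2
      linarith
    rw [div_le_iff₀ hTpos] at h5
    calc cnt R (off E0 w) * q ^ E0.card ≤ cnt R (off E0 w) * q ^ ((off E0 w).card + t) := by
          refine mul_le_mul_of_nonneg_left (pow_le_pow_right₀ hq hle) (cnt_nonneg _ _)
      _ = (cnt R (off E0 w) * q ^ (off E0 w).card) * q ^ t := by rw [pow_add]; ring
      _ ≤ 4 / 3 * T * q ^ t := by gcongr
  -- collisions
  let Z : V → V → ℝ := fun u w => ∑ i : V → α, if u ≠ w ∧ i w = i u then ind R (off E0 w) i else 0
  have hZ : ∀ u w, M * Z u w ≤ cnt R (off E0 w) := by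
    intro u w
    by_cases huw : u = w
    · simp only [Z, huw]
      simpa using cnt_nonneg R (off E0 w)
    · simp only [Z]
      rw [← averaging _ w]
      unfold cnt
      refine le_of_eq (Finset.sum_congr rfl fun i _ => ?_)
      have h1 : ∀ x, (if u ≠ w ∧ (Function.update i w x) w = (Function.update i w x) u then
          ind R (off E0 w) (Function.update i w x) else 0) = if x = i u then ind R (off E0 w) i else 0 := by
        intro x
        rw [Function.update_self, Function.update_of_ne huw]
        have : ind R (off E0 w) (Function.update i w x) = ind R (off E0 w) i := by
          unfold ind
          rw [sat_congr R (off E0 w) (Function.update i w x) i]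
          intro e he
          simp only [off, Finset.mem_filter] at he
          rw [Function.update_of_ne he.2.1, Function.update_of_ne he.2.2]; exact ⟨rfl, rfl⟩
        rw [this]
        simp [huw]
      simp_rw [h1]
      simp
  have hle : cnt R E0 ≤ ∑ u, ∑ w, Z u w := by
    have h1 : ∑ u, ∑ w, Z u w =
        ∑ i : V → α, ∑ u, ∑ w, if u ≠ w ∧ i w = i u then ind R (off E0 w) i else 0 := by
      simp only [Z]
      rw [Finset.sum_comm]
      rw [Finset.sum_congr rfl (fun w _ => Finset.sum_comm), Finset.sum_comm]
      exact Finset.sum_congr rfl fun i _ => Finset.sum_comm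
    rw [h1]
    unfold cnt
    refine Finset.sum_le_sum fun i _ => ?_
    have hnn : ∀ u w, 0 ≤ (if u ≠ w ∧ i w = i u then ind R (off E0 w) i else 0) := by
      intro u w; split_ifs
      · exact ind_nonneg _ _ _
      · exact le_rfl
    by_cases hs : sat R E0 i
    · have hni : ¬ Function.Injective i := fun h => hcon i h hs
      rw [Function.not_injective_iff] at hni
      obtain ⟨w, u, h2, h3⟩ := hni
      calc ind R E0 i = 1 := by simp [ind, hs]
        _ = if u ≠ w ∧ i w = i u then ind R (off E0 w) i else 0 := by
          rw [if_pos ⟨h3.symm, h2⟩]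
          unfold ind
          rw [if_pos]
          exact fun e he => hs e (Finset.filter_subset _ _ he)
        _ ≤ ∑ w, (if u ≠ w ∧ i w = i u then ind R (off E0 w) i else 0) :=
          Finset.single_le_sum (f := fun w => if u ≠ w ∧ i w = i u then ind R (off E0 w) i else 0)
            (fun w _ => hnn u w) (Finset.mem_univ w)
        _ ≤ _ := Finset.single_le_sum
            (f := fun u => ∑ w, if u ≠ w ∧ i w = i u then ind R (off E0 w) i else 0)
            (fun u _ => Finset.sum_nonneg fun w _ => hnn u w) (Finset.mem_univ u)
    · have : ind R E0 i = 0 := by simp [ind, hs]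
      rw [this]
      exact Finset.sum_nonneg fun u _ => Finset.sum_nonneg fun w _ => hnn u w
  have hfin : M * (cnt R E0 * q ^ E0.card) ≤ (Fintype.card V : ℝ) ^ 2 * (4 / 3 * T * q ^ t) := by
    calc M * (cnt R E0 * q ^ E0.card) ≤ M * ((∑ u, ∑ w, Z u w) * q ^ E0.card) := by gcongr
      _ = ∑ u, ∑ w, (M * Z u w) * q ^ E0.card := by
          rw [Finset.sum_mul, Finset.mul_sum]
          refine Finset.sum_congr rfl fun u _ => ?_
          rw [Finset.sum_mul, Finset.mul_sum]
          refine Finset.sum_congr rfl fun w _ => ?_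
          ring
      _ ≤ ∑ _u : V, ∑ _w : V, (4 / 3 * T * q ^ t) := by
          refine Finset.sum_le_sum fun u _ => Finset.sum_le_sum fun w _ => ?_
          refine le_trans ?_ (hoff w)
          exact mul_le_mul_of_nonneg_right (hZ u w) (by positivity)
      _ = _ := by simp; ring
  have h7 : M * (2 / 3 * T) ≤ (Fintype.card V : ℝ) ^ 2 * (4 / 3 * T * q ^ t) :=
    (mul_le_mul_of_nonneg_left hlow hMpos.le).trans hfin
  have h8 : (4 * ((Fintype.card V : ℝ) ^ 2 * q ^ t)) * T ≤ M * T := mul_le_mul_of_nonneg_right hsmall2 hTpos.le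
  have h9 : 0 < M * T := by positivity
  nlinarith

end

end DG

/-- Distance-graph embedding for a non-degenerate quadratic form:
if `|A| ≥ 12 n² q^{(d-1)/2 + t}` then `A` contains an isometric copy of every distance
graph with `n` vertices and maximum degree `t`, where distance is `Q (x - y)`. -/
theorem stmt1 (q d n t : ℕ) (hd : 2 ≤ d) (hn : 0 < n) (ht : 0 < t)
    (F : Type) [Field F] [Fintype F] (hq : Fintype.card F = q) (hodd : Odd q)
    (Q : QuadraticForm F (Fin d → F))
    (hQ : ∀ x, (∀ y, QuadraticMap.polar (⇑Q) x y = 0) → x = 0)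
    (A : Finset (Fin d → F))
    (hA : (A.card : ℝ) ≥ 12 * (n : ℝ) ^ 2 * (q : ℝ) ^ (((d : ℝ) - 1) / 2 + (t : ℝ)))
    (G : SimpleGraph (Fin n)) [DecidableRel G.Adj]
    (hdeg : ∀ v, G.degree v ≤ t)
    (lam : Fin n → Fin n → F)
    (hsymm : ∀ v w, lam v w = lam w v)
    (hlam : ∀ v w, G.Adj v w → lam v w ≠ 0) :
    ∃ ι : Fin n → (Fin d → F), Function.Injective ι ∧ (∀ v, ι v ∈ A) ∧
      ∀ v w, G.Adj v w → Q (ι v - ι w) = lam v w := by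
  classical
  have hpF : Fact (ringChar F).Prime := ⟨CharP.char_is_prime F (ringChar F)⟩
  have hp2 : ringChar F ≠ 2 := by
    intro h
    have h1 := FiniteField.even_card_of_char_two h
    rw [hq] at h1
    have := Nat.odd_iff.1 hodd
    omega
  have hq1 : (1 : ℝ) ≤ q := by
    have : 1 ≤ q := by rw [← hq]; exact Fintype.card_pos
    exact_mod_cast this
  have hq0 : (0 : ℝ) < q := by linarith
  have hn1 : (1 : ℝ) ≤ n := by exact_mod_cast hn
  set X : ℝ := (q : ℝ) ^ (((d : ℝ) - 1) / 2) with hX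
  have hX1 : 1 ≤ X := by
    apply Real.one_le_rpow hq1
    have : (2 : ℝ) ≤ d := by exact_mod_cast hd
    linarith
  have hΛ : 2 * Real.sqrt (q : ℝ) ^ (d + 1) / q = 2 * X := by
    have h1 : Real.sqrt (q : ℝ) ^ (d + 1) = X * q := by
      rw [Real.sqrt_eq_rpow, ← Real.rpow_natCast, ← Real.rpow_mul hq0.le, hX]
      conv_rhs => rw [← Real.rpow_one (q : ℝ), Real.rpow_one, ← Real.rpow_add_one hq0.ne']
      congr 1
      push_cast
      ring
    rw [h1]
    field_simp
  have hA' : 12 * (n : ℝ) ^ 2 * (X * (q : ℝ) ^ t) ≤ A.card := by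
    rw [Real.rpow_add hq0, Real.rpow_natCast] at hA
    exact hA
  have hqt : (1 : ℝ) ≤ (q : ℝ) ^ t := one_le_pow₀ hq1
  have hn2 : (1 : ℝ) ≤ (n : ℝ) ^ 2 := one_le_pow₀ hn1
  have hXq : (q : ℝ) ^ t ≤ X * (q : ℝ) ^ t := le_mul_of_one_le_left (by linarith) hX1
  have hbig : (n : ℝ) ^ 2 * (q : ℝ) ^ t ≤ (n : ℝ) ^ 2 * (X * (q : ℝ) ^ t) :=
    mul_le_mul_of_nonneg_left hXq (by linarith)
  have hnq : (1 : ℝ) ≤ (n : ℝ) ^ 2 * (q : ℝ) ^ t := by nlinarith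
  have hMpos : (0 : ℝ) < A.card := by nlinarith
  let E0 : Finset (Fin n × Fin n) := Finset.univ.filter fun e => e.1 < e.2 ∧ G.Adj e.1 e.2
  have hmem : ∀ e, e ∈ E0 ↔ e.1 < e.2 ∧ G.Adj e.1 e.2 := fun e => by simp [E0]
  have hEcard : (E0.card : ℝ) ≤ (n : ℝ) ^ 2 := by
    have h1 : E0.card ≤ (Finset.univ : Finset (Fin n × Fin n)).card := Finset.card_filter_le _ _
    rw [Finset.card_univ, Fintype.card_prod, Fintype.card_fin] at h1
    rw [sq]
    exact_mod_cast h1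
  obtain ⟨i, hinj, hsat⟩ := DG.exists_inj (V := Fin n) (α := {x // x ∈ A})
    (fun e x y => Q (x.1 - y.1) = lam e.1 e.2) (q : ℝ) (2 * X) hq1 (by linarith)
    (by rw [Fintype.card_coe]; exact_mod_cast hMpos) t E0 (fun e he => ((hmem e).1 he).1)
    (by
      intro v
      refine le_trans ?_ (hdeg v)
      rw [← SimpleGraph.card_neighborFinset_eq_degree]
      refine Finset.card_le_card_of_injOn (fun e => if e.1 = v then e.2 else e.1) ?_ ?_
      · rintro ⟨a, b⟩ he
        have he := (Finset.mem_filter.1 (Finset.mem_coe.1 he))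
        have h1 := (hmem _).1 he.1
        have h2 := he.2
        simp only [Finset.mem_coe, SimpleGraph.mem_neighborFinset]
        dsimp only at h1 h2
        split_ifs with h
        · subst h; exact h1.2
        · rcases h2 with h2 | h2
          · exact absurd h2 h
          · subst h2; exact h1.2.symm
      · rintro ⟨a, b⟩ he ⟨a', b'⟩ he' h
        have he := (Finset.mem_filter.1 (Finset.mem_coe.1 he))
        have he' := (Finset.mem_filter.1 (Finset.mem_coe.1 he'))
        have h1 := ((hmem _).1 he.1).1
        have h2 := he.2
        have h1' := ((hmem _).1 he'.1).1
        have h2' := he'.2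
        clear he he'
        dsimp only at h h1 h2 h1' h2'
        rw [Prod.mk.injEq]
        split_ifs at h <;> omega)
    (by
      intro e he B C
      have hm := DG.mixing_Q hp2 Q hQ (lam e.1 e.2) (hlam _ _ ((hmem e).1 he).2)
        (B.map (Function.Embedding.subtype _)) (C.map (Function.Embedding.subtype _))
      rw [Finset.card_map, Finset.card_map, hq, hΛ, ← Finset.prodMap_map_product,
        Finset.filter_map, Finset.card_map] at hm
      refine le_trans (le_of_eq ?_) hm
      congr 4)
    (by
      rw [Fintype.card_coe]
      have h1 : 2 * X * (q : ℝ) ^ t / A.card ≤ 1 / (6 * (n : ℝ) ^ 2) := by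
        rw [div_le_div_iff₀ hMpos (by linarith)]
        linarith
      calc 2 * (2 * X * (q : ℝ) ^ t / A.card) * E0.card
          ≤ 2 * (1 / (6 * (n : ℝ) ^ 2)) * (n : ℝ) ^ 2 := by
            apply mul_le_mul _ hEcard (by positivity) (by positivity)
            linarith
        _ = 1 / 3 := by field_simp; norm_num)
    (by
      rw [Fintype.card_coe, Fintype.card_fin]
      linarith)
  refine ⟨fun v => (i v).1, fun a b h => hinj (Subtype.ext h), fun v => (i v).2, ?_⟩
  intro v w hvw
  rcases lt_trichotomy v w with h | h | h
  · exact hsat (v, w) ((hmem _).2 ⟨h, hvw⟩)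
  · exact absurd h hvw.ne
  · have := hsat (w, v) ((hmem _).2 ⟨h, hvw.symm⟩)
    rw [← neg_sub, QuadraticMap.map_neg, hsymm]
    exact this
end

section
/- Let q be an odd prime power, d ≥ 2, and let Q be a non-degenerate quadratic form on F_q^d. Then for any nonnegative functions f, g : F_q^d → ℝ and any λ ∈ F_q \ {0}, one has | Σ_{(x,y): Q(x−y)=λ} f(x) g(y) − q^{-1} (Σ_x f(x)) (Σ_y g(y)) | ≤ 2 q^{(d-1)/2} (Σ_x f(x)²)^{1/2} (Σ_y g(y)²)^{1/2}. -/
open Finset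


namespace KS
open Polynomial

lemma baseP_inj {F : Type*} [Field F] (P : ℕ) (n : ℕ) :
    ∀ G : F[X][X], G.natDegree ≤ n → (∀ i, (G.coeff i).natDegree < P) →
    G.eval (X ^ P) = 0 → G = 0 := by
  have key : ∀ a b : F[X], a.natDegree < P → b * X ^ P + a = 0 → a = 0 := by
    intro a b ha h
    by_contra hne
    have hd : (X ^ P : F[X]) ∣ a := ⟨-b, by linear_combination h⟩
    have := Polynomial.natDegree_le_of_dvd hd hne
    simp at this
    omega
  induction n with
  | zero =>
    intro G hG hc h0
    rw [Polynomial.eq_C_of_natDegree_le_zero hG] at h0 ⊢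
    simpa using h0
  | succ n ih =>
    intro G hG hc h0
    rw [← Polynomial.divX_mul_X_add G] at h0
    simp only [eval_add, eval_mul, eval_X, eval_C] at h0
    have h1 := key _ _ (hc 0) h0
    rw [h1, add_zero] at h0
    have h2 : G.divX.eval (X ^ P) = 0 := by
      rcases mul_eq_zero.mp h0 with h | h
      · exact h
      · exact absurd h (pow_ne_zero _ X_ne_zero)
    have h3 := ih G.divX (by rw [Polynomial.natDegree_divX_eq_natDegree_tsub_one]; omega)
      (fun i => by rw [coeff_divX]; exact hc _) h2
    rw [← Polynomial.divX_mul_X_add G, h3, h1]; simp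

lemma no_square {F : Type*} [Field F] (f a c : F[X]) (k : F) (hk : k ≠ 0) (hf : Squarefree f)
    (hu : ¬ IsUnit f) (ha : a ≠ 0) (h : a ^ 2 * f = C k * c ^ 2) : False := by
  have hf0 : f ≠ 0 := hf.ne_zero
  obtain ⟨g, hg, hgf⟩ := WfDvdMonoid.exists_irreducible_factor hu hf0
  have hgp := hg.prime
  have hc : c ≠ 0 := by
    rintro rfl
    simp [ha, hf0] at h
  have hfin : ∀ b : F[X], b ≠ 0 → FiniteMultiplicity g b := fun b hb =>
    FiniteMultiplicity.of_not_isUnit hg.not_isUnit hb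
  have e := congrArg (multiplicity g) h
  have hCk : (C k : F[X]) ≠ 0 := by simpa using hk
  rw [multiplicity_mul hgp (hfin _ (mul_ne_zero (pow_ne_zero _ ha) hf0)),
    multiplicity_mul hgp (hfin _ (mul_ne_zero hCk (pow_ne_zero _ hc))),
    FiniteMultiplicity.multiplicity_pow hgp (hfin _ ha),
    FiniteMultiplicity.multiplicity_pow hgp (hfin _ hc)] at e
  have h1 : multiplicity g (C k) = 0 := by
    rw [multiplicity_eq_zero]
    intro hd
    exact hg.not_isUnit (isUnit_of_dvd_unit hd (isUnit_C.mpr (isUnit_iff_ne_zero.mpr hk)))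
  have h2 : multiplicity g f = 1 := by
    apply le_antisymm
    · by_contra hlt
      push Not at hlt
      have : g ^ 2 ∣ f := pow_dvd_of_le_multiplicity hlt
      rw [pow_two] at this
      exact hg.not_isUnit (hf g this)
    · have : FiniteMultiplicity g f := hfin _ hf0
      exact this.le_multiplicity_of_pow_dvd (by simpa using hgf)
  omega

/-- bivariate polynomial from coefficients -/
noncomputable def biv {F : Type*} [Field F] (I a : ℕ) (α : Fin I × Fin a → F) : F[X][X] :=
  ∑ ik : Fin I × Fin a, C (C (α ik) * X ^ (ik.2 : ℕ)) * X ^ (ik.1 : ℕ)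

lemma biv_coeff_deg {F : Type*} [Field F] (I a : ℕ) (α : Fin I × Fin a → F) (i : ℕ) :
    ((biv I a α).coeff i).natDegree ≤ a - 1 := by
  unfold biv
  rw [finsetSum_coeff]
  apply natDegree_sum_le_of_forall_le
  intro ik _
  rw [coeff_C_mul, coeff_X_pow]
  have h1 : (C (α ik) * X ^ (ik.2 : ℕ) : F[X]).natDegree ≤ a - 1 :=
    (natDegree_C_mul_X_pow_le _ _).trans (by have := ik.2.2; omega)
  split_ifs
  · simpa using h1
  · simp

lemma biv_coeff_coeff {F : Type*} [Field F] (I a : ℕ) (α : Fin I × Fin a → F) (jl : Fin I × Fin a) :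
    ((biv I a α).coeff jl.1).coeff jl.2 = α jl := by
  unfold biv
  rw [finsetSum_coeff, finsetSum_coeff, Finset.sum_eq_single jl]
  · rw [coeff_C_mul, coeff_X_pow]; simp
  · intro b _ hb
    rw [coeff_C_mul, coeff_X_pow]
    split_ifs with h
    · simp only [mul_one, coeff_C_mul, coeff_X_pow]
      split_ifs with h'
      · exact absurd (Prod.ext (Fin.ext h.symm) (Fin.ext h'.symm)) hb
      · simp
    · simp
  · simp

lemma biv_eval {F : Type*} [Field F] (I a P : ℕ) (α : Fin I × Fin a → F) :
    (biv I a α).eval (X ^ P) = ∑ ik : Fin I × Fin a, C (α ik) * X ^ ((ik.2 : ℕ) + P * ik.1) := by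
  unfold biv
  rw [eval_finsetSum]
  refine Finset.sum_congr rfl fun ik _ => ?_
  simp only [eval_mul, eval_C, eval_pow, eval_X]
  ring

end KS

namespace KS
open Polynomial

lemma stepanov_U_ne {F : Type*} [Field F] (p m P h e : ℕ) [Fact p.Prime] [CharP F p]
    (hP : P = p ^ m) (hh : P = 2 * h + 1) (he : e ≤ h)
    (f : F[X]) (hf : Squarefree f) (hu : ¬ IsUnit f) (hdeg : f.natDegree ≤ 2 * e)
    (A G : F[X][X]) (hA : ∀ i, (A.coeff i).natDegree ≤ h - e)
    (hG : ∀ i, (G.coeff i).natDegree ≤ h)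
    (hU : A.eval (X ^ P) + f ^ h * G.eval (X ^ P) = 0) : A = 0 ∧ G = 0 := by
  have hf0 : f ≠ 0 := hf.ne_zero
  have hA0 : A = 0 := by
    by_contra hA0
    set ft : F[X][X] := (f.map (iterateFrobenius F p m)).map C with hft
    have hfte : ft.eval (X ^ P) = f ^ P := by
      rw [hft, eval_map, hP, ← map_iterateFrobenius_expand p f m, map_expand, expand_eq_comp_X_pow]
      rfl
    have hft0 : ft ≠ 0 := by
      rw [hft, Ne, Polynomial.map_eq_zero_iff (C_injective), Polynomial.map_eq_zero]
      exact hf0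
    have hlift : A ^ 2 * C f - ft * G ^ 2 = 0 := by
      apply baseP_inj P _ _ le_rfl
      · intro i
        have h1 : ((A ^ 2 * C f).coeff i).natDegree ≤ 2 * h := by
          rw [coeff_mul_C, pow_two, coeff_mul]
          refine natDegree_mul_le.trans ?_
          have : (∑ x ∈ antidiagonal i, A.coeff x.1 * A.coeff x.2).natDegree ≤ (h - e) + (h - e) := by
            apply natDegree_sum_le_of_forall_le
            intro x _
            exact natDegree_mul_le.trans (add_le_add (hA _) (hA _))
          omega
        have h2 : ((ft * G ^ 2).coeff i).natDegree ≤ 2 * h := by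
          rw [coeff_mul]
          apply natDegree_sum_le_of_forall_le
          intro x _
          refine natDegree_mul_le.trans ?_
          have h3 : (ft.coeff x.1).natDegree = 0 := by
            rw [hft, coeff_map]; exact natDegree_C _
          have : ((G ^ 2).coeff x.2).natDegree ≤ h + h := by
            rw [pow_two, coeff_mul]
            apply natDegree_sum_le_of_forall_le
            intro x _
            exact natDegree_mul_le.trans (add_le_add (hG _) (hG _))
          omega
        rw [coeff_sub]
        have := natDegree_sub_le ((A ^ 2 * C f).coeff i) ((ft * G ^ 2).coeff i)
        have := max_le h1 h2
        omega
      · simp only [eval_sub, eval_mul, eval_pow, eval_C, hfte]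
        have h1 : A.eval (X ^ P) = - (f ^ h * G.eval (X ^ P)) := eq_neg_of_add_eq_zero_left hU
        rw [h1, hh]
        ring
    have hlc := congrArg leadingCoeff (sub_eq_zero.mp hlift)
    rw [leadingCoeff_mul, leadingCoeff_mul, leadingCoeff_pow, leadingCoeff_pow, leadingCoeff_C] at hlc
    have : ft.leadingCoeff = C ((f.map (iterateFrobenius F p m)).leadingCoeff) := by
      rw [hft, leadingCoeff_map_of_injective C_injective]
    rw [this] at hlc
    refine no_square f _ _ _ ?_ hf hu (leadingCoeff_ne_zero.mpr hA0) hlc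
    rw [Ne, leadingCoeff_eq_zero, Polynomial.map_eq_zero]
    exact hf0
  refine ⟨hA0, ?_⟩
  apply baseP_inj P _ _ le_rfl
  · intro i; have := hG i; omega
  · rw [hA0] at hU
    simpa [hf0] using hU

lemma stepanov {F : Type*} [Field F] [Fintype F] [DecidableEq F] (p m P h e : ℕ) [Fact p.Prime] [CharP F p]
    (hP : P = p ^ m) (hcard : Fintype.card F = P * P) (hh : P = 2 * h + 1) (he : e ≤ h)
    (heP : e ^ 2 < P)
    (f : F[X]) (hf : Squarefree f) (hu : ¬ IsUnit f) (hdeg : f.natDegree ≤ 2 * e)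
    (ε : F) (hε : ε ≠ 0) :
    #{x : F | f.eval x ^ (h * P + h) = ε} ≤ (h + e) * P + (h - e) := by
  set I := h + 1 + e with hI
  set a := h + 1 - e with ha
  set J := h + 1 with hJ
  have hroot : ∀ x : F, (x ^ P) ^ P = x := by
    intro x
    rw [← pow_mul, ← hcard]; exact FiniteField.pow_card x
  let w : (I a : ℕ) → (Fin I × Fin a → F) → F[X] := fun I a α =>
    ∑ ik : Fin I × Fin a, C (α ik) * X ^ (P * (ik.2 : ℕ) + ik.1)
  have hwdeg : ∀ (I a : ℕ) (α : Fin I × Fin a → F),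
      (w I a α).natDegree ≤ P * (a - 1) + (I - 1) := by
    intro I a α
    apply natDegree_sum_le_of_forall_le
    intro ik _
    refine (natDegree_C_mul_X_pow_le _ _).trans ?_
    have h1 := ik.1.2
    have h2 := ik.2.2
    gcongr <;> omega
  let W : ((Fin I × Fin a ⊕ Fin J × Fin J) → F) →ₗ[F] (Fin (h * P + h + 1) → F) :=
    { toFun := fun v n => (f ^ h * w I a (fun x => v (Sum.inl x)) +
          C ε * w J J (fun x => v (Sum.inr x))).coeff n
      map_add' := by
        intro u v
        ext n
        simp only [Pi.add_apply, ← coeff_add]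
        congr 1
        simp only [w, C_add, add_mul, Finset.sum_add_distrib]
        ring
      map_smul' := by
        intro c v
        ext n
        simp only [Pi.smul_apply, smul_eq_mul, RingHom.id_apply, ← coeff_C_mul]
        congr 1
        simp only [w, C_mul, mul_assoc, ← Finset.mul_sum]
        ring }
  have hker : LinearMap.ker W ≠ ⊥ := by
    apply LinearMap.ker_ne_bot_of_finrank_lt
    simp only [Module.finrank_fintype_fun_eq_card, Fintype.card_fin, Fintype.card_sum,
      Fintype.card_prod]
    rw [hI, ha, hJ]
    zify [show e ≤ h + 1 by omega]
    zify at heP hh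
    rw [hh] at heP ⊢
    nlinarith
  obtain ⟨v, hv, hv0⟩ := (Submodule.ne_bot_iff _).mp hker
  have hW0 : f ^ h * w I a (fun x => v (Sum.inl x)) + C ε * w J J (fun x => v (Sum.inr x)) = 0 := by
    ext n
    by_cases hn : n < h * P + h + 1
    · exact congrFun (LinearMap.mem_ker.mp hv) ⟨n, hn⟩
    · rw [coeff_zero]
      apply coeff_eq_zero_of_natDegree_lt
      refine lt_of_le_of_lt (natDegree_add_le _ _) (max_lt ?_ ?_)
      · refine lt_of_lt_of_le ?_ (not_lt.mp hn)
        refine lt_of_le_of_lt natDegree_mul_le ?_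
        have h1 := hwdeg I a (fun x => v (Sum.inl x))
        have h2 : (f ^ h).natDegree ≤ h * (2 * e) := natDegree_pow_le.trans (by gcongr)
        have h3 : h * (2 * e) + (P * (a - 1) + (I - 1)) = h * P + h := by
          rw [hI, ha, show h + 1 - e - 1 = h - e by omega, show h + 1 + e - 1 = h + e by omega]
          zify [he]
          zify at hh
          rw [hh]; ring
        omega
      · refine lt_of_lt_of_le ?_ (not_lt.mp hn)
        refine lt_of_le_of_lt natDegree_mul_le ?_
        have h1 := hwdeg J J (fun x => v (Sum.inr x))
        have h3 : P * (J - 1) + (J - 1) = h * P + h := by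
          rw [hJ, Nat.add_sub_cancel]; ring
        rw [natDegree_C]
        omega
  set α : Fin I × Fin a → F := fun x => v (Sum.inl x) ^ P with hα
  set γ : Fin J × Fin J → F := fun x => v (Sum.inr x) ^ P with hγ
  have hP0 : P ≠ 0 := by omega
  set U : F[X] := (biv I a α).eval (X ^ P) + f ^ h * (biv J J γ).eval (X ^ P) with hU
  have hU0 : U ≠ 0 := by
    intro h0
    obtain ⟨h1, h2⟩ := stepanov_U_ne p m P h e hP hh he f hf hu hdeg _ _
      (fun i => (biv_coeff_deg I a α i).trans (by omega))
      (fun i => (biv_coeff_deg J J γ i).trans (by omega)) h0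
    apply hv0
    ext x
    rcases x with x | x
    · have := biv_coeff_coeff I a α x
      rw [h1] at this
      simp only [coeff_zero, hα] at this
      exact pow_eq_zero_iff hP0 |>.mp this.symm
    · have := biv_coeff_coeff J J γ x
      rw [h2] at this
      simp only [coeff_zero, hγ] at this
      exact pow_eq_zero_iff hP0 |>.mp this.symm
  have hbdeg : ∀ (I a : ℕ) (α : Fin I × Fin a → F),
      ((biv I a α).eval (X ^ P)).natDegree ≤ (a - 1) + P * (I - 1) := by
    intro I a α
    rw [biv_eval]
    apply natDegree_sum_le_of_forall_le
    intro ik _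
    refine (natDegree_C_mul_X_pow_le _ _).trans ?_
    have h1 := ik.1.2
    have h2 := ik.2.2
    gcongr <;> omega
  have hUdeg : U.natDegree ≤ (h + e) * P + (h - e) := by
    refine (natDegree_add_le _ _).trans (max_le ?_ ?_)
    · refine (hbdeg _ _ _).trans (le_of_eq ?_)
      rw [hI, ha, show h + 1 - e - 1 = h - e by omega, show h + 1 + e - 1 = h + e by omega]
      ring
    · refine natDegree_mul_le.trans ?_
      have h1 := hbdeg J J γ
      have h2 : (f ^ h).natDegree ≤ h * (2 * e) := natDegree_pow_le.trans (by gcongr)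
      have h3 : h * (2 * e) + ((J - 1) + P * (J - 1)) = (h + e) * P + (h - e) := by
        rw [hJ, Nat.add_sub_cancel]
        zify [he]
        zify at hh
        rw [hh]; ring
      omega
  -- the P-th power evaluation
  have hbP : ∀ (I a : ℕ) (β : Fin I × Fin a → F) (x : F),
      (((biv I a (fun y => β y ^ P)).eval (X ^ P)).eval x) ^ P = (w I a β).eval x := by
    intro I a β x
    rw [biv_eval]
    simp only [w, eval_finsetSum, eval_mul, eval_C, eval_pow, eval_X]
    conv_lhs => rw [hP, sum_pow_char_pow p m]
    refine Finset.sum_congr rfl fun ik _ => ?_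
    rw [← hP, mul_pow, hroot, ← pow_mul, add_mul, pow_add, pow_add, mul_comm (ik.2 : ℕ) P]
    congr 2
    rw [show P * (ik.1 : ℕ) * P = (P * P) * ik.1 by ring, pow_mul, ← hcard, FiniteField.pow_card]
  have hsub : ({x : F | f.eval x ^ (h * P + h) = ε} : Finset F) ⊆ U.roots.toFinset := by
    intro x hx
    simp only [Finset.mem_filter, Finset.mem_univ, true_and] at hx
    rw [Multiset.mem_toFinset, mem_roots hU0, IsRoot.def]
    have hfx : f.eval x ≠ 0 := by
      intro h0
      have : h * P + h ≠ 0 := by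
        have : 0 < h := by
          rcases Nat.eq_zero_or_pos h with h0 | h0
          · subst h0
            have he0 : e = 0 := by omega
            subst he0
            have : f.natDegree = 0 := by omega
            exact absurd (by
              rw [eq_C_of_natDegree_eq_zero this] at hf ⊢
              apply isUnit_C.mpr
              apply isUnit_iff_ne_zero.mpr
              intro h00
              exact hf.ne_zero (by simp [h00])) hu
          · exact h0
        omega
      rw [h0, zero_pow this] at hx
      exact hε hx.symm
    have h1 : (f.eval x) ^ h * (U.eval x) ^ P = 0 := by
      have h2 : (U.eval x) ^ P = (w I a (fun y => v (Sum.inl y))).eval x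
          + (f.eval x) ^ (h * P) * (w J J (fun y => v (Sum.inr y))).eval x := by
        rw [hU, eval_add, eval_mul, eval_pow]
        conv_lhs => rw [hP, add_pow_char_pow]
        rw [← hP, mul_pow, hbP, hbP, pow_mul]
      have h3 := congrArg (eval x) hW0
      simp only [eval_add, eval_mul, eval_pow, eval_C, eval_zero] at h3
      rw [h2, mul_add, ← mul_assoc, ← pow_add, add_comm h, hx]
      exact h3
    rcases mul_eq_zero.mp h1 with h2 | h2
    · exact absurd h2 (pow_ne_zero _ hfx)
    · exact (pow_eq_zero_iff hP0).mp h2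
  calc _ ≤ #U.roots.toFinset := Finset.card_le_card hsub
    _ ≤ Multiset.card U.roots := Multiset.toFinset_card_le _
    _ ≤ U.natDegree := card_roots' _
    _ ≤ _ := hUdeg

end KS

namespace KS
open Polynomial

lemma charsum {F : Type*} [Field F] [Fintype F] [DecidableEq F] (p m P h e : ℕ) [Fact p.Prime] [CharP F p]
    (hP : P = p ^ m) (hcard : Fintype.card F = P * P) (hh : P = 2 * h + 1) (he : e ≤ h)
    (heP : e ^ 2 < P)
    (f : F[X]) (hf : Squarefree f) (hu : ¬ IsUnit f) (hdeg : f.natDegree ≤ 2 * e) :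
    |∑ x : F, quadraticChar F (f.eval x)| ≤ 2 * e * P := by
  have hcard2 : Fintype.card F / 2 = h * P + h := by
    rw [hcard, hh]
    have : (2 * h + 1) * (2 * h + 1) = 2 * (h * (2 * h + 1) + h) + 1 := by ring
    omega
  have hF : ringChar F ≠ 2 := by
    intro h2
    have h3 := FiniteField.even_card_of_char_two h2
    rw [hcard, hh] at h3
    have : (2 * h + 1) * (2 * h + 1) = 2 * (h * (2 * h + 1) + h) + 1 := by ring
    omega
  have key : ∀ ε : ℤ, (ε = 1 ∨ ε = -1) → #{x : F | quadraticChar F (f.eval x) = ε} ≤ (h + e) * P + (h - e) := by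
    intro ε hε
    refine le_trans (Finset.card_le_card ?_)
      (stepanov p m P h e hP hcard hh he heP f hf hu hdeg (ε : F) ?_)
    · intro x hx
      simp only [Finset.mem_filter, Finset.mem_univ, true_and] at hx ⊢
      rw [← hx, quadraticChar_eq_pow_of_char_ne_two' hF, hcard2]
    · rcases hε with rfl | rfl <;> simp
  have h1 := key 1 (Or.inl rfl)
  have h2 := key (-1) (Or.inr rfl)
  set N1 := #{x : F | quadraticChar F (f.eval x) = 1} with hN1
  set N2 := #{x : F | quadraticChar F (f.eval x) = -1} with hN2
  have h0 : #{x : F | f.eval x = 0} ≤ 2 * e := by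
    refine le_trans (Finset.card_le_card (t := f.roots.toFinset) ?_) ?_
    · intro x hx
      simp only [Finset.mem_filter, Finset.mem_univ, true_and] at hx
      rw [Multiset.mem_toFinset, mem_roots hf.ne_zero]; exact hx
    · exact (Multiset.toFinset_card_le _).trans ((card_roots' _).trans hdeg)
  set N0 := #{x : F | f.eval x = 0} with hN0
  have hsum : (∑ x : F, quadraticChar F (f.eval x)) = (N1 : ℤ) - N2 := by
    rw [hN1, hN2, Finset.card_filter, Finset.card_filter]
    push_cast
    rw [← Finset.sum_sub_distrib]
    refine Finset.sum_congr rfl fun x _ => ?_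
    by_cases hx : f.eval x = 0
    · simp [hx]
    · rcases quadraticChar_dichotomy hx with h | h <;> simp [h]
  have htot : (P * P : ℤ) = N1 + N2 + N0 := by
    have : (Fintype.card F : ℤ) = ∑ x : F, 1 := by simp
    rw [← Nat.cast_mul, ← hcard, this, hN1, hN2, hN0, Finset.card_filter, Finset.card_filter, Finset.card_filter]
    push_cast
    rw [← Finset.sum_add_distrib, ← Finset.sum_add_distrib]
    refine Finset.sum_congr rfl fun x _ => ?_
    by_cases hx : f.eval x = 0
    · simp [hx]
    · rcases quadraticChar_dichotomy hx with h | h <;> simp [h, hx]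
  rw [hsum, abs_le]
  zify [he] at h1 h2 h0 hh
  have : (P * P : ℤ) = 2 * h * P + P := by rw [hh]; ring
  constructor <;> nlinarith

/-- Kloosterman sum -/
noncomputable def Kl {F : Type*} [Field F] [Fintype F] [DecidableEq F] (ψ : AddChar F ℂ) (b : F) : ℂ :=
  ∑ x : F, if x = 0 then 0 else ψ (x + b / x)

lemma sum_sqrt {F : Type*} [Field F] [Fintype F] [DecidableEq F] (hF : ringChar F ≠ 2) (h : F → ℂ) :
    ∑ c : F, h (c ^ 2) = ∑ t : F, h t * (1 + (quadraticChar F t : ℂ)) := by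
  rw [← Finset.sum_fiberwise (s := univ) (g := fun c : F => c ^ 2)]
  refine Finset.sum_congr rfl fun t _ => ?_
  rw [Finset.sum_congr rfl (g := fun _ => h t)]
  · rw [Finset.sum_const, nsmul_eq_mul, mul_comm]
    congr 1
    have := quadraticChar_card_sqrts hF t
    rw [Set.toFinset_ofPred] at this
    have h2 := congrArg (Int.cast : ℤ → ℂ) this
    push_cast at h2
    rw [h2]; ring
  · intro x hx
    simp only [Finset.mem_filter, Finset.mem_univ, true_and] at hx
    rw [hx]

lemma two_ne {F : Type*} [Field F] (hF : ringChar F ≠ 2) : (2 : F) ≠ 0 := Ring.two_ne_zero hF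

/-- sum over the roots of x^2 - u x + b -/
lemma sum_by_trace {F : Type*} [Field F] [Fintype F] [DecidableEq F] (hF : ringChar F ≠ 2)
    (b : F) (hb : b ≠ 0) (h : F → ℂ) :
    (∑ x : F, if x = 0 then 0 else h (x + b / x)) =
      ∑ u : F, h u * (1 + (quadraticChar F (u ^ 2 - 4 * b) : ℂ)) := by
  have h2 := two_ne hF
  have e1 : ∀ u : F, (1 + (quadraticChar F (u ^ 2 - 4 * b) : ℂ)) =
      ∑ x : F, if x ^ 2 - u * x + b = 0 then (1 : ℂ) else 0 := by
    intro u
    have := sum_sqrt hF (fun t => if t = u ^ 2 - 4 * b then (1 : ℂ) else 0)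
    simp only [ite_mul, one_mul, zero_mul, Finset.sum_ite_eq', Finset.mem_univ, if_true] at this
    rw [← this]
    refine Fintype.sum_bijective (fun c : F => (c + u) / 2) ?_ _ _ ?_
    · constructor
      · intro x y hxy
        simp only at hxy
        field_simp at hxy
        simpa using hxy
      · intro y
        exact ⟨2 * y - u, by field_simp; ring⟩
    · intro c
      congr 1
      apply propext
      constructor
      · intro h
        field_simp
        linear_combination h
      · intro h
        field_simp at h
        linear_combination h
  simp_rw [e1, Finset.mul_sum]
  rw [Finset.sum_comm]
  refine Finset.sum_congr rfl fun x _ => ?_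
  split_ifs with hx
  · subst hx
    simp [hb]
  · rw [Finset.sum_eq_single (x + b / x)]
    · rw [if_pos, mul_one]
      field_simp; ring
    · intro u _ hu
      rw [if_neg, mul_zero]
      intro h0
      apply hu
      field_simp
      linear_combination -h0
    · simp

lemma Kl_eq {F : Type*} [Field F] [Fintype F] [DecidableEq F] (hF : ringChar F ≠ 2)
    (ψ : AddChar F ℂ) (hψ : ψ ≠ 1) (b : F) (hb : b ≠ 0) :
    Kl ψ b = ∑ u : F, ψ u * (quadraticChar F (u ^ 2 - 4 * b) : ℂ) := by
  unfold Kl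
  rw [sum_by_trace hF b hb (fun u => ψ u)]
  simp only [mul_add, mul_one, Finset.sum_add_distrib]
  rw [AddChar.sum_eq_zero_of_ne_one hψ, zero_add]

lemma norm_char {G : Type*} [AddCommGroup G] [Finite G] (ψ : AddChar G ℂ) (x : G) : ‖ψ x‖ = 1 :=
  AddChar.norm_apply ψ x

lemma Kl_big {F : Type*} [Field F] [Fintype F] [DecidableEq F] (p m P r q : ℕ) [Fact p.Prime] [CharP F p]
    (hp : p ≠ 2)
    (hP : P = p ^ m) (hcard : Fintype.card F = P * P) (hq : q = p ^ r) (hr : r ≠ 0)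
    (hqP : q ^ 2 < P) 
    (ψ : AddChar F ℂ) (hψ : ψ ≠ 1) (hψq : ∀ y, ψ (y ^ q - y) = 1) (b : F) (hb : b ≠ 0) :
    ‖Kl ψ b‖ ≤ 2 * q * P := by
  have hF : ringChar F ≠ 2 := by rwa [ringChar.eq F p]
  have h2 := two_ne hF
  have hpp : p.Prime := Fact.out
  have hPodd : Odd P := by rw [hP]; exact (hpp.odd_of_ne_two hp).pow
  obtain ⟨h, hh⟩ := hPodd
  have hq1 : 1 < q := by rw [hq]; exact Nat.one_lt_pow hr hpp.one_lt
  have hqF : (q : F) = 0 := by rw [hq]; push_cast; rw [CharP.cast_eq_zero, zero_pow hr]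
  have heh : q ≤ h := by
    have : 3 ≤ q := by
      have : p ≤ q := by rw [hq]; exact Nat.le_self_pow hr p
      have := hpp.two_le
      omega
    nlinarith
  rw [Kl_eq hF ψ hψ b hb]
  have hz : ∀ z : F, ‖(∑ y : F, (quadraticChar F ((y ^ q - y + z) ^ 2 - 4 * b) : ℂ))‖ ≤ 2 * q * P := by
    intro z
    set Y : F[X] := X ^ q - X + C z with hY
    set f : F[X] := Y ^ 2 - C (4 * b) with hf
    have hdY : derivative Y = -1 := by
      simp [hY, derivative_X_pow, hqF]
    have hdf : derivative f = - (2 * Y) := by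
      rw [hf, derivative_sub, derivative_C, pow_two, derivative_mul, hdY]
      ring
    have hsep : f.Separable := by
      refine ⟨C (-(1 / (4 * b))), C (-(1 / (4 * b)) / 2) * Y, ?_⟩
      rw [hdf, hf]
      have e1 : (C (-(1 / (4 * b)) / 2) : F[X]) * 2 = C (-(1 / (4 * b))) := by
        rw [show (2 : F[X]) = C 2 from (C_ofNat 2).symm, ← C_mul]
        congr 1; field_simp
      have e2 : (C (-(1 / (4 * b))) * C (4 * b) : F[X]) = -1 := by
        rw [← C_mul, ← C_1, ← C_neg]
        have h4 : (4 : F) ≠ 0 := by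
          rw [show (4 : F) = 2 * 2 by norm_num]; exact mul_ne_zero h2 h2
        congr 1; field_simp
      linear_combination -Y ^ 2 * e1 - e2
    have hYc : Y.coeff q = 1 := by
      have hq0 : q ≠ 0 := by omega
      have hq1' : ¬ (1 = q) := by omega
      rw [hY]
      simp [coeff_X, coeff_C, hq0, hq1']
    have hu : ¬ IsUnit f := by
      intro hu
      obtain ⟨k, -, hk⟩ := Polynomial.isUnit_iff.mp hu
      rw [← hk, derivative_C] at hdf
      have := congrArg (fun g => coeff g q) hdf
      simp only [coeff_zero, coeff_neg] at this
      rw [show (2 : F[X]) = C 2 from (C_ofNat 2).symm, coeff_C_mul, hYc, mul_one] at this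
      exact h2 (neg_eq_zero.mp this.symm)
    have hYd : Y.natDegree ≤ q := by
      rw [hY]
      compute_degree
      omega
    have hd : f.natDegree ≤ 2 * q := by
      rw [hf]
      rw [natDegree_sub_C]
      exact natDegree_pow_le.trans (by omega)
    have := charsum p m P h q hP hcard hh heh hqP f hsep.squarefree hu hd
    have he : ∀ y, f.eval y = (y ^ q - y + z) ^ 2 - 4 * b := by
      intro y; simp [hf, hY]
    simp_rw [he] at this
    have h3 : ‖((∑ y : F, quadraticChar F ((y ^ q - y + z) ^ 2 - 4 * b) : ℤ) : ℂ)‖ ≤ 2 * q * P := by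
      rw [Complex.norm_intCast]
      exact_mod_cast this
    push_cast at h3
    exact h3
  have hcpos : (0 : ℝ) < Fintype.card F := by exact_mod_cast Fintype.card_pos
  have havg : (Fintype.card F : ℂ) * ∑ u : F, ψ u * (quadraticChar F (u ^ 2 - 4 * b) : ℂ) =
      ∑ z : F, ψ z * ∑ y : F, (quadraticChar F ((y ^ q - y + z) ^ 2 - 4 * b) : ℂ) := by
    rw [Finset.sum_congr rfl (g := fun z => ∑ y : F, ψ z * (quadraticChar F ((y ^ q - y + z) ^ 2 - 4 * b) : ℂ)) (fun z _ => Finset.mul_sum _ _ _)]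
    rw [Finset.sum_comm (s := univ) (t := univ) (f := fun z y => ψ z * (quadraticChar F ((y ^ q - y + z) ^ 2 - 4 * b) : ℂ))]
    rw [← Finset.card_univ, ← nsmul_eq_mul, ← Finset.sum_const]
    · refine Finset.sum_congr rfl fun y _ => Eq.symm ?_
      refine Fintype.sum_bijective (fun z => y ^ q - y + z) (AddGroup.addLeft_bijective _) _ _ ?_
      intro z
      rw [AddChar.map_add_eq_mul, hψq, one_mul]
  have hn := congrArg norm havg
  rw [norm_mul, Complex.norm_natCast] at hn
  have : ‖∑ z : F, ψ z * ∑ y : F, (quadraticChar F ((y ^ q - y + z) ^ 2 - 4 * b) : ℂ)‖ ≤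
      Fintype.card F * (2 * q * P) := by
    refine (norm_sum_le _ _).trans ?_
    refine (Finset.sum_le_sum (g := fun _ => (2 * q * P : ℝ)) ?_).trans ?_
    · intro z _
      rw [norm_mul, norm_char, one_mul]; exact hz z
    · simp
  rw [← hn] at this
  exact le_of_mul_le_mul_left this hcpos

end KS

namespace KS

lemma sum_two_cover {F : Type*} [Field F] [Fintype F] [DecidableEq F] (hF : ringChar F ≠ 2)
    (ν : F) (hν : quadraticChar F ν = -1) (h : F → ℂ) :
    ∑ c : F, h (c ^ 2) + ∑ c : F, h (ν * c ^ 2) = 2 * ∑ t : F, h t := by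
  have hν0 : ν ≠ 0 := by
    rintro rfl
    simp at hν
  rw [sum_sqrt hF h, sum_sqrt hF (fun t => h (ν * t))]
  have : ∑ t : F, h (ν * t) * (1 + (quadraticChar F t : ℂ)) =
      ∑ t : F, h t * (1 - (quadraticChar F t : ℂ)) := by
    refine Fintype.sum_bijective (fun t => ν * t) (mulLeft_bijective₀ ν hν0) _ _ ?_
    intro t
    rw [map_mul, hν]
    push_cast
    ring
  rw [this, ← Finset.sum_add_distrib, Finset.mul_sum]
  refine Finset.sum_congr rfl fun t _ => ?_
  ring

lemma Kl_sq {F : Type*} [Field F] [Fintype F] [DecidableEq F] (hF : ringChar F ≠ 2)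
    (ψ : AddChar F ℂ) (b : F) :
    Kl ψ b ^ 2 = ∑ a : F, ∑ c : F,
      if a ^ 2 - c ^ 2 = 0 then 0 else ψ (2 * a + 2 * a * b / (a ^ 2 - c ^ 2)) := by
  have h2 := two_ne hF
  unfold Kl
  rw [pow_two, Finset.sum_mul_sum, ← Finset.sum_product', ← Finset.sum_product']
  simp only [Finset.univ_product_univ]
  symm
  refine Fintype.sum_bijective (fun x : F × F => (x.1 + x.2, x.1 - x.2)) ?_ _ _ ?_
  · constructor
    · rintro ⟨x, y⟩ ⟨x', y'⟩ h
      simp only [Prod.mk.injEq] at h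
      obtain ⟨h3, h4⟩ := h
      have e1 : 2 * x = 2 * x' := by linear_combination h3 + h4
      have e2 : 2 * y = 2 * y' := by linear_combination h3 - h4
      rw [mul_right_inj' h2] at e1 e2
      rw [e1, e2]
    · rintro ⟨x, y⟩
      refine ⟨((x + y) / 2, (x - y) / 2), ?_⟩
      simp only [Prod.mk.injEq]
      constructor <;> field_simp <;> ring
  · rintro ⟨a, c⟩
    simp only
    rw [show a ^ 2 - c ^ 2 = (a + c) * (a - c) by ring]
    by_cases h3 : a + c = 0
    · simp [h3]
    · by_cases h4 : a - c = 0
      · simp [h4]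
      · rw [if_neg (mul_ne_zero h3 h4), if_neg h3, if_neg h4, ← AddChar.map_add_eq_mul]
        congr 1
        field_simp
        ring

lemma Kl_sum {F : Type*} [Field F] [Fintype F] [DecidableEq F] (hF : ringChar F ≠ 2)
    (ψ : AddChar F ℂ) (hψ : ψ ≠ 1) (b : F) (hb : b ≠ 0) (ν : F) (hν : quadraticChar F ν = -1) :
    Kl ψ b ^ 2 + (∑ a : F, ∑ c : F,
      if a ^ 2 - ν * c ^ 2 = 0 then 0 else ψ (2 * a + 2 * a * b / (a ^ 2 - ν * c ^ 2))) =
      2 * Fintype.card F := by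
  have h2 := two_ne hF
  rw [Kl_sq hF, ← Finset.sum_add_distrib]
  have e1 : ∀ a : F, (∑ c : F, (if a ^ 2 - c ^ 2 = 0 then 0 else ψ (2 * a + 2 * a * b / (a ^ 2 - c ^ 2)))) +
      (∑ c : F, if a ^ 2 - ν * c ^ 2 = 0 then 0 else ψ (2 * a + 2 * a * b / (a ^ 2 - ν * c ^ 2))) =
      2 * ∑ e : F, if e = 0 then 0 else ψ (a * (2 * (1 + b / e))) := by
    intro a
    rw [sum_two_cover hF ν hν (fun t => if a ^ 2 - t = 0 then 0 else ψ (2 * a + 2 * a * b / (a ^ 2 - t)))]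
    congr 1
    refine Fintype.sum_bijective (fun t => a ^ 2 - t) (Equiv.subLeft (a ^ 2)).bijective _ _ ?_
    intro t
    split_ifs
    · rfl
    · congr 1; ring
  rw [Finset.sum_congr rfl (fun a _ => e1 a), ← Finset.mul_sum, Finset.sum_comm]
  congr 1
  rw [Finset.sum_eq_single (-b)]
  · rw [Finset.sum_congr rfl (g := fun _ => (1 : ℂ))]
    · simp
    · intro a _
      rw [if_neg (neg_ne_zero.mpr hb), show 1 + b / -b = 0 by field_simp; ring]
      simp
  · intro e _ he
    by_cases he0 : e = 0
    · simp [he0]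
    · simp only [he0, if_false]
      rw [AddChar.sum_mulShift _ (AddChar.IsPrimitive.of_ne_one hψ), if_neg]
      · simp
      intro h
      apply he
      rcases mul_eq_zero.mp h with h | h
      · exact absurd h h2
      · field_simp at h
        linear_combination h
  · simp

lemma step (p r q : ℕ) [Fact p.Prime] (hp : p ≠ 2) (hq : q = p ^ r)
    (F : Type) [Field F] [Fintype F] [DecidableEq F] [CharP F p]
    (ψ : AddChar F ℂ) (hψ : ψ ≠ 1) (hψq : ∀ y, ψ (y ^ q - y) = 1) (b : F) (hb : b ≠ 0) :
    ∃ (E : Type) (_ : Field E) (_ : Fintype E) (_ : DecidableEq E) (_ : CharP E p)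
      (ψ' : AddChar E ℂ) (b' : E), ψ' ≠ 1 ∧ (∀ y, ψ' (y ^ q - y) = 1) ∧ b' ≠ 0 ∧
      Fintype.card E = Fintype.card F ^ 2 ∧ Kl ψ' b' = 2 * Fintype.card F - Kl ψ b ^ 2 := by
  have hF : ringChar F ≠ 2 := by rwa [ringChar.eq F p]
  have h2 := two_ne hF
  obtain ⟨ν, hν⟩ := quadraticChar_exists_neg_one hF
  have hns := quadraticChar_neg_one_iff_not_isSquare.mp hν
  have : Fact (∀ r : F, r ^ 2 ≠ ν + 0 * r) := ⟨by
    intro r h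
    exact hns ⟨r, by rw [← pow_two, h]; ring⟩⟩
  let : Fintype (QuadraticAlgebra F ν 0) := Fintype.ofEquiv _ (QuadraticAlgebra.equivProd ν 0).symm
  let : DecidableEq (QuadraticAlgebra F ν 0) := Classical.decEq _
  have : CharP (QuadraticAlgebra F ν 0) p := charP_of_injective_algebraMap (algebraMap F (QuadraticAlgebra F ν 0)).injective p
  let ψ' : AddChar (QuadraticAlgebra F ν 0) ℂ :=
    { toFun := fun x => ψ (2 * x.re)
      map_zero_eq_one' := by simp
      map_add_eq_mul' := by
        intro x y
        rw [QuadraticAlgebra.re_add, mul_add, AddChar.map_add_eq_mul] }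
  have hψ' : ∀ x : (QuadraticAlgebra F ν 0), ψ' x = ψ (2 * x.re) := fun x => rfl
  refine ⟨(QuadraticAlgebra F ν 0), inferInstance, inferInstance, inferInstance, inferInstance, ψ', algebraMap F (QuadraticAlgebra F ν 0) b, ?_, ?_, ?_, ?_, ?_⟩
  · obtain ⟨x, hx⟩ := AddChar.ne_one_iff.mp hψ
    rw [AddChar.ne_one_iff]
    refine ⟨algebraMap F (QuadraticAlgebra F ν 0) (x / 2), ?_⟩
    rw [hψ', QuadraticAlgebra.algebraMap_re, mul_div_cancel₀ _ h2]
    exact hx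
  · intro y
    have hre : (y ^ q).re = y.re ^ q := by
      have hy : y = algebraMap F (QuadraticAlgebra F ν 0) y.re + algebraMap F (QuadraticAlgebra F ν 0) y.im * (QuadraticAlgebra.omega : (QuadraticAlgebra F ν 0)) := by
        ext <;> simp
      have hodd : Odd q := by rw [hq]; exact ((Fact.out : p.Prime).odd_of_ne_two hp).pow
      obtain ⟨k, hk⟩ := hodd
      have hom : (QuadraticAlgebra.omega : (QuadraticAlgebra F ν 0)) ^ 2 = algebraMap F (QuadraticAlgebra F ν 0) ν := by
        rw [pow_two, QuadraticAlgebra.omega_mul_omega_eq_algebraMap]; simp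
      have h1 : y ^ q = algebraMap F (QuadraticAlgebra F ν 0) (y.re ^ q) + algebraMap F (QuadraticAlgebra F ν 0) (y.im ^ q * ν ^ k) * (QuadraticAlgebra.omega : (QuadraticAlgebra F ν 0)) := by
        conv_lhs => rw [hy, hq, add_pow_char_pow, ← hq, mul_pow]
        rw [show (QuadraticAlgebra.omega : (QuadraticAlgebra F ν 0)) ^ q = algebraMap F (QuadraticAlgebra F ν 0) (ν ^ k) * (QuadraticAlgebra.omega : (QuadraticAlgebra F ν 0)) by
          rw [hk, pow_add, pow_mul, hom, map_pow, pow_one]]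
        simp only [map_pow, map_mul]
        ring
      rw [h1]
      simp [-map_pow, -map_mul]
    rw [hψ', QuadraticAlgebra.re_sub, hre]
    have h3 := hψq y.re
    have : 2 * (y.re ^ q - y.re) = (y.re ^ q - y.re) + (y.re ^ q - y.re) := by ring
    rw [this, AddChar.map_add_eq_mul, h3, one_mul]
  · simpa using hb
  · rw [Fintype.card_congr (QuadraticAlgebra.equivProd ν 0), Fintype.card_prod, pow_two]
  · rw [← Kl_sum hF ψ hψ b hb ν hν, add_sub_cancel_left]
    unfold Kl
    rw [← Finset.sum_product']
    simp only [Finset.univ_product_univ]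
    refine Fintype.sum_bijective (QuadraticAlgebra.equivProd ν 0) (Equiv.bijective _) _ _ ?_
    intro x
    have hx0 : x = 0 ↔ x.re ^ 2 - ν * x.im ^ 2 = 0 := by
      constructor
      · rintro rfl; simp
      · intro h
        have him : x.im = 0 := by
          by_contra him
          apply hns
          refine ⟨x.re / x.im, ?_⟩
          field_simp
          linear_combination -h
        rw [him] at h
        have hre : x.re = 0 := by simpa using h
        ext <;> simp [him, hre]
    have hxe : (QuadraticAlgebra.equivProd ν 0) x = (x.re, x.im) := rfl
    rw [hxe]
    by_cases hx : x = 0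
    · simp only [if_pos hx, if_pos (hx0.mp hx)]
    · rw [if_neg hx, if_neg (fun h => hx (hx0.mpr h)), hψ']
      congr 1
      have hn := fun h => hx (hx0.mpr h)
      have hinv : algebraMap F (QuadraticAlgebra F ν 0) b / x = ⟨b * x.re / (x.re ^ 2 - ν * x.im ^ 2), - (b * x.im / (x.re ^ 2 - ν * x.im ^ 2))⟩ := by
        rw [div_eq_iff hx]
        ext
        · simp
          field_simp
          ring
        · simp
          field_simp
          ring
      rw [hinv, QuadraticAlgebra.re_add]
      field_simp

end KS

namespace KS

lemma conj_char {G : Type*} [AddCommGroup G] [Finite G] (ψ : AddChar G ℂ) (x : G) :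
    (starRingEnd ℂ) (ψ x) = ψ (-x) := by
  rw [AddChar.map_neg_eq_conj]

lemma Kl_real {F : Type*} [Field F] [Fintype F] [DecidableEq F] (ψ : AddChar F ℂ) (b : F) :
    ∃ k : ℝ, Kl ψ b = (k : ℂ) := by
  refine (Complex.conj_eq_iff_real).mp ?_
  unfold Kl
  rw [map_sum]
  refine Fintype.sum_bijective (fun x => -x) neg_bijective _ _ ?_
  intro x
  by_cases hx : x = 0
  · simp [hx]
  · rw [if_neg hx, if_neg (neg_ne_zero.mpr hx), conj_char]
    congr 1
    field_simp
    ring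

lemma tower (p r q : ℕ) [Fact p.Prime] (hp : p ≠ 2) (hq : q = p ^ r)
    (F : Type) [Field F] [Fintype F] [DecidableEq F] [CharP F p] (hcard : Fintype.card F = q)
    (ψ : AddChar F ℂ) (hψ : ψ ≠ 1) (b : F) (hb : b ≠ 0) (δ : ℝ) (hδ : 0 < δ)
    (hK : (4 + δ) * q ≤ ‖Kl ψ b‖ ^ 2) (j : ℕ) :
    ∃ (E : Type) (_ : Field E) (_ : Fintype E) (_ : DecidableEq E) (_ : CharP E p)
      (ψ' : AddChar E ℂ) (b' : E), ψ' ≠ 1 ∧ (∀ y, ψ' (y ^ q - y) = 1) ∧ b' ≠ 0 ∧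
      Fintype.card E = q ^ (2 ^ j) ∧ (4 + 4 ^ j * δ) * Fintype.card E ≤ ‖Kl ψ' b'‖ ^ 2 := by
  induction j with
  | zero =>
    refine ⟨F, inferInstance, inferInstance, inferInstance, inferInstance, ψ, b, hψ, ?_, hb, ?_, ?_⟩
    · intro y
      rw [← hcard, FiniteField.pow_card, sub_self, AddChar.map_zero_eq_one]
    · simpa using hcard
    · rw [hcard]; simpa using hK
  | succ j ih =>
    obtain ⟨E, _, _, _, _, ψ', b', h1, h2, h3, h4, h5⟩ := ih
    obtain ⟨E', i1, i2, i3, i4, ψ'', b'', g1, g2, g3, g4, g5⟩ := step p r q hp hq E ψ' h1 h2 b' h3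
    refine ⟨E', i1, i2, i3, i4, ψ'', b'', g1, g2, g3, ?_, ?_⟩
    · rw [g4, h4, ← pow_mul, pow_succ]
    · obtain ⟨k, hk⟩ := Kl_real ψ' b'
      rw [g5, hk, g4]
      rw [hk, Complex.norm_real, Real.norm_eq_abs, sq_abs] at h5
      have : (2 * (Fintype.card E : ℂ) - (k : ℂ) ^ 2) = ((2 * (Fintype.card E : ℝ) - k ^ 2 : ℝ) : ℂ) := by
        push_cast; ring
      rw [this, Complex.norm_real, Real.norm_eq_abs, sq_abs]
      push_cast
      have hc : (0 : ℝ) < Fintype.card E := by exact_mod_cast Fintype.card_pos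
      set c : ℝ := (Fintype.card E : ℝ)
      set D : ℝ := 4 ^ j * δ with hD
      have hD0 : 0 < D := by positivity
      rw [pow_succ, mul_assoc, mul_comm 4 δ, ← mul_assoc, ← hD]
      have h6 : (2 + D) * c ≤ k ^ 2 - 2 * c := by linarith
      have h7 : ((2 + D) * c) ^ 2 ≤ (k ^ 2 - 2 * c) ^ 2 := pow_le_pow_left₀ (by positivity) h6 2
      have h8 : 0 ≤ D ^ 2 * c ^ 2 := by positivity
      nlinarith

theorem weil (F : Type) [Field F] [Fintype F] [DecidableEq F] (hF : ringChar F ≠ 2)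
    (ψ : AddChar F ℂ) (hψ : ψ ≠ 1) (b : F) (hb : b ≠ 0) :
    ‖Kl ψ b‖ ^ 2 ≤ 4 * Fintype.card F := by
  by_contra hlt
  push Not at hlt
  obtain ⟨p, hchar⟩ := CharP.exists F
  obtain ⟨r, hpp, hcard⟩ := FiniteField.card F p
  have : Fact p.Prime := ⟨hpp⟩
  have hp : p ≠ 2 := by rwa [ringChar.eq F p] at hF
  set q := Fintype.card F with hqdef
  have hq1 : 1 < q := Fintype.one_lt_card
  have hq0 : (0 : ℝ) < q := by positivity
  set δ : ℝ := ‖Kl ψ b‖ ^ 2 / q - 4 with hδ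
  have hδ0 : 0 < δ := by
    rw [hδ, sub_pos, lt_div_iff₀ hq0]; exact hlt
  have hK : (4 + δ) * q ≤ ‖Kl ψ b‖ ^ 2 := by
    rw [hδ]; apply le_of_eq; field_simp; ring
  obtain ⟨n, hn⟩ := pow_unbounded_of_one_lt (4 * (q : ℝ) ^ 2 / δ) (by norm_num : (1 : ℝ) < 4)
  obtain ⟨E, _, _, _, _, ψ', b', h1, h2, h3, h4, h5⟩ := tower p r q hp hcard F rfl ψ hψ b hb δ hδ0 hK (n + 3)
  have hPP : q ^ (2 ^ (n + 3)) = q ^ (2 ^ (n + 2)) * q ^ (2 ^ (n + 2)) := by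
    rw [← pow_add]; congr 1; ring
  have hbig := Kl_big p (r * 2 ^ (n + 2)) (q ^ (2 ^ (n + 2))) r q hp (by rw [pow_mul, ← hcard])
    (by rw [h4, hPP]) hcard r.ne_zero
    (Nat.pow_lt_pow_right hq1 (by
      have : 2 ^ (n + 2) = 4 * 2 ^ n := by ring
      have := Nat.one_le_two_pow (n := n)
      omega)) ψ' h1 h2 b' h3
  have h6 : ‖Kl ψ' b'‖ ^ 2 ≤ 4 * q ^ 2 * Fintype.card E := by
    calc _ ≤ (2 * q * (q ^ (2 ^ (n + 2)) : ℕ) : ℝ) ^ 2 := pow_le_pow_left₀ (norm_nonneg _) hbig 2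
      _ = _ := by rw [h4, hPP]; push_cast; ring
  have hc : (0 : ℝ) < Fintype.card E := by exact_mod_cast Fintype.card_pos
  have h7 := le_of_mul_le_mul_right (h5.trans h6) hc
  rw [div_lt_iff₀ hδ0] at hn
  have h8 : (4 : ℝ) ^ n * δ ≤ 4 ^ (n + 3) * δ := by
    gcongr
    · norm_num
    · omega
  linarith

end KS

namespace KS

/-- quadratic Gauss sum -/
noncomputable def gs {F : Type*} [Field F] [Fintype F] [DecidableEq F] (ψ : AddChar F ℂ) : ℂ :=
  ∑ x : F, (quadraticChar F x : ℂ) * ψ x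

lemma gs_norm {F : Type*} [Field F] [Fintype F] [DecidableEq F] (hF : ringChar F ≠ 2)
    (ψ : AddChar F ℂ) (hψ : ψ ≠ 1) : ‖gs ψ‖ ^ 2 = Fintype.card F := by
  have h1 : gs ψ = gaussSum ((quadraticChar F).ringHomComp (Int.castRingHom ℂ)) ψ := rfl
  have hq : ((quadraticChar F).ringHomComp (Int.castRingHom ℂ)).IsQuadratic :=
    (quadraticChar_isQuadratic F).comp _
  have hne : (quadraticChar F).ringHomComp (Int.castRingHom ℂ) ≠ 1 := by
    obtain ⟨a, ha⟩ := quadraticChar_exists_neg_one' hF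
    intro h
    have := congrArg (fun χ : MulChar F ℂ => χ a) h
    simp [MulChar.ringHomComp_apply, ha] at this
    norm_num at this
  have h2 := gaussSum_sq hne hq (AddChar.IsPrimitive.of_ne_one hψ)
  rw [← h1] at h2
  have h3 := congrArg norm h2
  rw [norm_pow, norm_mul, Complex.norm_natCast] at h3
  rw [h3]
  have : ‖((quadraticChar F).ringHomComp (Int.castRingHom ℂ)) (-1)‖ = 1 := by
    rw [MulChar.ringHomComp_apply]
    rcases quadraticChar_dichotomy (F := F) (a := -1) (by simp) with h | h <;> simp [h]
  rw [this, one_mul]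

lemma norm_eta {F : Type*} [Field F] [Fintype F] [DecidableEq F] (a : F) (ha : a ≠ 0) :
    ‖((quadraticChar F a : ℤ) : ℂ)‖ = 1 := by
  rcases quadraticChar_dichotomy ha with h | h <;> simp [h]

lemma sum_psi_sq {F : Type*} [Field F] [Fintype F] [DecidableEq F] (hF : ringChar F ≠ 2)
    (ψ : AddChar F ℂ) (hψ : ψ ≠ 1) (t : F) (ht : t ≠ 0) :
    ∑ z : F, ψ (t * z ^ 2) = (quadraticChar F t : ℂ) * gs ψ := by
  rw [sum_sqrt hF (fun s => ψ (t * s))]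
  simp only [mul_add, mul_one, Finset.sum_add_distrib]
  have h0 : ∑ s : F, ψ (t * s) = 0 := by
    have := AddChar.sum_mulShift t (AddChar.IsPrimitive.of_ne_one hψ)
    simp only [mul_comm t]
    rw [this, if_neg ht]; simp
  rw [h0, zero_add, gs, Finset.mul_sum]
  refine Fintype.sum_bijective (fun s => t * s) (mulLeft_bijective₀ t ht) _ _ ?_
  intro s
  rw [show quadraticChar F (t * s) = quadraticChar F t * quadraticChar F s from map_mul _ _ _]
  have : ((quadraticChar F t : ℤ) : ℂ) ^ 2 = 1 := by exact_mod_cast quadraticChar_sq_one ht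
  push_cast
  linear_combination (-(ψ (t * s) * ((quadraticChar F s : ℤ) : ℂ))) * this

/-- Salie sum -/
noncomputable def Sal {F : Type*} [Field F] [Fintype F] [DecidableEq F] (ψ : AddChar F ℂ) (c : F) : ℂ :=
  ∑ x : F, (quadraticChar F x : ℂ) * ψ (x + c / x)

lemma gs_shift {F : Type*} [Field F] [Fintype F] [DecidableEq F] (ψ : AddChar F ℂ) (k : F) :
    ∑ u : F, ψ u * (quadraticChar F (u + k) : ℂ) = ψ (-k) * gs ψ := by
  rw [gs, Finset.mul_sum]
  refine Fintype.sum_bijective (fun s => s + k) (AddGroup.addRight_bijective k) _ _ ?_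
  intro s
  rw [show ψ s = ψ (-k) * ψ (s + k) by rw [← AddChar.map_add_eq_mul]; congr 1; ring]
  ring

lemma Sal_sq {F : Type*} [Field F] [Fintype F] [DecidableEq F] (hF : ringChar F ≠ 2)
    (ψ : AddChar F ℂ) (k : F) (hk : k ≠ 0) :
    Sal ψ (k ^ 2) = (ψ (-(2 * k)) + ψ (2 * k)) * gs ψ := by
  have h2 := two_ne hF
  have h22 : (2 : F) ^ 2 ≠ 0 := pow_ne_zero _ h2
  set η : F → ℂ := fun x => ((quadraticChar F x : ℤ) : ℂ) with hη
  have ηmul : ∀ x y, η (x * y) = η x * η y := by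
    intro x y
    show ((quadraticChar F (x * y) : ℤ) : ℂ) = ((quadraticChar F x : ℤ) : ℂ) * ((quadraticChar F y : ℤ) : ℂ)
    rw [map_mul]; push_cast; rfl
  have ηsq : ∀ x, x ≠ 0 → η x * η x = 1 := by
    intro x hx
    have := quadraticChar_sq_one hx
    show ((quadraticChar F x : ℤ) : ℂ) * ((quadraticChar F x : ℤ) : ℂ) = 1
    rw [← pow_two]; exact_mod_cast this
  have η0 : η 0 = 0 := by simp [hη]
  have key : ∀ x y z : F, x ≠ 0 → z ≠ 0 → y * x = z ^ 2 → η y = η x := by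
    intro x y z hx hz h
    have h3 : η y * η x = 1 := by
      rw [← ηmul, h, pow_two, ηmul, ηsq z hz]
    calc η y = η y * (η x * η x) := by rw [ηsq x hx, mul_one]
      _ = (η y * η x) * η x := by ring
      _ = η x := by rw [h3, one_mul]
  have hη4 : ∀ x, η (4 * x) = η x := by
    intro x
    rw [show (4 : F) * x = (2 * 2) * x by ring, ηmul, ηmul, ηsq 2 h2, one_mul]
  -- pointwise on x
  have hx : ∀ x : F, x ≠ 0 → 2 * η x = η (x + k ^ 2 / x + 2 * k) + η (x + k ^ 2 / x - 2 * k)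
      + ((if x = -k then η (-k) else 0) + (if x = k then η k else 0)) := by
    intro x hx
    have hkk : k ≠ -k := by
      intro h
      have : 2 * k = 0 := by linear_combination h
      exact mul_ne_zero h2 hk this
    have e1 : (x + k ^ 2 / x + 2 * k) * x = (x + k) ^ 2 := by field_simp; ring
    have e2 : (x + k ^ 2 / x - 2 * k) * x = (x - k) ^ 2 := by field_simp; ring
    by_cases h3 : x = -k
    · have h4 : x + k ^ 2 / x + 2 * k = 0 := by
        have : (x + k ^ 2 / x + 2 * k) * x = 0 := by rw [e1, h3]; ring
        exact (mul_eq_zero.mp this).resolve_right hx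
      have h5 : x - k ≠ 0 := by
        intro h; apply hkk; rw [← h3]; linear_combination -h
      rw [h4, key x _ _ hx h5 e2, η0, if_pos h3, if_neg (by rw [h3]; exact hkk.symm), ← h3]
      ring
    · have h3' : x + k ≠ 0 := fun h => h3 (by linear_combination h)
      rw [key x _ _ hx h3' e1, if_neg h3]
      by_cases h4 : x = k
      · have h5 : x + k ^ 2 / x - 2 * k = 0 := by
          have : (x + k ^ 2 / x - 2 * k) * x = 0 := by rw [e2, h4]; ring
          exact (mul_eq_zero.mp this).resolve_right hx
        rw [h5, η0, if_pos h4, h4]; ring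
      · have h4' : x - k ≠ 0 := fun h => h4 (by linear_combination h)
        rw [key x _ _ hx h4' e2, if_neg h4]; ring
  -- pointwise on u
  have hu : ∀ u : F, (η (u + 2 * k) + η (u - 2 * k)) * (1 + η (u ^ 2 - 4 * k ^ 2)) =
      2 * (η (u + 2 * k) + η (u - 2 * k)) - ((if u = -(2 * k) then η (-k) else 0) + (if u = 2 * k then η k else 0)) := by
    intro u
    have hkk : 2 * k ≠ -(2 * k) := by
      intro h
      have : 2 * (2 * k) = 0 := by linear_combination h
      exact mul_ne_zero h2 (mul_ne_zero h2 hk) this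
    rw [show u ^ 2 - 4 * k ^ 2 = (u + 2 * k) * (u - 2 * k) by ring, ηmul]
    by_cases h3 : u = -(2 * k)
    · rw [if_pos h3, if_neg (by rw [h3]; exact hkk.symm), h3,
        show -(2 * k) + 2 * k = 0 by ring, show -(2 * k) - 2 * k = 4 * (-k) by ring, η0, hη4]
      ring
    · have h3' : u + 2 * k ≠ 0 := fun h => h3 (by linear_combination h)
      rw [if_neg h3]
      by_cases h4 : u = 2 * k
      · rw [if_pos h4, h4, show 2 * k - 2 * k = 0 by ring, show 2 * k + 2 * k = 4 * k by ring, η0, hη4]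
        ring
      · have h4' : u - 2 * k ≠ 0 := fun h => h4 (by linear_combination h)
        rw [if_neg h4]
        linear_combination η (u - 2 * k) * ηsq _ h3' + η (u + 2 * k) * ηsq _ h4'
  have hS : 2 * Sal ψ (k ^ 2) = 2 * ((ψ (-(2 * k)) + ψ (2 * k)) * gs ψ) := by
    have e1 : 2 * Sal ψ (k ^ 2) =
        (∑ x : F, if x = 0 then 0 else ψ (x + k ^ 2 / x) * (η (x + k ^ 2 / x + 2 * k) + η (x + k ^ 2 / x - 2 * k)))
        + (η (-k) * ψ (-(2 * k)) + η k * ψ (2 * k)) := by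
      have e2 : η (-k) * ψ (-(2 * k)) + η k * ψ (2 * k) =
          ∑ x : F, ((if x = -k then η (-k) else 0) + (if x = k then η k else 0)) * ψ (x + k ^ 2 / x) := by
        simp only [add_mul, Finset.sum_add_distrib, ite_mul, zero_mul, Finset.sum_ite_eq', Finset.mem_univ, if_true]
        have e3 : -k + k ^ 2 / -k = -(2 * k) := by field_simp; ring
        have e4 : k + k ^ 2 / k = 2 * k := by field_simp; ring
        rw [e3, e4]
      rw [e2, ← Finset.sum_add_distrib, Sal, Finset.mul_sum]
      refine Finset.sum_congr rfl fun x _ => ?_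
      by_cases h : x = 0
      · subst h
        rw [if_pos rfl, if_neg (by simpa using hk), if_neg hk.symm]
        simp
      · rw [if_neg h, ← mul_assoc, hx x h]; ring
    rw [e1, sum_by_trace hF (k ^ 2) (pow_ne_zero _ hk) (fun u => ψ u * (η (u + 2 * k) + η (u - 2 * k)))]
    have e5 : ∀ u : F, ψ u * (η (u + 2 * k) + η (u - 2 * k)) * (1 + ((quadraticChar F (u ^ 2 - 4 * k ^ 2) : ℤ) : ℂ)) =
        2 * (ψ u * η (u + 2 * k)) + 2 * (ψ u * η (u + -(2 * k))) - ((if u = -(2 * k) then η (-k) * ψ u else 0) + (if u = 2 * k then η k * ψ u else 0)) := by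
      intro u
      rw [mul_assoc, hu u, ← sub_eq_add_neg]
      split_ifs <;> ring
    rw [Finset.sum_congr rfl (fun u _ => e5 u), Finset.sum_sub_distrib, Finset.sum_add_distrib,
      Finset.sum_add_distrib, ← Finset.mul_sum, ← Finset.mul_sum]
    simp only [hη]
    rw [gs_shift, gs_shift]
    simp only [Finset.sum_ite_eq', Finset.mem_univ, if_true, neg_neg]
    ring
  exact mul_left_cancel₀ two_ne_zero hS

lemma Sal_bound {F : Type*} [Field F] [Fintype F] [DecidableEq F] (hF : ringChar F ≠ 2)
    (ψ : AddChar F ℂ) (hψ : ψ ≠ 1) (c : F) : ‖Sal ψ c‖ ≤ 2 * Real.sqrt (Fintype.card F) := by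
  have hg : ‖gs ψ‖ = Real.sqrt (Fintype.card F) := by
    rw [← gs_norm hF ψ hψ, Real.sqrt_sq (norm_nonneg _)]
  by_cases hc : c = 0
  · subst hc
    have : Sal ψ 0 = gs ψ := by simp [Sal, gs]
    rw [this, hg]
    have := Real.sqrt_nonneg (Fintype.card F : ℝ)
    linarith
  by_cases hs : IsSquare c
  · obtain ⟨k, rfl⟩ := hs
    have hk : k ≠ 0 := by rintro rfl; simp at hc
    rw [← pow_two, Sal_sq hF ψ k hk, norm_mul, hg]
    gcongr
    refine (norm_add_le _ _).trans ?_
    rw [norm_char, norm_char]; norm_num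
  · have h1 := quadraticChar_neg_one_iff_not_isSquare.mpr hs
    have h3 : Sal ψ c = - Sal ψ c := by
      conv_lhs => rw [Sal]
      rw [Sal, ← Finset.sum_neg_distrib]
      refine Fintype.sum_bijective (fun x => c / x) ?_ _ _ ?_
      · apply Function.Involutive.bijective
        intro x
        by_cases hx : x = 0
        · simp [hx]
        · field_simp
      · intro x
        by_cases hx : x = 0
        · simp [hx]
        · have e1 : quadraticChar F (c / x) = - quadraticChar F x := by
            have : quadraticChar F (c / x) * quadraticChar F x = -1 := by
              rw [← map_mul, div_mul_cancel₀ _ hx, h1]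
            rcases quadraticChar_dichotomy hx with h | h <;> rw [h] at this ⊢ <;> linarith
          rw [e1, show c / x + c / (c / x) = x + c / x by field_simp; ring]
          push_cast; ring
    have : Sal ψ c = 0 := by
      have : 2 * Sal ψ c = 0 := by linear_combination h3
      simpa using this
    rw [this, norm_zero]; positivity

lemma Kl_bound (F : Type) [Field F] [Fintype F] [DecidableEq F] (hF : ringChar F ≠ 2)
    (ψ : AddChar F ℂ) (hψ : ψ ≠ 1) (b : F) : ‖Kl ψ b‖ ≤ 2 * Real.sqrt (Fintype.card F) := by
  have hc : (1 : ℝ) ≤ Fintype.card F := by exact_mod_cast Fintype.card_pos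
  by_cases hb : b = 0
  · subst hb
    have : Kl ψ 0 = -1 := by
      have h := AddChar.sum_eq_zero_of_ne_one hψ
      have h2 : Kl ψ 0 = ∑ x : F, (ψ x - if x = 0 then 1 else 0) := by
        unfold Kl
        refine Finset.sum_congr rfl fun x _ => ?_
        split_ifs with hx <;> simp [hx]
      rw [h2, Finset.sum_sub_distrib, h]; simp
    rw [this, norm_neg, norm_one]
    have := Real.one_le_sqrt.mpr hc
    linarith
  · have h := weil F hF ψ hψ b hb
    apply le_of_sq_le_sq _ (by positivity)
    rw [mul_pow, Real.sq_sqrt (by positivity)]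
    linarith

/-- twisted sum, uniform in the parity -/
lemma twisted_bound (F : Type) [Field F] [Fintype F] [DecidableEq F] (hF : ringChar F ≠ 2)
    (ψ : AddChar F ℂ) (hψ : ψ ≠ 1) (a b : F) (ha : a ≠ 0) (d : ℕ) :
    ‖∑ t : F, if t = 0 then 0 else (quadraticChar F t : ℂ) ^ d * ψ (a * t + b / t)‖
      ≤ 2 * Real.sqrt (Fintype.card F) := by
  have hre : (∑ t : F, if t = 0 then 0 else (quadraticChar F t : ℂ) ^ d * ψ (a * t + b / t)) =
      (quadraticChar F a : ℂ) ^ d * ∑ x : F, if x = 0 then 0 else (quadraticChar F x : ℂ) ^ d * ψ (x + (a * b) / x) := by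
    rw [Finset.mul_sum]
    refine Fintype.sum_bijective (fun t => a * t) (mulLeft_bijective₀ a ha) _ _ ?_
    intro t
    by_cases ht : t = 0
    · simp [ht]
    · rw [if_neg ht, if_neg (mul_ne_zero ha ht), map_mul]
      have : ((quadraticChar F a : ℤ) : ℂ) ^ 2 = 1 := by exact_mod_cast quadraticChar_sq_one ha
      have h2 : (((quadraticChar F a : ℤ) : ℂ) ^ d) * (((quadraticChar F a : ℤ) : ℂ) ^ d) = 1 := by
        rw [← mul_pow, ← pow_two, this, one_pow]
      rw [show a * b / (a * t) = b / t by field_simp]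
      push_cast
      rw [mul_pow]
      linear_combination (-(((quadraticChar F t : ℤ) : ℂ) ^ d * ψ (a * t + b / t))) * h2
  rw [hre, norm_mul, norm_pow, norm_eta a ha, one_pow, one_mul]
  rcases Nat.even_or_odd d with hd | hd
  · have : (∑ x : F, if x = 0 then 0 else (quadraticChar F x : ℂ) ^ d * ψ (x + (a * b) / x)) = Kl ψ (a * b) := by
      unfold Kl
      refine Finset.sum_congr rfl fun x _ => ?_
      by_cases hx : x = 0
      · simp [hx]
      · rw [if_neg hx, if_neg hx]
        rcases quadraticChar_dichotomy hx with h | h <;> rw [h] <;> simp [hd.neg_one_pow]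
    rw [this]; exact Kl_bound F hF ψ hψ _
  · have : (∑ x : F, if x = 0 then 0 else (quadraticChar F x : ℂ) ^ d * ψ (x + (a * b) / x)) = Sal ψ (a * b) := by
      unfold Sal
      refine Finset.sum_congr rfl fun x _ => ?_
      by_cases hx : x = 0
      · simp [hx]
      · rw [if_neg hx]
        rcases quadraticChar_dichotomy hx with h | h <;> rw [h] <;> simp [hd.neg_one_pow]
    rw [this]; exact Sal_bound hF ψ hψ _

end KS

namespace KS

section planch
variable {V : Type*} [AddCommGroup V] [Fintype V] [DecidableEq V]

lemma parseval (e : V → V → ℂ) (N : ℝ)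
    (hadd : ∀ w x y, e w (x + y) = e w x * e w y)
    (hneg : ∀ w x, e w (-x) = starRingEnd ℂ (e w x))
    (horth : ∀ z, ∑ w, e w z = if z = 0 then (N : ℂ) else 0) (f : V → ℝ) :
    ∑ w, ‖∑ x, (f x : ℂ) * e w x‖ ^ 2 = N * ∑ x, f x ^ 2 := by
  have h : ((∑ w, ‖∑ x, (f x : ℂ) * e w x‖ ^ 2 : ℝ) : ℂ) = ((N * ∑ x, f x ^ 2 : ℝ) : ℂ) := by
    push_cast
    have h1 : ∀ w, ((‖∑ x, (f x : ℂ) * e w x‖ : ℝ) : ℂ) ^ 2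
        = ∑ x, ∑ y, (f x : ℂ) * f y * e w (x + -y) := by
      intro w
      rw [← Complex.mul_conj', map_sum, Finset.sum_mul_sum]
      refine Finset.sum_congr rfl fun x _ => Finset.sum_congr rfl fun y _ => ?_
      rw [hadd, hneg, map_mul, Complex.conj_ofReal]; ring
    rw [Finset.sum_congr rfl (fun w _ => h1 w), Finset.sum_comm, Finset.mul_sum]
    refine Finset.sum_congr rfl fun x _ => ?_
    rw [Finset.sum_comm]
    simp only [← Finset.mul_sum, horth, ← sub_eq_add_neg, sub_eq_zero]
    simp only [mul_ite, mul_zero, Finset.sum_ite_eq, Finset.mem_univ, if_true]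
    ring
  exact_mod_cast h

lemma planch (e : V → V → ℂ) (N : ℝ) (hN : 0 < N)
    (hadd : ∀ w x y, e w (x + y) = e w x * e w y)
    (hneg : ∀ w x, e w (-x) = starRingEnd ℂ (e w x))
    (horth : ∀ z, ∑ w, e w z = if z = 0 then (N : ℂ) else 0) (f g : V → ℝ) (m : V → ℂ) (C : ℝ)
    (hC : ∀ w, ‖∑ z, m z * e w z‖ ≤ C) :
    ‖∑ x, ∑ y, m (x - y) * f x * g y‖ ≤ C * √(∑ x, f x ^ 2) * √(∑ y, g y ^ 2) := by
  have hC0 : 0 ≤ C := (norm_nonneg _).trans (hC 0)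
  have inv : ∀ z, (N : ℂ) * m z = ∑ w, (∑ u, m u * e w u) * e w (-z) := by
    intro z
    have h1 : ∀ w, (∑ u, m u * e w u) * e w (-z) = ∑ u, m u * e w (u + -z) := by
      intro w
      rw [Finset.sum_mul]
      refine Finset.sum_congr rfl fun u _ => ?_
      rw [hadd]; ring
    rw [Finset.sum_congr rfl (fun w _ => h1 w), Finset.sum_comm]
    simp only [← Finset.mul_sum, horth, ← sub_eq_add_neg, sub_eq_zero]
    simp only [mul_ite, mul_zero, Finset.sum_ite_eq', Finset.mem_univ, if_true]
    ring
  have main : (N : ℂ) * ∑ x, ∑ y, m (x - y) * f x * g y =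
      ∑ w, (∑ u, m u * e w u) * starRingEnd ℂ (∑ x, (f x : ℂ) * e w x) * (∑ y, (g y : ℂ) * e w y) := by
    rw [Finset.mul_sum]
    simp only [Finset.mul_sum]
    have h2 : ∀ x y, (N : ℂ) * (m (x - y) * f x * g y) =
        ∑ w, (∑ u, m u * e w u) * (starRingEnd ℂ ((f x : ℂ) * e w x)) * ((g y : ℂ) * e w y) := by
      intro x y
      rw [show (N : ℂ) * (m (x - y) * f x * g y) = ((N : ℂ) * m (x - y)) * (f x * g y) by ring, inv,
        Finset.sum_mul]
      refine Finset.sum_congr rfl fun w _ => ?_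
      rw [show -(x - y) = -x + y by abel, hadd, hneg, map_mul, Complex.conj_ofReal]; ring
    simp only [h2]
    have h3 : ∀ x, ∑ y, ∑ w, (∑ u, m u * e w u) * (starRingEnd ℂ ((f x : ℂ) * e w x)) * ((g y : ℂ) * e w y)
        = ∑ w, ∑ y, (∑ u, m u * e w u) * (starRingEnd ℂ ((f x : ℂ) * e w x)) * ((g y : ℂ) * e w y) :=
      fun x => Finset.sum_comm
    rw [Finset.sum_congr rfl (fun x _ => h3 x), Finset.sum_comm]
    refine Finset.sum_congr rfl fun w _ => ?_
    rw [map_sum, Finset.mul_sum, Finset.sum_comm]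
    refine Finset.sum_congr rfl fun y _ => ?_
    rw [Finset.sum_mul]
  have h4 : N * ‖∑ x, ∑ y, m (x - y) * f x * g y‖ ≤
      C * (∑ w, ‖∑ x, (f x : ℂ) * e w x‖ * ‖∑ y, (g y : ℂ) * e w y‖) := by
    have : N * ‖∑ x, ∑ y, m (x - y) * f x * g y‖ = ‖(N : ℂ) * ∑ x, ∑ y, m (x - y) * f x * g y‖ := by
      rw [norm_mul, Complex.norm_real, Real.norm_of_nonneg hN.le]
    rw [this, main, Finset.mul_sum]
    refine (norm_sum_le _ _).trans (Finset.sum_le_sum fun w _ => ?_)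
    rw [norm_mul, norm_mul, RCLike.norm_conj, mul_assoc]
    exact mul_le_mul_of_nonneg_right (hC w) (by positivity)
  have h5 := Real.sum_mul_le_sqrt_mul_sqrt Finset.univ (fun w => ‖∑ x, (f x : ℂ) * e w x‖)
    (fun w => ‖∑ y, (g y : ℂ) * e w y‖)
  rw [parseval e N hadd hneg horth, parseval e N hadd hneg horth, Real.sqrt_mul hN.le,
    Real.sqrt_mul hN.le] at h5
  have h6 : N * ‖∑ x, ∑ y, m (x - y) * f x * g y‖ ≤ N * (C * √(∑ x, f x ^ 2) * √(∑ y, g y ^ 2)) := by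
    refine h4.trans ((mul_le_mul_of_nonneg_left h5 hC0).trans (le_of_eq ?_))
    linear_combination (C * √(∑ x, f x ^ 2) * √(∑ y, g y ^ 2)) * Real.mul_self_sqrt hN.le
  exact le_of_mul_le_mul_left h6 hN
end planch

lemma char_sum {F ι : Type*} [Field F] (ψ : AddChar F ℂ) (s : Finset ι) (f : ι → F) :
    ψ (∑ i ∈ s, f i) = ∏ i ∈ s, ψ (f i) := by
  classical
  induction s using Finset.induction_on with
  | empty => simp
  | insert a s ha ih => rw [Finset.sum_insert ha, Finset.prod_insert ha, AddChar.map_add_eq_mul, ih]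

lemma gaussQ {F : Type*} [Field F] [Fintype F] [DecidableEq F] (hF : ringChar F ≠ 2)
    (ψ : AddChar F ℂ) (hψ : ψ ≠ 1) (d : ℕ) (Q : QuadraticForm F (Fin d → F))
    (hQ : ∀ x, (∀ y, QuadraticMap.polar (⇑Q) x y = 0) → x = 0) :
    ∃ κ : ℂ, ‖κ‖ = 1 ∧ ∀ t : F, t ≠ 0 →
      ∑ z, ψ (t * Q z) = κ * (quadraticChar F t : ℂ) ^ d * gs ψ ^ d := by
  have h2 := two_ne hF
  have : Invertible (2 : F) := invertibleOfNonzero h2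
  have hsep : (QuadraticMap.associated (R := F) Q).SeparatingLeft := by
    intro x hx
    apply hQ
    intro y
    have h := hx y
    have h3 := congrArg (fun B => B x y) (QuadraticMap.two_nsmul_associated F Q)
    simp only [LinearMap.smul_apply, h, smul_zero] at h3
    exact h3.symm
  obtain ⟨w, ⟨E⟩⟩ := QuadraticForm.equivalent_weightedSumSquares_units_of_nondegenerate' Q hsep
  refine ⟨∏ i, ((quadraticChar F (w i : F) : ℤ) : ℂ), ?_, ?_⟩
  · rw [norm_prod]
    exact Finset.prod_eq_one fun i _ => norm_eta _ (w i).ne_zero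
  · intro t ht
    have e1 : ∑ z, ψ (t * Q z) = ∑ y : Fin (Module.finrank F (Fin d → F)) → F, ∏ i, ψ (t * w i * (y i) ^ 2) := by
      refine Fintype.sum_equiv E.toLinearEquiv.toEquiv _ _ ?_
      intro z
      have : Q z = QuadraticMap.weightedSumSquares F w (E z) := (E.map_app z).symm
      rw [this, QuadraticMap.weightedSumSquares_apply, Finset.mul_sum, KS.char_sum]
      refine Finset.prod_congr rfl fun i _ => ?_
      congr 1
      rw [Units.smul_def, smul_eq_mul, pow_two, mul_assoc]
      rfl
    rw [e1, ← Fintype.piFinset_univ, ← Finset.prod_univ_sum (fun _ => Finset.univ) (fun i y => ψ (t * w i * y ^ 2))]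
    have e2 : ∀ i, ∑ y : F, ψ (t * w i * y ^ 2) =
        (quadraticChar F (w i : F) : ℂ) * ((quadraticChar F t : ℂ) * gs ψ) := by
      intro i
      rw [sum_psi_sq hF ψ hψ _ (mul_ne_zero ht (w i).ne_zero), map_mul]
      push_cast; ring
    rw [Finset.prod_congr rfl (fun i _ => e2 i), Finset.prod_mul_distrib, Finset.prod_const,
      Finset.card_univ, Fintype.card_fin,
      show ∀ c : ℂ, c ^ Module.finrank F (Fin d → F) = c ^ d by intro c; rw [Module.finrank_fin_fun],
      mul_pow, mul_assoc]

end KS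

namespace KS

lemma orth {F : Type*} [Field F] [Fintype F] [DecidableEq F]
    (ψ : AddChar F ℂ) (hψ : ψ ≠ 1) (d : ℕ) (Q : QuadraticForm F (Fin d → F))
    (hQ : ∀ x, (∀ y, QuadraticMap.polar (⇑Q) x y = 0) → x = 0) (z : Fin d → F) :
    ∑ w, ψ (QuadraticMap.polar (⇑Q) w z) =
      if z = 0 then (((Fintype.card (Fin d → F) : ℕ) : ℝ) : ℂ) else 0 := by
  split_ifs with hz
  · subst hz
    simp
  · obtain ⟨y, hy⟩ : ∃ y, QuadraticMap.polar (⇑Q) z y ≠ 0 := by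
      by_contra! h
      exact hz (hQ z h)
    obtain ⟨c, hc⟩ : ∃ c, ψ c ≠ 1 := by
      by_contra! h
      exact hψ (by ext x; simpa using h x)
    have hp : ∃ u, ψ (QuadraticMap.polar (⇑Q) u z) ≠ 1 := by
      refine ⟨(c / QuadraticMap.polar (⇑Q) z y) • y, ?_⟩
      rw [QuadraticMap.polar_smul_left, QuadraticMap.polar_comm (⇑Q) y z, smul_eq_mul, div_mul_cancel₀ _ hy]
      exact hc
    obtain ⟨u, hu⟩ := hp
    have h1 : ∑ w, ψ (QuadraticMap.polar (⇑Q) w z) =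
        ψ (QuadraticMap.polar (⇑Q) u z) * ∑ w, ψ (QuadraticMap.polar (⇑Q) w z) := by
      rw [Finset.mul_sum]
      symm
      refine Fintype.sum_bijective (fun w => u + w) (AddGroup.addLeft_bijective u) _ _ ?_
      intro w
      rw [QuadraticMap.polar_add_left, AddChar.map_add_eq_mul]
    have h2 : (ψ (QuadraticMap.polar (⇑Q) u z) - 1) * ∑ w, ψ (QuadraticMap.polar (⇑Q) w z) = 0 := by
      linear_combination -h1
    exact (mul_eq_zero.mp h2).resolve_left (sub_ne_zero.mpr hu)

lemma mult_bound (F : Type) [Field F] [Fintype F] [DecidableEq F] (hF : ringChar F ≠ 2)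
    (ψ : AddChar F ℂ) (hψ : ψ ≠ 1) (d : ℕ) (Q : QuadraticForm F (Fin d → F))
    (hQ : ∀ x, (∀ y, QuadraticMap.polar (⇑Q) x y = 0) → x = 0) (l : F) (hl : l ≠ 0)
    (w : Fin d → F) :
    ‖∑ z, ((if Q z = l then 1 else 0) - (Fintype.card F : ℂ)⁻¹) * ψ (QuadraticMap.polar (⇑Q) w z)‖ ≤
      2 * (Fintype.card F : ℝ) ^ (((d : ℝ) - 1) / 2) := by
  obtain ⟨κ, hκ, hg⟩ := gaussQ hF ψ hψ d Q hQ
  have hq0 : (0 : ℝ) < Fintype.card F := by exact_mod_cast Fintype.card_pos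
  have hqC : (Fintype.card F : ℂ) ≠ 0 := by exact_mod_cast hq0.ne'
  have hm : ∀ z, (Fintype.card F : ℂ) * ((if Q z = l then 1 else 0) - (Fintype.card F : ℂ)⁻¹) =
      ∑ t : F, if t = 0 then 0 else ψ (t * (Q z - l)) := by
    intro z
    have h1 := AddChar.sum_mulShift (Q z - l) (AddChar.IsPrimitive.of_ne_one hψ)
    have h2 : (∑ t : F, if t = 0 then 0 else ψ (t * (Q z - l))) =
        ∑ t : F, (ψ (t * (Q z - l)) - if t = 0 then 1 else 0) := by
      refine Finset.sum_congr rfl fun t _ => ?_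
      split_ifs with h <;> simp [h]
    rw [h2, Finset.sum_sub_distrib, h1, mul_sub, mul_inv_cancel₀ hqC]
    simp [sub_eq_zero]
  have hM : (Fintype.card F : ℂ) *
      (∑ z, ((if Q z = l then 1 else 0) - (Fintype.card F : ℂ)⁻¹) * ψ (QuadraticMap.polar (⇑Q) w z)) =
      κ * gs ψ ^ d * ∑ t : F, if t = 0 then 0 else
        (quadraticChar F t : ℂ) ^ d * ψ (-l * t + (-Q w) / t) := by
    rw [Finset.mul_sum]
    simp only [← mul_assoc, hm, Finset.sum_mul]
    rw [Finset.sum_comm, Finset.mul_sum]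
    refine Finset.sum_congr rfl fun t _ => ?_
    by_cases ht : t = 0
    · simp [ht]
    simp only [if_neg ht]
    have h3 : ∀ z, ψ (t * (Q z - l)) * ψ (QuadraticMap.polar (⇑Q) w z) =
        ψ (-l * t + (-Q w) / t) * ψ (t * Q (t⁻¹ • w + z)) := by
      intro z
      rw [← AddChar.map_add_eq_mul, ← AddChar.map_add_eq_mul]
      congr 1
      have h4 : Q (t⁻¹ • w + z) = Q (t⁻¹ • w) + Q z + QuadraticMap.polar (⇑Q) (t⁻¹ • w) z := by
        rw [QuadraticMap.polar]; ring
      rw [h4, QuadraticMap.polar_smul_left, QuadraticMap.map_smul, smul_eq_mul, smul_eq_mul]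
      field_simp
      ring
    rw [Finset.sum_congr rfl (fun z _ => h3 z), ← Finset.mul_sum]
    have h5 : ∑ z, ψ (t * Q (t⁻¹ • w + z)) = ∑ z, ψ (t * Q z) :=
      Fintype.sum_bijective (fun z => t⁻¹ • w + z) (AddGroup.addLeft_bijective _) _ _ (fun _ => rfl)
    rw [h5, hg t ht]; ring
  have hgn : ‖gs ψ‖ = √(Fintype.card F : ℝ) := by
    rw [← gs_norm hF ψ hψ, Real.sqrt_sq (norm_nonneg _)]
  have hb := twisted_bound F hF ψ hψ (-l) (-Q w) (neg_ne_zero.mpr hl) d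
  have hn := congrArg norm hM
  rw [norm_mul, norm_mul, norm_mul, norm_pow, hκ, one_mul, hgn, Complex.norm_natCast] at hn
  refine le_of_mul_le_mul_left ?_ hq0
  rw [hn]
  refine (mul_le_mul_of_nonneg_left hb (by positivity)).trans (le_of_eq ?_)
  rw [Real.sqrt_eq_rpow, ← Real.rpow_natCast, ← Real.rpow_mul hq0.le,
    show (Fintype.card F : ℝ) ^ (1 / 2 * (d : ℝ)) * (2 * (Fintype.card F : ℝ) ^ (1 / 2 : ℝ)) =
      2 * ((Fintype.card F : ℝ) ^ (1 / 2 * (d : ℝ)) * (Fintype.card F : ℝ) ^ (1 / 2 : ℝ)) by ring,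
    ← Real.rpow_add hq0,
    show (Fintype.card F : ℝ) * (2 * (Fintype.card F : ℝ) ^ (((d : ℝ) - 1) / 2)) =
      2 * ((Fintype.card F : ℝ) ^ (1 : ℝ) * (Fintype.card F : ℝ) ^ (((d : ℝ) - 1) / 2)) by
        rw [Real.rpow_one]; ring,
    ← Real.rpow_add hq0]
  congr 2
  ring

end KS

/-- Functional distance theorem for a non-degenerate quadratic form. -/
theorem stmt3 (q d : ℕ) (hd : 2 ≤ d)
    (F : Type) [Field F] [Fintype F] [DecidableEq F]
    (hq : Fintype.card F = q) (hodd : Odd q)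
    (Q : QuadraticForm F (Fin d → F))
    (hQ : ∀ x, (∀ y, QuadraticMap.polar (⇑Q) x y = 0) → x = 0)
    (f g : (Fin d → F) → ℝ) (hf : ∀ x, 0 ≤ f x) (hg : ∀ x, 0 ≤ g x)
    (l : F) (hl : l ≠ 0) :
    |(∑ x, ∑ y, if Q (x - y) = l then f x * g y else 0) -
        (q : ℝ)⁻¹ * (∑ x, f x) * (∑ y, g y)| ≤
      2 * (q : ℝ) ^ (((d : ℝ) - 1) / 2) *
        Real.sqrt (∑ x, f x ^ 2) * Real.sqrt (∑ y, g y ^ 2) := by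
  subst hq
  have hF : ringChar F ≠ 2 := by
    intro h
    have h1 := FiniteField.even_card_of_char_two h
    have h2 := Nat.odd_iff.mp hodd
    omega
  obtain ⟨ψ, hψ1⟩ := (AddChar.exists_apply_ne_zero (a := (1 : F))).mpr one_ne_zero
  have hψ : ψ ≠ 1 := by
    rintro rfl
    simp at hψ1
  have key := KS.planch (fun w z => ψ (QuadraticMap.polar (⇑Q) w z))
    ((Fintype.card (Fin d → F) : ℕ) : ℝ) (by exact_mod_cast Fintype.card_pos)
    (fun w x y => by rw [QuadraticMap.polar_add_right, AddChar.map_add_eq_mul])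
    (fun w x => by rw [QuadraticMap.polar_neg_right, KS.conj_char])
    (KS.orth ψ hψ d Q hQ) f g
    (fun z => (if Q z = l then 1 else 0) - (Fintype.card F : ℂ)⁻¹)
    _ (KS.mult_bound F hF ψ hψ d Q hQ l hl)
  refine le_trans (le_of_eq ?_) key
  rw [← Real.norm_eq_abs, ← Complex.norm_real]
  congr 1
  push_cast
  rw [mul_assoc, Finset.sum_mul_sum, Finset.mul_sum, ← Finset.sum_sub_distrib]
  refine Finset.sum_congr rfl fun x _ => ?_
  rw [Finset.mul_sum, ← Finset.sum_sub_distrib]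
  refine Finset.sum_congr rfl fun y _ => ?_
  split_ifs <;> push_cast <;> ring
end
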